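/- For all positive integers l, r, s there is a positive integer f = f(l,r,s) such that for every graph G having an induced minor isomorphic to the complete bipartite graph K_{f,f}, one of the following holds: (a) G has an induced minor isomorphic to the r-by-r wall W_{r×r}; or (b) there is an (s,l)-constellation in G. -/

import Mathlib

open SimpleGraph

/-- Two vertex sets `X` and `Y` are *anticomplete* in `G` if they are disjoint and
there is no edge of `G` with an end in each. -/
def Anticomplete {V : Type} (G : SimpleGraph V) (X Y : Set V) : Prop :=
  Disjoint X Y ∧ ∀ x ∈ X, ∀ y ∈ Y, ¬ G.Adj x y

/-- `G` has an induced subgraph isomorphic to `H`. -/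
def HasInducedSubgraphIso {V W : Type} (G : SimpleGraph V) (H : SimpleGraph W) : Prop :=
  ∃ X : Set V, Nonempty (H ≃g G.induce X)

/-- `G` has an induced minor isomorphic to `H`, witnessed by branch sets. -/
def HasInducedMinor {V W : Type} (G : SimpleGraph V) (H : SimpleGraph W) : Prop :=
  ∃ B : W → Set V,
    (∀ w, (G.induce (B w)).Connected) ∧
    (Pairwise fun u v => Disjoint (B u) (B v)) ∧
    (∀ u v : W, u ≠ v → (H.Adj u v ↔ ¬ Anticomplete G (B u) (B v)))

/-- The set `P` induces a path in `G`. -/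
def IsPathSet {V : Type} (G : SimpleGraph V) (P : Set V) : Prop :=
  ∃ n : ℕ, Nonempty (G.induce P ≃g pathGraph (n + 1))

/-- The vertex sets of the connected components of the subgraph of `G` induced on `X`. -/
def CompsOn {V : Type} (G : SimpleGraph V) (X : Set V) : Set (Set V) :=
  {L | ∃ C : (G.induce X).ConnectedComponent, L = Subtype.val '' C.supp}

/-- The induced subgraph of `G` on `W` together with the stable set `S ⊆ W` forms a
constellation: every component of `W \ S` is a path and every vertex of `S` has a
neighbor in every such component. -/
structure IsConstellationOn {V : Type} (G : SimpleGraph V) (W S : Set V) : Prop where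
  subset : S ⊆ W
  stable : ∀ x ∈ S, ∀ y ∈ S, ¬ G.Adj x y
  comp_paths : ∀ L ∈ CompsOn G (W \ S), IsPathSet G L
  dominates : ∀ x ∈ S, ∀ L ∈ CompsOn G (W \ S), ∃ y ∈ L, G.Adj x y

/-- `p` is a route of the constellation `(W, S)` in `G`: an induced path of the induced
subgraph of `G` on `W`, with its two (distinct) ends in `S` and its interior outside `S`. -/
structure IsRoute {V : Type} (G : SimpleGraph V) (W S : Set V) {x y : V}
    (p : G.Walk x y) : Prop where
  ne : x ≠ y
  isPath : p.IsPath
  induced : ∀ u v, u ∈ p.support → v ∈ p.support → G.Adj u v → p.toSubgraph.Adj u v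
  support_mem : ∀ v ∈ p.support, v ∈ W
  fst_mem : x ∈ S
  snd_mem : y ∈ S
  interior : ∀ v ∈ p.support, v ≠ x → v ≠ y → v ∉ S

/-- The constellation `(W, S)` in `G` is `d`-ample: no route has length at most `d+1`. -/
def DAmple {V : Type} (G : SimpleGraph V) (W S : Set V) (d : ℕ) : Prop :=
  ∀ ⦃x y : V⦄ (p : G.Walk x y), IsRoute G W S p → d + 1 < p.length

/-- The constellation `(W, S)` in `G` is interrupted with respect to some linear order
(encoded by an injective-on-`S` function `f : V → ℕ`). -/
def Interrupted {V : Type} (G : SimpleGraph V) (W S : Set V) : Prop :=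
  ∃ f : V → ℕ, Set.InjOn f S ∧
    ∀ x ∈ S, ∀ y ∈ S, ∀ z ∈ S, f x < f y → f y < f z →
      ∀ (p : G.Walk x y), IsRoute G W S p → ∃ v ∈ p.support, G.Adj z v

/-- The constellation `(W, S)` in `G` is `q`-zigzagged. -/
def Zigzagged {V : Type} (G : SimpleGraph V) (W S : Set V) (q : ℕ) : Prop :=
  ∃ f : V → ℕ, Set.InjOn f S ∧
    ∀ x ∈ S, ∀ y ∈ S, f x < f y →
      ∀ (p : G.Walk x y), IsRoute G W S p →
        {z | z ∈ S ∧ f x < f z ∧ f z < f y ∧ ¬ ∃ v ∈ p.support, G.Adj z v}.ncard < q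

/-- The constellation `(W, S)` in `G` is `(qm, q, qp)`-mixed. -/
def Mixed {V : Type} (G : SimpleGraph V) (W S : Set V) (qm q qp : ℕ) : Prop :=
  ∃ f : V → ℕ, Set.InjOn f S ∧
    ∀ x ∈ S, ∀ y ∈ S, f x < f y →
      ∀ (p : G.Walk x y), IsRoute G W S p →
        ∀ Qm Q Qp : Set V, Qm ⊆ S → Q ⊆ S → Qp ⊆ S →
          Qm.ncard = qm → Q.ncard = q → Qp.ncard = qp →
          (∀ z ∈ Qm, f z < f x) → (∀ z ∈ Q, f x < f z ∧ f z < f y) →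
          (∀ z ∈ Qp, f y < f z) →
          ∃ z ∈ Qm ∪ Q ∪ Qp, ∃ v ∈ p.support, G.Adj z v

/-- The constellation `(W', S')` sits in the constellation `(W, S)` (both within `G`). -/
def SitsIn {V : Type} (G : SimpleGraph V) (W' S' W S : Set V) : Prop :=
  W' ⊆ W ∧ S' ⊆ S ∧
  (∀ L ∈ CompsOn G (W' \ S'), ∃ M ∈ CompsOn G (W \ S), L ⊆ M) ∧
  (∀ M ∈ CompsOn G (W \ S), ∀ L₁ ∈ CompsOn G (W' \ S'), ∀ L₂ ∈ CompsOn G (W' \ S'),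
      L₁ ⊆ M → L₂ ⊆ M → L₁ = L₂)

/-- A witness that `S` is a subdivision of `H`, where each edge of `H` is replaced by a
path whose length satisfies `ok`. -/
structure SubdivModel {U W : Type} (S : SimpleGraph U) (H : SimpleGraph W)
    (ok : ℕ → Prop) where
  b : W → U
  b_inj : Function.Injective b
  path : ∀ ⦃u v : W⦄, H.Adj u v → S.Walk (b u) (b v)
  path_isPath : ∀ ⦃u v : W⦄ (h : H.Adj u v), (path h).IsPath
  path_len : ∀ ⦃u v : W⦄ (h : H.Adj u v), ok (path h).length
  path_symm : ∀ ⦃u v : W⦄ (h : H.Adj u v), path h.symm = (path h).reverse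
  branch_avoid : ∀ ⦃u v : W⦄ (h : H.Adj u v) (w : W), b w ∈ (path h).support → w = u ∨ w = v
  interiors_anticomplete :
    ∀ ⦃u v u' v' : W⦄ (h : H.Adj u v) (h' : H.Adj u' v'),
      (s(u, v) : Sym2 W) ≠ s(u', v') →
      ∀ x ∈ (path h).support, x ≠ b u → x ≠ b v →
      ∀ y ∈ (path h').support, y ≠ b u' → y ≠ b v' →
        x ≠ y ∧ ¬ S.Adj x y
  cover : ∀ x : U, (∃ w, x = b w) ∨ ∃ (u v : W) (h : H.Adj u v), x ∈ (path h).support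
  edges_eq : ∀ x y : U, S.Adj x y → ∃ (u v : W) (h : H.Adj u v), (path h).toSubgraph.Adj x y

/-- `S` is a subdivision of `H` with path lengths satisfying `ok`. -/
def IsSubdivisionWith {U W : Type} (S : SimpleGraph U) (H : SimpleGraph W)
    (ok : ℕ → Prop) : Prop :=
  Nonempty (SubdivModel S H ok)

/-- The line graph of `G`. -/
def LineGraph {V : Type} (G : SimpleGraph V) : SimpleGraph G.edgeSet :=
  SimpleGraph.fromRel (fun e f => ∃ v : V, v ∈ (e : Sym2 V) ∧ v ∈ (f : Sym2 V))

/-- The `r`-by-`r` hexagonal wall (brick wall). -/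
def Wall (r : ℕ) : SimpleGraph (Fin r × Fin (2 * r)) :=
  SimpleGraph.fromRel (fun a b =>
    (a.1 = b.1 ∧ a.2.val + 1 = b.2.val) ∨
    (a.2 = b.2 ∧ a.1.val + 1 = b.1.val ∧ (a.1.val + a.2.val) % 2 = 0))

/-- The full binary tree of radius `r`, on `2^(r+1) - 1` vertices (heap indexing). -/
def BinTree (r : ℕ) : SimpleGraph (Fin (2 ^ (r + 1) - 1)) :=
  SimpleGraph.fromRel (fun a b =>
    b.val + 1 = 2 * (a.val + 1) ∨ b.val + 1 = 2 * (a.val + 1) + 1)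

/-- The leaf-extension of `H` by leaves `L` attached via `f`. -/
def leafExt {W : Type} (H : SimpleGraph W) (L : Type) (f : L → W) :
    SimpleGraph (W ⊕ L) :=
  SimpleGraph.fromRel (fun a b =>
    match a, b with
    | Sum.inl a, Sum.inl b => H.Adj a b
    | Sum.inl a, Sum.inr x => f x = a
    | _, _ => False)

/-- `G` has treewidth at most `k` (via tree decompositions). -/
def TreewidthLE {V : Type} (G : SimpleGraph V) (k : ℕ) : Prop :=
  ∃ (ι : Type) (T : SimpleGraph ι) (bag : ι → Set V),
    T.IsTree ∧
    (∀ v, ∃ i, v ∈ bag i) ∧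
    (∀ u v, G.Adj u v → ∃ i, u ∈ bag i ∧ v ∈ bag i) ∧
    (∀ v, (T.induce {i | v ∈ bag i}).Connected) ∧
    (∀ i, (bag i).ncard ≤ k + 1)

/-- `G` has pathwidth at most `k` (via path decompositions). -/
def PathwidthLE {V : Type} (G : SimpleGraph V) (k : ℕ) : Prop :=
  ∃ (n : ℕ) (bag : Fin n → Set V),
    (∀ v, ∃ i, v ∈ bag i) ∧
    (∀ u v, G.Adj u v → ∃ i, u ∈ bag i ∧ v ∈ bag i) ∧
    (∀ (v : V) (i j k' : Fin n), i ≤ j → j ≤ k' → v ∈ bag i → v ∈ bag k' → v ∈ bag j) ∧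
    (∀ i, (bag i).ncard ≤ k + 1)

/-- An induced `(s,t)`-model in `G`. -/
def IsInducedModel {V : Type} (G : SimpleGraph V) {s t : ℕ}
    (A : Fin s → Set V) (B : Fin t → Set V) : Prop :=
  (∀ i, (G.induce (A i)).Connected) ∧
  (∀ j, (G.induce (B j)).Connected) ∧
  (∀ i j : Fin s, i ≠ j → Anticomplete G (A i) (A j)) ∧
  (∀ i j : Fin t, i ≠ j → Anticomplete G (B i) (B j)) ∧
  (∀ (i : Fin s) (j : Fin t), Disjoint (A i) (B j) ∧ ¬ Anticomplete G (A i) (B j))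

/-- The `A`-contraction of a model: each `A i` is contracted to the vertex `Sum.inl i`. -/
def AContraction {V : Type} (G : SimpleGraph V) {s t : ℕ}
    (A : Fin s → Set V) (B : Fin t → Set V) :
    SimpleGraph (Fin s ⊕ (⋃ j, B j : Set V)) :=
  SimpleGraph.fromRel (fun x y =>
    match x, y with
    | Sum.inl i, Sum.inl i' => i ≠ i' ∧ ∃ a ∈ A i, ∃ a' ∈ A i', G.Adj a a'
    | Sum.inl i, Sum.inr b => ∃ a ∈ A i, G.Adj a ↑b
    | Sum.inr b, Sum.inr b' => G.Adj ↑b ↑b'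
    | _, _ => False)

/-- A linear induced model is `d`-`A`-ample if its `A`-contraction is `d`-ample. -/
def ModelAAmple {V : Type} (G : SimpleGraph V) {s t : ℕ}
    (A : Fin s → Set V) (B : Fin t → Set V) (d : ℕ) : Prop :=
  DAmple (AContraction G A B) Set.univ (Set.range Sum.inl) d

/-- A linear induced model is `d`-ample if it is `d`-`A`-ample and `d`-`B`-ample. -/
def ModelAmple {V : Type} (G : SimpleGraph V) {s t : ℕ}
    (A : Fin s → Set V) (B : Fin t → Set V) (d : ℕ) : Prop :=
  ModelAAmple G A B d ∧ ModelAAmple G B A d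

/-- The zigzag sequences. -/
def Zseq : ℕ → List ℤ
  | 0 => []
  | 1 => [1]
  | 2 => [1, 2]
  | 3 => [1, 2, 3]
  | n + 4 =>
      (Zseq (n + 3)).dropLast ++ (((Zseq (n + 2)).map (· + 1)).reverse).dropLast
        ++ (Zseq (n + 3)).map (· + 1)

/-- Collapse each maximal run of consecutive equal entries to a single entry. -/
def collapse (l : List ℤ) : List ℤ := l.destutter (· ≠ ·)

/-- `B` is an alignment in the sequence `A`. -/
def IsAlignment (A : List ℤ) (B : Finset ℤ) : Prop :=
  (∀ b ∈ B, b ∈ A) ∧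
  ∃ i j : ℕ, i ≤ j ∧ j < A.length ∧
    ∀ b ∈ B,
      (collapse (((A.take (j + 1)).drop i).filter (fun a => decide (a ∈ B)))).count b = 1

namespace BicliqueMinor

/-- A vertex set is connected if it is nonempty and every property that propagates along
edges inside the set and holds somewhere on the set holds everywhere on it. -/
def ConnSet {V : Type} (Γ : SimpleGraph V) (K : Set V) : Prop :=
  K.Nonempty ∧ ∀ P : V → Prop, (∃ u ∈ K, P u) →
    (∀ a ∈ K, ∀ b ∈ K, Γ.Adj a b → P a → P b) → ∀ v ∈ K, P v

/-- Some edge joins the two sets. -/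
def Touch {V : Type} (Γ : SimpleGraph V) (X Y : Set V) : Prop :=
  ∃ x ∈ X, ∃ y ∈ Y, Γ.Adj x y

theorem Touch.symm {V : Type} {Γ : SimpleGraph V} {X Y : Set V} (h : Touch Γ X Y) :
    Touch Γ Y X := by
  obtain ⟨x, hx, y, hy, h⟩ := h
  exact ⟨y, hy, x, hx, h.symm⟩

theorem Touch.mono {V : Type} {Γ : SimpleGraph V} {X Y X' Y' : Set V} (h : Touch Γ X Y)
    (hX : X ⊆ X') (hY : Y ⊆ Y') : Touch Γ X' Y' := by
  obtain ⟨x, hx, y, hy, h⟩ := h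
  exact ⟨x, hX hx, y, hY hy, h⟩

theorem connSet_iff {V : Type} {Γ : SimpleGraph V} {K : Set V} :
    ConnSet Γ K ↔ (Γ.induce K).Connected := by
  constructor
  · rintro ⟨⟨u, hu⟩, h⟩
    rw [connected_iff_exists_forall_reachable]
    refine ⟨⟨u, hu⟩, ?_⟩
    have := h (fun v => ∃ hv : v ∈ K, (Γ.induce K).Reachable ⟨u, hu⟩ ⟨v, hv⟩)
      ⟨u, hu, hu, Reachable.refl _⟩ ?_
    · rintro ⟨v, hv⟩
      exact (this v hv).2
    · rintro a ha b hb hab ⟨_, hr⟩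
      exact ⟨hb, hr.trans (Adj.reachable (by simpa using hab))⟩
  · intro h
    obtain ⟨⟨u, hu⟩⟩ := h.nonempty
    refine ⟨⟨u, hu⟩, ?_⟩
    rintro P ⟨w, hw, hPw⟩ hP v hv
    obtain ⟨p⟩ := h.preconnected ⟨w, hw⟩ ⟨v, hv⟩
    have key : ∀ (a b : K) (p : (Γ.induce K).Walk a b), P a → P b := by
      intro a b p
      induction p with
      | nil => exact id
      | cons hadj _ ih =>
        intro ha
        exact ih (hP _ (Subtype.property _) _ (Subtype.property _) (by simpa using hadj) ha)
    exact key _ _ p hPw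

theorem ConnSet.mono_on {V : Type} {Γ Γ' : SimpleGraph V} {K : Set V} (h : ConnSet Γ K)
    (hΓ : ∀ a ∈ K, ∀ b ∈ K, Γ.Adj a b → Γ'.Adj a b) : ConnSet Γ' K :=
  ⟨h.1, fun P hP hc => h.2 P hP fun a ha b hb hab => hc a ha b hb (hΓ a ha b hb hab)⟩

theorem ConnSet.mono {V : Type} {Γ Γ' : SimpleGraph V} {K : Set V} (h : ConnSet Γ K)
    (hΓ : Γ ≤ Γ') : ConnSet Γ' K :=
  h.mono_on fun _ _ _ _ hab => hΓ hab

theorem connSet_singleton {V : Type} (Γ : SimpleGraph V) (v : V) : ConnSet Γ {v} := by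
  refine ⟨⟨v, rfl⟩, ?_⟩
  rintro P ⟨u, rfl, hu⟩ _ w rfl
  exact hu

/-- A set is connected if every vertex lies in a connected subset through a common vertex. -/
theorem connSet_of_center {V : Type} {Γ : SimpleGraph V} {K : Set V} (s : V) (hs : s ∈ K)
    (h : ∀ v ∈ K, ∃ K' ⊆ K, ConnSet Γ K' ∧ s ∈ K' ∧ v ∈ K') : ConnSet Γ K := by
  refine ⟨⟨s, hs⟩, ?_⟩
  rintro P ⟨u, hu, hPu⟩ hc v hv
  obtain ⟨K₁, hK₁, hc₁, hs₁, hu₁⟩ := h u hu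
  obtain ⟨K₂, hK₂, hc₂, hs₂, hv₂⟩ := h v hv
  have h₁ := hc₁.2 P ⟨u, hu₁, hPu⟩ (fun a ha b hb => hc a (hK₁ ha) b (hK₁ hb)) s hs₁
  exact hc₂.2 P ⟨s, hs₂, h₁⟩ (fun a ha b hb => hc a (hK₂ ha) b (hK₂ hb)) v hv₂

theorem ConnSet.biUnion {V ι : Type} {Γ : SimpleGraph V} {Λ : SimpleGraph ι} {I : Set ι}
    {K : ι → Set V} (hI : ConnSet Λ I) (hK : ∀ i ∈ I, ConnSet Γ (K i))
    (hΛ : ∀ i ∈ I, ∀ j ∈ I, Λ.Adj i j → ∃ u ∈ K i, ∃ v ∈ K j, u = v ∨ Γ.Adj u v) :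
    ConnSet Γ (⋃ i ∈ I, K i) := by
  obtain ⟨i₀, hi₀⟩ := hI.1
  obtain ⟨x₀, hx₀⟩ := (hK i₀ hi₀).1
  refine ⟨⟨x₀, Set.mem_biUnion hi₀ hx₀⟩, ?_⟩
  rintro P ⟨u, hu, hPu⟩ hc v hv
  have hall : ∀ i ∈ I, (∃ u ∈ K i, P u) → ∀ w ∈ K i, P w := fun i hi he =>
    (hK i hi).2 P he fun a ha b hb =>
      hc a (Set.mem_biUnion hi ha) b (Set.mem_biUnion hi hb)
  simp only [Set.mem_iUnion, exists_prop] at hu hv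
  obtain ⟨i, hi, hu⟩ := hu
  obtain ⟨j, hj, hv⟩ := hv
  refine hI.2 (fun i => ∀ w ∈ K i, P w) ⟨i, hi, hall i hi ⟨u, hu, hPu⟩⟩ ?_ j hj v hv
  intro a ha b hb hab hPa
  obtain ⟨x, hx, y, hy, hxy⟩ := hΛ a ha b hb hab
  refine hall b hb ⟨y, hy, ?_⟩
  rcases hxy with rfl | hxy
  · exact hPa _ hx
  · exact hc x (Set.mem_biUnion ha hx) y (Set.mem_biUnion hb hy) hxy (hPa x hx)

theorem ConnSet.union {V : Type} {Γ : SimpleGraph V} {K L : Set V} (hK : ConnSet Γ K)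
    (hL : ConnSet Γ L) (h : ∃ u ∈ K, ∃ v ∈ L, u = v ∨ Γ.Adj u v) : ConnSet Γ (K ∪ L) := by
  obtain ⟨u, hu, v, hv, huv⟩ := h
  refine ⟨⟨u, Or.inl hu⟩, ?_⟩
  rintro P ⟨w, hw, hPw⟩ hc
  have hcK : (∃ u ∈ K, P u) → ∀ w ∈ K, P w := fun he =>
    hK.2 P he fun a ha b hb => hc a (Or.inl ha) b (Or.inl hb)
  have hcL : (∃ u ∈ L, P u) → ∀ w ∈ L, P w := fun he =>
    hL.2 P he fun a ha b hb => hc a (Or.inr ha) b (Or.inr hb)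
  have huv₁ : P u → P v := by
    rcases huv with rfl | huv
    · exact id
    · exact hc u (Or.inl hu) v (Or.inr hv) huv
  have huv₂ : P v → P u := by
    rcases huv with rfl | huv
    · exact id
    · exact hc v (Or.inr hv) u (Or.inl hu) huv.symm
  have hPu : P u := by
    rcases hw with hw | hw
    · exact hcK ⟨w, hw, hPw⟩ u hu
    · exact huv₂ (hcL ⟨w, hw, hPw⟩ v hv)
  rintro x (hx | hx)
  · exact hcK ⟨u, hu, hPu⟩ x hx
  · exact hcL ⟨v, hv, huv₁ hPu⟩ x hx

theorem connSet_pair {V : Type} {Γ : SimpleGraph V} {u v : V} (h : Γ.Adj u v) :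
    ConnSet Γ {u, v} :=
  (connSet_singleton Γ u).union (connSet_singleton Γ v) ⟨u, rfl, v, rfl, Or.inr h⟩

/-- A connected set together with connected sets meeting or touching it is connected. -/
theorem ConnSet.union_star {V ι : Type} {Γ : SimpleGraph V} {K : Set V} {L : ι → Set V}
    {I : Set ι} (hK : ConnSet Γ K) (hL : ∀ i ∈ I, ConnSet Γ (L i))
    (h : ∀ i ∈ I, ∃ u ∈ K, ∃ v ∈ L i, u = v ∨ Γ.Adj u v) :
    ConnSet Γ (K ∪ ⋃ i ∈ I, L i) := by
  obtain ⟨s, hs⟩ := hK.1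
  refine connSet_of_center s (Or.inl hs) ?_
  rintro v (hv | hv)
  · exact ⟨K, Set.subset_union_left, hK, hs, hv⟩
  · simp only [Set.mem_iUnion, exists_prop] at hv
    obtain ⟨i, hi, hv⟩ := hv
    exact ⟨K ∪ L i, Set.union_subset_union_right _ (Set.subset_biUnion_of_mem hi),
      hK.union (hL i hi) (h i hi), Or.inl hs, Or.inr hv⟩

theorem connSet_image_Icc {V : Type} {Γ : SimpleGraph V} (p : ℕ → V) (a b : ℕ) (hab : a ≤ b)
    (h : ∀ i, a ≤ i → i < b → Γ.Adj (p i) (p (i + 1))) : ConnSet Γ (p '' Set.Icc a b) := by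
  induction b, hab using Nat.le_induction with
  | base => simpa using connSet_singleton Γ (p a)
  | succ b hab ih =>
    have h₁ := (ih fun i hi hib => h i hi (by omega)).union (connSet_singleton Γ (p (b + 1)))
      ⟨p b, ⟨b, ⟨hab, le_rfl⟩, rfl⟩, p (b + 1), rfl, Or.inr (h b hab (by omega))⟩
    convert h₁ using 1
    ext v
    constructor
    · rintro ⟨i, ⟨hi, hib⟩, rfl⟩
      rcases Nat.lt_or_ge i (b + 1) with hlt | hge
      · exact Or.inl ⟨i, ⟨hi, by omega⟩, rfl⟩
      · obtain rfl : i = b + 1 := by omega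
        exact Or.inr rfl
    · rintro (⟨i, ⟨hi, hib⟩, rfl⟩ | rfl)
      · exact ⟨i, ⟨hi, by omega⟩, rfl⟩
      · exact ⟨b + 1, ⟨by omega, le_rfl⟩, rfl⟩

/-- `p 0, …, p n` is an induced path of `Γ` inside `K` from `X` to `Y`, with no other vertex in
`X` or `Y`. -/
structure IsTightPath {V : Type} (Γ : SimpleGraph V) (K X Y : Set V) (p : ℕ → V) (n : ℕ) :
    Prop where
  mem : ∀ i ≤ n, p i ∈ K
  fst_mem : p 0 ∈ X
  lst_mem : p n ∈ Y
  adj : ∀ i < n, Γ.Adj (p i) (p (i + 1))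
  fst_only : ∀ i ≤ n, p i ∈ X → i = 0
  lst_only : ∀ i ≤ n, p i ∈ Y → i = n
  ne : ∀ i j, i < j → j ≤ n → p i ≠ p j
  induced : ∀ i j, i < j → j ≤ n → Γ.Adj (p i) (p j) → j = i + 1

theorem IsTightPath.inj {V : Type} {Γ : SimpleGraph V} {K X Y : Set V} {p : ℕ → V} {n : ℕ}
    (h : IsTightPath Γ K X Y p n) {i j : ℕ} (hi : i ≤ n) (hj : j ≤ n) (hij : p i = p j) :
    i = j := by
  rcases lt_trichotomy i j with hlt | heq | hlt
  · exact absurd hij (h.ne i j hlt hj)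
  · exact heq
  · exact absurd hij.symm (h.ne j i hlt hi)

theorem IsTightPath.connSet {V : Type} {Γ : SimpleGraph V} {K X Y : Set V} {p : ℕ → V} {n : ℕ}
    (h : IsTightPath Γ K X Y p n) : ConnSet Γ (p '' Set.Icc 0 n) :=
  connSet_image_Icc p 0 n (Nat.zero_le n) fun i _ hi => h.adj i hi

theorem ConnSet.exists_tightPath {V : Type} {Γ : SimpleGraph V} {K X Y : Set V}
    (hK : ConnSet Γ K) (hX : (K ∩ X).Nonempty) (hY : (K ∩ Y).Nonempty) :
    ∃ (p : ℕ → V) (n : ℕ), IsTightPath Γ K X Y p n := by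
  classical
  have hex : ∃ n : ℕ, ∃ p : ℕ → V, (∀ i ≤ n, p i ∈ K) ∧ p 0 ∈ X ∧ p n ∈ Y ∧
      ∀ i < n, Γ.Adj (p i) (p (i + 1)) := by
    obtain ⟨x, hxK, hxX⟩ := hX
    obtain ⟨y, hyK, hyY⟩ := hY
    obtain ⟨n, p, hp, h0, hn, ha⟩ := hK.2 (fun v => ∃ n : ℕ, ∃ p : ℕ → V, (∀ i ≤ n, p i ∈ K) ∧
      p 0 ∈ X ∧ p n = v ∧ ∀ i < n, Γ.Adj (p i) (p (i + 1)))
      ⟨x, hxK, 0, fun _ => x, fun _ _ => hxK, hxX, rfl, by simp⟩ (by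
        rintro a ha b hb hab ⟨n, p, hp, h0, hn, hadj⟩
        refine ⟨n + 1, fun i => if i ≤ n then p i else b, ?_, by simpa using h0, by simp, ?_⟩
        · intro i _
          dsimp only
          split_ifs with h
          · exact hp i h
          · exact hb
        · intro i hi
          rcases Nat.lt_or_ge i n with hlt | hge
          · simpa [hlt.le, Nat.succ_le_of_lt hlt] using hadj i hlt
          · obtain rfl : i = n := by omega
            simpa [hn] using hab) y hyK
    exact ⟨n, p, hp, h0, hn ▸ hyY, ha⟩
  obtain ⟨p, hp, h0, hn, ha⟩ := Nat.find_spec hex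
  set n := Nat.find hex
  have hmin : ∀ m < n, ¬ ∃ p : ℕ → V, (∀ i ≤ m, p i ∈ K) ∧ p 0 ∈ X ∧ p m ∈ Y ∧
      ∀ i < m, Γ.Adj (p i) (p (i + 1)) := fun m hm => Nat.find_min hex hm
  have hcut : ∀ i j, i + 1 < j → j ≤ n → ¬ Γ.Adj (p i) (p j) := by
    intro i j hij hj hadj
    refine hmin (n - (j - i - 1)) (by omega)
      ⟨fun k => if k ≤ i then p k else p (k + (j - i - 1)), ?_, by simpa using h0, ?_, ?_⟩
    · intro k hk
      dsimp only
      split_ifs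
      · exact hp k (by omega)
      · exact hp _ (by omega)
    · dsimp only
      rw [if_neg (by omega), Nat.sub_add_cancel (by omega)]
      exact hn
    · intro k hk
      dsimp only
      split_ifs with h₁ h₂ h₂
      · exact ha k (by omega)
      · obtain rfl : k = i := by omega
        rwa [show k + 1 + (j - k - 1) = j by omega]
      · omega
      · rw [show k + 1 + (j - i - 1) = k + (j - i - 1) + 1 by omega]
        exact ha _ (by omega)
  refine ⟨p, n, hp, h0, hn, ha, ?_, ?_, ?_, ?_⟩
  · intro i hi hiX
    by_contra h
    refine hmin (n - i) (by omega) ⟨fun k => p (k + i), fun k hk => hp _ (by omega), by simpa,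
      ?_, fun k hk => ?_⟩
    · dsimp only
      rwa [Nat.sub_add_cancel hi]
    · have := ha (k + i) (by omega)
      rwa [show k + i + 1 = k + 1 + i by omega] at this
  · intro i hi hiY
    by_contra h
    exact hmin i (by omega) ⟨p, fun k hk => hp _ (by omega), h0, hiY, fun k hk => ha k (by omega)⟩
  · intro i j hij hj heq
    rcases Nat.lt_or_ge j n with hlt | hge
    · exact hcut i (j + 1) (by omega) hlt (heq ▸ ha j hlt)
    · obtain rfl : j = n := by omega
      exact hmin i hij ⟨p, fun k hk => hp _ (by omega), h0, heq ▸ hn, fun k hk => ha k (by omega)⟩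
  · intro i j hij hj hadj
    by_contra h
    exact hcut i j (by omega) hj hadj

/-- `W` is a minor (not necessarily induced) of `Γ`. -/
def HasMinor {ι κ : Type} (Γ : SimpleGraph ι) (W : SimpleGraph κ) : Prop :=
  ∃ B : κ → Set ι, (∀ a, ConnSet Γ (B a)) ∧ (∀ a b, a ≠ b → Disjoint (B a) (B b)) ∧
    ∀ a b, W.Adj a b → Touch Γ (B a) (B b)

theorem HasMinor.of_injective {ι κ κ' : Type} {Γ : SimpleGraph ι} {W : SimpleGraph κ}
    {W' : SimpleGraph κ'} (h : HasMinor Γ W) (f : κ' → κ) (hf : Function.Injective f)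
    (hW : ∀ a b, W'.Adj a b → W.Adj (f a) (f b)) : HasMinor Γ W' := by
  obtain ⟨B, hc, hd, ht⟩ := h
  exact ⟨fun a => B (f a), fun a => hc _, fun a b hab => hd _ _ (hf.ne hab),
    fun a b hab => ht _ _ (hW a b hab)⟩

theorem HasMinor.mono {ι κ : Type} {Γ Γ' : SimpleGraph ι} {W : SimpleGraph κ}
    (h : HasMinor Γ W) (hΓ : Γ ≤ Γ') : HasMinor Γ' W := by
  obtain ⟨B, hc, hd, ht⟩ := h
  refine ⟨B, fun a => (hc a).mono hΓ, hd, fun a b hab => ?_⟩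
  obtain ⟨x, hx, y, hy, hxy⟩ := ht a b hab
  exact ⟨x, hx, y, hy, hΓ hxy⟩

theorem hasMinor_wall_of_top {ι : Type} {Γ : SimpleGraph ι} {r N : ℕ} (hN : 2 * r * r ≤ N)
    (h : HasMinor Γ (⊤ : SimpleGraph (Fin N))) : HasMinor Γ (Wall r) := by
  have hcard : Fintype.card (Fin r × Fin (2 * r)) ≤ Fintype.card (Fin N) := by
    simp only [Fintype.card_prod, Fintype.card_fin]
    nlinarith
  obtain ⟨f⟩ := Function.Embedding.nonempty_of_card_le hcard
  exact h.of_injective f f.injective fun a b hab => f.injective.ne hab.ne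

theorem hasMinor_wall_of_grid {ι : Type} {Γ : SimpleGraph ι} {r : ℕ}
    (B : Fin r × Fin (2 * r) → Set ι) (hc : ∀ a, ConnSet Γ (B a))
    (hd : ∀ a b, a ≠ b → Disjoint (B a) (B b))
    (hrow : ∀ i j j', j.val + 1 = j'.val → Touch Γ (B (i, j)) (B (i, j')))
    (hcol : ∀ i i' j, i.val + 1 = i'.val → Touch Γ (B (i, j)) (B (i', j))) :
    HasMinor Γ (Wall r) := by
  refine ⟨B, hc, hd, ?_⟩
  have key : ∀ a b : Fin r × Fin (2 * r), ((a.1 = b.1 ∧ a.2.val + 1 = b.2.val) ∨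
      (a.2 = b.2 ∧ a.1.val + 1 = b.1.val ∧ (a.1.val + a.2.val) % 2 = 0)) →
      Touch Γ (B a) (B b) := by
    rintro ⟨i, j⟩ ⟨i', j'⟩ (⟨h₁, h₂⟩ | ⟨h₁, h₂, -⟩) <;> obtain rfl := h₁
    · exact hrow _ _ _ h₂
    · exact hcol _ _ _ h₂
  rintro a b hab
  rw [Wall, SimpleGraph.fromRel_adj] at hab
  rcases hab.2 with h | h
  · exact key _ _ h
  · exact (key _ _ h).symm

theorem hasMinor_wall_of_biclique {ι : Type} {Γ : SimpleGraph ι} {r N : ℕ} (hN : 2 * r * r ≤ N)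
    (A B : Fin N → Set ι) (hA : ∀ i, ConnSet Γ (A i)) (hB : ∀ i, ConnSet Γ (B i))
    (hAd : ∀ i j, i ≠ j → Disjoint (A i) (A j)) (hBd : ∀ i j, i ≠ j → Disjoint (B i) (B j))
    (hAB : ∀ i j, Disjoint (A i) (B j)) (ht : ∀ i j, Touch Γ (A i) (B j)) :
    HasMinor Γ (Wall r) := by
  have hcard : Fintype.card (Fin r × Fin (2 * r)) ≤ Fintype.card (Fin N) := by
    simp only [Fintype.card_prod, Fintype.card_fin]
    nlinarith
  obtain ⟨f⟩ := Function.Embedding.nonempty_of_card_le hcard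
  refine hasMinor_wall_of_grid
    (fun a => if (a.1.val + a.2.val) % 2 = 0 then A (f a) else B (f a)) ?_ ?_ ?_ ?_
  · intro a
    split_ifs
    · exact hA _
    · exact hB _
  · intro a b hab
    split_ifs
    · exact hAd _ _ (f.injective.ne hab)
    · exact hAB _ _
    · exact (hAB _ _).symm
    · exact hBd _ _ (f.injective.ne hab)
  · intro i j j' h
    dsimp only
    split_ifs
    · omega
    · exact ht _ _
    · exact (ht _ _).symm
    · omega
  · intro i i' j h
    dsimp only
    split_ifs
    · omega
    · exact ht _ _
    · exact (ht _ _).symm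
    · omega

/-- The 1-subdivision of `Γ` is an induced minor of `G`, with branch sets `c` for the vertices
of `Γ` and `σ` for its edges. -/
structure IsSubdivMinor {V ι : Type} (G : SimpleGraph V) (Γ : SimpleGraph ι) (c : ι → Set V)
    (σ : Sym2 ι → Set V) : Prop where
  c_conn : ∀ i, ConnSet G (c i)
  σ_conn : ∀ e ∈ Γ.edgeSet, ConnSet G (σ e)
  c_anti : ∀ i j, i ≠ j → Anticomplete G (c i) (c j)
  c_disj_σ : ∀ i, ∀ e ∈ Γ.edgeSet, Disjoint (c i) (σ e)
  touch : ∀ e ∈ Γ.edgeSet, ∀ i ∈ e, Touch G (σ e) (c i)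
  not_touch : ∀ e ∈ Γ.edgeSet, ∀ i ∉ e, ¬ Touch G (σ e) (c i)
  σ_anti : ∀ e ∈ Γ.edgeSet, ∀ e' ∈ Γ.edgeSet, e ≠ e' → Anticomplete G (σ e) (σ e')

theorem not_touch_of_anticomplete {V : Type} {G : SimpleGraph V} {X Y : Set V}
    (h : Anticomplete G X Y) : ¬ Touch G X Y := by
  rintro ⟨x, hx, y, hy, hxy⟩
  exact h.2 x hx y hy hxy

theorem not_anticomplete_of_touch {V : Type} {G : SimpleGraph V} {X Y : Set V}
    (h : Touch G X Y) : ¬ Anticomplete G X Y := fun h' => not_touch_of_anticomplete h' h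

theorem touch_of_not_anticomplete {V : Type} {G : SimpleGraph V} {X Y : Set V}
    (h : ¬ Anticomplete G X Y) (hd : Disjoint X Y) : Touch G X Y := by
  by_contra h'
  exact h ⟨hd, fun x hx y hy hxy => h' ⟨x, hx, y, hy, hxy⟩⟩

theorem Anticomplete.symm {V : Type} {G : SimpleGraph V} {X Y : Set V}
    (h : Anticomplete G X Y) : Anticomplete G Y X :=
  ⟨h.1.symm, fun x hx y hy hxy => h.2 y hy x hx hxy.symm⟩

/-- A minor of `Γ` is an induced minor of any graph containing the 1-subdivision of `Γ` as an
induced minor. -/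
theorem IsSubdivMinor.hasInducedMinor {V ι κ : Type} [Finite κ] {G : SimpleGraph V}
    {Γ : SimpleGraph ι} {c : ι → Set V} {σ : Sym2 ι → Set V} {W : SimpleGraph κ}
    (h : IsSubdivMinor G Γ c σ) (hm : HasMinor Γ W) : HasInducedMinor G W := by
  obtain ⟨N, ⟨o⟩⟩ := Finite.exists_equiv_fin κ
  obtain ⟨B, hBc, hBd, hBt⟩ := hm
  have hBeq : ∀ {a b i}, i ∈ B a → i ∈ B b → a = b := by
    intro a b i ha hb
    by_contra hab
    exact Set.disjoint_left.1 (hBd a b hab) ha hb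
  have hBt' : ∀ a b, ∃ p q, W.Adj a b → p ∈ B a ∧ q ∈ B b ∧ Γ.Adj p q := by
    intro a b
    by_cases hab : W.Adj a b
    · obtain ⟨x, hx, y, hy, hxy⟩ := hBt a b hab
      exact ⟨x, y, fun _ => ⟨hx, hy, hxy⟩⟩
    · obtain ⟨x, -⟩ := (hBc a).1
      exact ⟨x, x, fun h' => absurd h' hab⟩
  choose p q hpq' using hBt'
  have hp : ∀ a b, W.Adj a b → p a b ∈ B a := fun a b hab => (hpq' a b hab).1
  have hq : ∀ a b, W.Adj a b → q a b ∈ B b := fun a b hab => (hpq' a b hab).2.1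
  have hpq : ∀ a b, W.Adj a b → Γ.Adj (p a b) (q a b) := fun a b hab => (hpq' a b hab).2.2
  let E : κ → Set (Sym2 ι) := fun a => {e | e ∈ Γ.edgeSet ∧
    ((∀ u ∈ e, u ∈ B a) ∨ ∃ b, W.Adj a b ∧ o a < o b ∧ e = s(p a b, q a b))}
  have hEe : ∀ {a e}, e ∈ E a → e ∈ Γ.edgeSet := fun he => he.1
  have hEend : ∀ {a e}, e ∈ E a → ∃ i ∈ B a, i ∈ e := by
    rintro a e ⟨he, h | ⟨b, hab, -, rfl⟩⟩
    · induction e with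
      | h x y => exact ⟨x, h x (Sym2.mem_mk_left x y), Sym2.mem_mk_left x y⟩
    · exact ⟨p a b, hp a b hab, Sym2.mem_mk_left _ _⟩
  have hEother : ∀ {a b e i}, a ≠ b → e ∈ E b → i ∈ B a → i ∈ e → W.Adj b a := by
    rintro a b e i hab ⟨he, h | ⟨b', hab', -, rfl⟩⟩ hi hie
    · exact absurd (hBeq hi (h i hie)) hab
    · rcases Sym2.mem_iff.1 hie with rfl | rfl
      · exact absurd (hBeq hi (hp b b' hab')) hab
      · rwa [hBeq hi (hq b b' hab')]
  have hEdisj : ∀ {a b e}, a ≠ b → e ∈ E a → e ∉ E b := by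
    rintro a b e hab ⟨he, h₁⟩ ⟨-, h₂⟩
    rcases h₁ with h₁ | ⟨a', ha, ho, rfl⟩ <;> rcases h₂ with h₂ | ⟨b', hb, ho', heq⟩
    · induction e with
      | h x y => exact hab (hBeq (h₁ x (Sym2.mem_mk_left x y)) (h₂ x (Sym2.mem_mk_left x y)))
    · subst heq
      exact hab (hBeq (h₁ _ (Sym2.mem_mk_left _ _)) (hp b b' hb))
    · exact hab (hBeq (hp a a' ha) (h₂ _ (Sym2.mem_mk_left _ _)))
    · rcases Sym2.eq_iff.1 heq with ⟨h₁, h₂⟩ | ⟨h₁, h₂⟩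
      · exact hab (hBeq (hp a a' ha) (h₁ ▸ hp b b' hb))
      · have e₁ : a = b' := hBeq (hp a a' ha) (h₁ ▸ hq b b' hb)
        have e₂ : a' = b := hBeq (hq a a' ha) (h₂ ▸ hp b b' hb)
        subst e₁ e₂
        exact absurd ho (not_lt.2 ho'.le)
  let R : κ → Set V := fun a => ⋃ i ∈ B a, (c i ∪ ⋃ e ∈ {e | e ∈ E a ∧ i ∈ e}, σ e)
  have hRmem : ∀ {a x}, x ∈ R a → (∃ i ∈ B a, x ∈ c i) ∨ ∃ e ∈ E a, x ∈ σ e := by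
    intro a x hx
    simp only [R, Set.mem_iUnion, exists_prop] at hx
    obtain ⟨i, hi, hx | hx⟩ := hx
    · exact Or.inl ⟨i, hi, hx⟩
    · simp only [Set.mem_iUnion, exists_prop] at hx
      obtain ⟨e, he, hx⟩ := hx
      exact Or.inr ⟨e, he.1, hx⟩
  have hcR : ∀ {a i}, i ∈ B a → c i ⊆ R a := by
    intro a i hi x hx
    simp only [R, Set.mem_iUnion, exists_prop]
    exact ⟨i, hi, Or.inl hx⟩
  have hσR : ∀ {a e}, e ∈ E a → σ e ⊆ R a := by
    intro a e he x hx
    obtain ⟨i, hi, hie⟩ := hEend he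
    simp only [R, Set.mem_iUnion, exists_prop]
    refine ⟨i, hi, Or.inr ?_⟩
    simp only [Set.mem_iUnion, exists_prop]
    exact ⟨e, ⟨he, hie⟩, hx⟩
  have hRd : ∀ a b, a ≠ b → Disjoint (R a) (R b) := by
    intro a b hab
    rw [Set.disjoint_left]
    intro x hxa hxb
    rcases hRmem hxa with ⟨i, hi, hx⟩ | ⟨e, he, hx⟩ <;>
      rcases hRmem hxb with ⟨j, hj, hx'⟩ | ⟨e', he', hx'⟩
    · have hij : i ≠ j := by
        rintro rfl
        exact hab (hBeq hi hj)
      exact Set.disjoint_left.1 (h.c_anti i j hij).1 hx hx'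
    · exact Set.disjoint_left.1 (h.c_disj_σ i e' (hEe he')) hx hx'
    · exact Set.disjoint_left.1 (h.c_disj_σ j e (hEe he)) hx' hx
    · have hee : e ≠ e' := by
        rintro rfl
        exact hEdisj hab he he'
      exact Set.disjoint_left.1 (h.σ_anti e (hEe he) e' (hEe he') hee).1 hx hx'
  refine ⟨R, fun a => connSet_iff.1 ?_, fun a b hab => hRd a b hab, ?_⟩
  · refine (hBc a).biUnion ?_ ?_
    · intro i hi
      refine (h.c_conn i).union_star (fun e he => h.σ_conn e (hEe he.1)) ?_
      intro e he
      obtain ⟨x, hx, y, hy, hxy⟩ := h.touch e (hEe he.1) i he.2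
      exact ⟨y, hy, x, hx, Or.inr hxy.symm⟩
    · intro i hi j hj hij
      have he : s(i, j) ∈ E a := by
        refine ⟨hij, Or.inl ?_⟩
        intro u hu
        rcases Sym2.mem_iff.1 hu with rfl | rfl
        · exact hi
        · exact hj
      obtain ⟨x, hx⟩ := (h.σ_conn _ (hEe he)).1
      refine ⟨x, Or.inr ?_, x, Or.inr ?_, Or.inl rfl⟩
      · simp only [Set.mem_iUnion, exists_prop]
        exact ⟨s(i, j), ⟨he, Sym2.mem_mk_left i j⟩, hx⟩
      · simp only [Set.mem_iUnion, exists_prop]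
        exact ⟨s(i, j), ⟨he, Sym2.mem_mk_right i j⟩, hx⟩
  · intro a b hab
    constructor
    · have key : ∀ a b, W.Adj a b → o a < o b → Touch G (R a) (R b) := by
        intro a b hW ho
        have he : s(p a b, q a b) ∈ E a := ⟨hpq a b hW, Or.inr ⟨b, hW, ho, rfl⟩⟩
        exact (h.touch _ (hEe he) (q a b) (Sym2.mem_mk_right _ _)).mono (hσR he)
          (hcR (hq a b hW))
      intro hW
      refine not_anticomplete_of_touch ?_
      rcases lt_trichotomy (o a) (o b) with hlt | heq | hlt
      · exact key a b hW hlt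
      · exact absurd (o.injective heq) hab
      · exact (key b a hW.symm hlt).symm
    · intro hna
      obtain ⟨x, hx, y, hy, hxy⟩ := touch_of_not_anticomplete hna (hRd a b hab)
      rcases hRmem hx with ⟨i, hi, hx⟩ | ⟨e, he, hx⟩ <;>
        rcases hRmem hy with ⟨j, hj, hy⟩ | ⟨e', he', hy⟩
      · have hij : i ≠ j := by
          rintro rfl
          exact hab (hBeq hi hj)
        exact absurd hxy ((h.c_anti i j hij).2 x hx y hy)
      · by_cases hie : i ∈ e'
        · exact (hEother hab he' hi hie).symm
        · exact absurd ⟨y, hy, x, hx, hxy.symm⟩ (h.not_touch e' (hEe he') i hie)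
      · by_cases hje : j ∈ e
        · exact hEother hab.symm he hj hje
        · exact absurd ⟨x, hx, y, hy, hxy⟩ (h.not_touch e (hEe he) j hje)
      · have hee : e ≠ e' := by
          rintro rfl
          exact hEdisj hab he he'
        exact absurd hxy ((h.σ_anti e (hEe he) e' (hEe he') hee).2 x hx y hy)

/-- Ramsey's theorem for hypergraphs. -/
theorem exists_ramsey (u p q : ℕ) : ∃ N : ℕ, ∀ (α : Type) (A : Finset α), N ≤ A.card →
    ∀ φ : Finset α → Prop,
      (∃ B ⊆ A, B.card = p ∧ ∀ T ⊆ B, T.card = u → φ T) ∨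
      ∃ B ⊆ A, B.card = q ∧ ∀ T ⊆ B, T.card = u → ¬ φ T := by
  classical
  induction u generalizing p q with
  | zero =>
    refine ⟨max p q, fun α A hA φ => ?_⟩
    by_cases h : φ ∅
    · obtain ⟨B, hB, hc⟩ := Finset.exists_subset_card_eq (le_trans (le_max_left p q) hA)
      exact Or.inl ⟨B, hB, hc, fun T _ hT => by rwa [Finset.card_eq_zero.1 hT]⟩
    · obtain ⟨B, hB, hc⟩ := Finset.exists_subset_card_eq (le_trans (le_max_right p q) hA)
      exact Or.inr ⟨B, hB, hc, fun T _ hT => by rwa [Finset.card_eq_zero.1 hT]⟩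
  | succ u ih =>
    suffices H : ∀ m p q, p + q = m → ∃ N : ℕ, ∀ (α : Type) (A : Finset α), N ≤ A.card →
        ∀ φ : Finset α → Prop,
          (∃ B ⊆ A, B.card = p ∧ ∀ T ⊆ B, T.card = u + 1 → φ T) ∨
          ∃ B ⊆ A, B.card = q ∧ ∀ T ⊆ B, T.card = u + 1 → ¬ φ T from H _ p q rfl
    intro m
    induction m with
    | zero =>
      intro p q hpq
      obtain rfl : p = 0 := by omega
      refine ⟨0, fun α A _ φ => Or.inl ⟨∅, by simp, by simp, fun T hT hc => ?_⟩⟩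
      rw [Finset.subset_empty.1 hT] at hc
      simp at hc
    | succ m ihm =>
      intro p q hpq
      rcases Nat.eq_zero_or_pos p with rfl | hp
      · refine ⟨0, fun α A _ φ => Or.inl ⟨∅, by simp, by simp, fun T hT hc => ?_⟩⟩
        rw [Finset.subset_empty.1 hT] at hc
        simp at hc
      rcases Nat.eq_zero_or_pos q with rfl | hq
      · refine ⟨0, fun α A _ φ => Or.inr ⟨∅, by simp, by simp, fun T hT hc => ?_⟩⟩
        rw [Finset.subset_empty.1 hT] at hc
        simp at hc
      obtain ⟨N₁, h₁⟩ := ihm (p - 1) q (by omega)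
      obtain ⟨N₂, h₂⟩ := ihm p (q - 1) (by omega)
      obtain ⟨N, hN⟩ := ih N₁ N₂
      refine ⟨N + 1, fun α A hA φ => ?_⟩
      obtain ⟨a, ha⟩ : A.Nonempty := Finset.card_pos.1 (by omega)
      have hcard : N ≤ (A.erase a).card := by
        rw [Finset.card_erase_of_mem ha]
        omega
      have hins : ∀ (B : Finset α) (ψ : Finset α → Prop), B ⊆ A.erase a →
          (∀ T ⊆ B, T.card = u → ψ (insert a T)) → (∀ T ⊆ B, T.card = u + 1 → ψ T) →
          ∀ T ⊆ insert a B, T.card = u + 1 → ψ T := by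
        intro B ψ hB hB₁ hB₂ T hT hc
        by_cases haT : a ∈ T
        · rw [← Finset.insert_erase haT]
          refine hB₁ _ ?_ (by rw [Finset.card_erase_of_mem haT]; omega)
          rwa [← Finset.subset_insert_iff]
        · exact hB₂ T ((Finset.subset_insert_iff_of_notMem haT).1 hT) hc
      rcases hN α (A.erase a) hcard (fun T => φ (insert a T)) with ⟨C, hC, hCc, hCφ⟩ | ⟨C, hC, hCc, hCφ⟩
      · rcases h₁ α C hCc.ge φ with ⟨B, hB, hBc, hBφ⟩ | ⟨B, hB, hBc, hBφ⟩
        · have haB : a ∉ B := fun h => Finset.notMem_erase a A (hC (hB h))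
          refine Or.inl ⟨insert a B, ?_, by rw [Finset.card_insert_of_notMem haB]; omega,
            hins B φ (hB.trans hC) (fun T hT => hCφ T (hT.trans hB)) hBφ⟩
          exact Finset.insert_subset ha ((hB.trans hC).trans (Finset.erase_subset _ _))
        · exact Or.inr ⟨B, (hB.trans hC).trans (Finset.erase_subset _ _), hBc, hBφ⟩
      · rcases h₂ α C hCc.ge φ with ⟨B, hB, hBc, hBφ⟩ | ⟨B, hB, hBc, hBφ⟩
        · exact Or.inl ⟨B, (hB.trans hC).trans (Finset.erase_subset _ _), hBc, hBφ⟩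
        · have haB : a ∉ B := fun h => Finset.notMem_erase a A (hC (hB h))
          refine Or.inr ⟨insert a B, ?_, by rw [Finset.card_insert_of_notMem haB]; omega,
            hins B (fun T => ¬ φ T) (hB.trans hC) (fun T hT => hCφ T (hT.trans hB)) hBφ⟩
          exact Finset.insert_subset ha ((hB.trans hC).trans (Finset.erase_subset _ _))

theorem exists_monochromatic {κ : Type} [Fintype κ] [Nonempty κ] {m T : ℕ}
    (h : Fintype.card κ * T ≤ m) (f : Fin m → κ) :
    ∃ c, ∃ e : Fin T ↪o Fin m, ∀ i, f (e i) = c := by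
  classical
  obtain ⟨c, hc⟩ := Fintype.exists_le_card_fiber_of_mul_le_card (f := f) (n := T) (by simpa using h)
  obtain ⟨B, hB, hBc⟩ := Finset.exists_subset_card_eq hc
  refine ⟨c, B.orderEmbOfFin hBc, fun i => ?_⟩
  have := hB (B.orderEmbOfFin_mem hBc i)
  simpa using this

/-- If every pair is assigned at most `k` forbidden elements, there is a large set in which no
element is forbidden for a pair of other elements. -/
theorem exists_free_embedding (n k : ℕ) : ∃ M : ℕ, ∀ Z : Fin M → Fin M → Finset (Fin M),
    (∀ a b, (Z a b).card ≤ k) → ∃ h : Fin n ↪ Fin M, ∀ a b c, a ≠ b → c ≠ a → c ≠ b →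
      h c ∉ Z (h a) (h b) := by
  classical
  obtain ⟨M, hM⟩ := exists_ramsey 3 n (6 * k + 4)
  refine ⟨M, fun Z hZ => ?_⟩
  rcases hM (Fin M) Finset.univ (by simp) (fun T => ∀ a ∈ T, ∀ b ∈ T, ∀ c ∈ T, a ≠ b → c ≠ a →
    c ≠ b → c ∉ Z a b) with ⟨B, -, hBc, hB⟩ | ⟨B, -, hBc, hB⟩
  · refine ⟨(B.orderEmbOfFin hBc).toEmbedding, fun a b c hab hca hcb => ?_⟩
    have hinj := (B.orderEmbOfFin hBc).injective
    refine hB {B.orderEmbOfFin hBc a, B.orderEmbOfFin hBc b, B.orderEmbOfFin hBc c} ?_ ?_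
      _ (by simp) _ (by simp) _ (by simp) (hinj.ne hab) (hinj.ne hca) (hinj.ne hcb)
    · intro x hx
      simp only [Finset.mem_insert, Finset.mem_singleton] at hx
      rcases hx with rfl | rfl | rfl <;> exact B.orderEmbOfFin_mem hBc _
    · exact Finset.card_eq_three.2 ⟨_, _, _, hinj.ne hab, hinj.ne hca.symm, hinj.ne hcb.symm, rfl⟩
  · exfalso
    have hsub : B.powersetCard 3 ⊆ (B ×ˢ B).biUnion fun x =>
        (Z x.1 x.2).image fun c => {x.1, x.2, c} := by
      intro T hT
      rw [Finset.mem_powersetCard] at hT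
      have := hB T hT.1 hT.2
      push Not at this
      obtain ⟨a, ha, b, hb, c, hc, hab, hca, hcb, hcZ⟩ := this
      rw [Finset.mem_biUnion]
      refine ⟨(a, b), by simp [hT.1 ha, hT.1 hb], Finset.mem_image.2 ⟨c, hcZ, ?_⟩⟩
      refine Finset.eq_of_subset_of_card_le ?_ ?_
      · intro x hx
        simp only [Finset.mem_insert, Finset.mem_singleton] at hx
        rcases hx with rfl | rfl | rfl <;> assumption
      · rw [hT.2, Finset.card_eq_three.2 ⟨a, b, c, hab, hca.symm, hcb.symm, rfl⟩]
    have h₁ := (Finset.card_le_card hsub).trans (Finset.card_biUnion_le_card_mul _ _ k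
      fun x _ => Finset.card_image_le.trans (hZ _ _))
    rw [Finset.card_powersetCard, Finset.card_product, hBc] at h₁
    have h₂ : (6 * k + 4).choose 3 * 6 = (6 * k + 4) * (6 * k + 3) * (6 * k + 2) := by
      have := Nat.descFactorial_eq_factorial_mul_choose (6 * k + 4) 3
      simp [Nat.descFactorial, Nat.factorial] at this
      nlinarith
    nlinarith

/-- A large connected graph has a vertex of large degree or a long path. -/
theorem exists_degree_or_path (Δ r : ℕ) : ∃ d : ℕ, 0 < d ∧ ∀ D : SimpleGraph (Fin d),
    ConnSet D Set.univ → (∃ v, ∃ f : Fin Δ ↪ Fin d, ∀ i, D.Adj v (f i)) ∨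
      ∃ ρ : ℕ → Fin d, (∀ i j, i < r → j < r → ρ i = ρ j → i = j) ∧
        ∀ i, i + 1 < r → D.Adj (ρ i) (ρ (i + 1)) := by
  classical
  refine ⟨(Δ + 1) ^ r + 1, Nat.succ_pos _, fun D hD => ?_⟩
  by_cases hdeg : ∃ v, Δ ≤ D.degree v
  · obtain ⟨v, hv⟩ := hdeg
    obtain ⟨B, hB, hBc⟩ := Finset.exists_subset_card_eq hv
    exact Or.inl ⟨v, (B.orderEmbOfFin hBc).toEmbedding, fun i =>
      (D.mem_neighborFinset v _).1 (hB (B.orderEmbOfFin_mem hBc i))⟩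
  right
  push Not at hdeg
  let ball : ℕ → Finset (Fin ((Δ + 1) ^ r + 1)) := fun i =>
    Nat.rec {0} (fun _ s => s ∪ s.biUnion fun v => D.neighborFinset v) i
  have hball : ∀ i, ball (i + 1) = ball i ∪ (ball i).biUnion fun v => D.neighborFinset v :=
    fun i => rfl
  have hcard : ∀ i, (ball i).card ≤ (Δ + 1) ^ i := by
    intro i
    induction i with
    | zero => simp [ball]
    | succ i ih =>
      rw [hball, pow_succ]
      refine (Finset.card_union_le _ _).trans ?_
      have := Finset.card_biUnion_le_card_mul (ball i) (fun v => D.neighborFinset v) Δ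
        fun v _ => (hdeg v).le
      nlinarith
  obtain ⟨w, hw⟩ : ∃ w, w ∉ ball r := by
    by_contra h
    push Not at h
    have := Finset.card_le_card (fun x _ => h x : (Finset.univ : Finset _) ⊆ ball r)
    rw [Finset.card_univ, Fintype.card_fin] at this
    have := hcard r
    omega
  obtain ⟨p, n, hp⟩ := hD.exists_tightPath (X := {0}) (Y := {w}) (by simp) (by simp)
  have hpb : ∀ i ≤ n, p i ∈ ball i := by
    intro i
    induction i with
    | zero =>
      intro _
      have := hp.fst_mem
      simp [ball] at this ⊢
      exact this
    | succ i ih =>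
      intro hi
      rw [hball, Finset.mem_union, Finset.mem_biUnion]
      exact Or.inr ⟨p i, ih (by omega), (D.mem_neighborFinset _ _).2 (hp.adj i (by omega))⟩
  have hmono : ∀ i j, i ≤ j → ball i ⊆ ball j := by
    intro i j hij
    induction j, hij using Nat.le_induction with
    | base => exact subset_rfl
    | succ j _ ih => exact ih.trans (hball j ▸ Finset.subset_union_left)
  have hn : r < n := by
    by_contra h
    have hl : p n = w := hp.lst_mem
    exact hw (hmono n r (by omega) (hl ▸ hpb n le_rfl))
  exact ⟨p, fun i j hi hj h => hp.inj (by omega) (by omega) h, fun i hi => hp.adj i (by omega)⟩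

/-- The vertices joined to `A` by a connected set avoiding `Z`. -/
def reachSet {V : Type} (Γ : SimpleGraph V) (A Z : Set V) : Set V :=
  {v | ∃ K, ConnSet Γ K ∧ Disjoint K Z ∧ (K ∩ A).Nonempty ∧ v ∈ K}

/-- Every connected set meeting `A` and `B` meets `Z`. -/
def Separates {V : Type} (Γ : SimpleGraph V) (A B Z : Set V) : Prop :=
  Disjoint (reachSet Γ A Z) B

/-- There are `k` disjoint connected sets meeting both `A` and `B`. -/
def Linked {V : Type} (Γ : SimpleGraph V) (A B : Set V) (k : ℕ) : Prop :=
  ∃ P : Fin k → Set V, (∀ i, ConnSet Γ (P i)) ∧ (∀ i j, i ≠ j → Disjoint (P i) (P j)) ∧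
    (∀ i, (P i ∩ A).Nonempty) ∧ ∀ i, (P i ∩ B).Nonempty

section

variable {V : Type} {Γ : SimpleGraph V} {A B Z : Set V}

theorem notMem_of_mem_reachSet {v : V} (h : v ∈ reachSet Γ A Z) : v ∉ Z := by
  obtain ⟨K, -, hd, -, hv⟩ := h
  exact Set.disjoint_left.1 hd hv

theorem mem_reachSet_of_mem {v : V} (h : v ∈ A) (hZ : v ∉ Z) : v ∈ reachSet Γ A Z :=
  ⟨{v}, connSet_singleton Γ v, by simpa using hZ, ⟨v, rfl, h⟩, rfl⟩

theorem ConnSet.subset_reachSet {K : Set V} (hK : ConnSet Γ K) (hd : Disjoint K Z) {v : V}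
    (hv : v ∈ K) (h : v ∈ reachSet Γ A Z) : K ⊆ reachSet Γ A Z := by
  obtain ⟨L, hL, hLd, ⟨a, haL, haA⟩, hvL⟩ := h
  intro w hw
  exact ⟨L ∪ K, hL.union hK ⟨v, hvL, v, hv, Or.inl rfl⟩, Set.disjoint_union_left.2 ⟨hLd, hd⟩,
    ⟨a, Or.inl haL, haA⟩, Or.inr hw⟩

theorem mem_reachSet_of_adj {v w : V} (h : v ∈ reachSet Γ A Z) (hvw : Γ.Adj v w)
    (hw : w ∉ Z) : w ∈ reachSet Γ A Z := by
  refine (connSet_pair hvw).subset_reachSet ?_ (Set.mem_insert v _) h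
    (Set.mem_insert_of_mem _ rfl)
  rw [Set.disjoint_left]
  rintro x (rfl | rfl)
  · exact notMem_of_mem_reachSet h
  · exact hw

theorem reachSet_induction {P : V → Prop} (h₀ : ∀ a ∈ A, a ∉ Z → P a)
    (h₁ : ∀ a b, P a → Γ.Adj a b → b ∉ Z → P b) {v : V} (hv : v ∈ reachSet Γ A Z) : P v := by
  obtain ⟨K, hK, hd, ⟨a, haK, haA⟩, hvK⟩ := hv
  exact hK.2 P ⟨a, haK, h₀ a haA (Set.disjoint_left.1 hd haK)⟩
    (fun x _ y hy hxy hx => h₁ x y hx hxy (Set.disjoint_left.1 hd hy)) v hvK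

theorem separates_iff : Separates Γ A B Z ↔
    ∀ K, ConnSet Γ K → (K ∩ A).Nonempty → (K ∩ B).Nonempty → ¬ Disjoint K Z := by
  constructor
  · rintro h K hK hA ⟨b, hbK, hbB⟩ hd
    exact Set.disjoint_left.1 h ⟨K, hK, hd, hA, hbK⟩ hbB
  · intro h
    rw [Separates, Set.disjoint_left]
    rintro b ⟨K, hK, hd, hA, hbK⟩ hbB
    exact h K hK hA ⟨b, hbK, hbB⟩ hd

theorem Separates.symm (h : Separates Γ A B Z) : Separates Γ B A Z := by
  rw [separates_iff] at h ⊢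
  exact fun K hK hB hA => h K hK hA hB

theorem Separates.disjoint_reachSet (h : Separates Γ A B Z) :
    Disjoint (reachSet Γ A Z) (reachSet Γ B Z) := by
  rw [Set.disjoint_left]
  rintro v ⟨K, hK, hd, ⟨a, haK, haA⟩, hvK⟩ ⟨L, hL, hLd, ⟨b, hbL, hbB⟩, hvL⟩
  exact separates_iff.1 h _ (hK.union hL ⟨v, hvK, v, hvL, Or.inl rfl⟩) ⟨a, Or.inl haK, haA⟩
    ⟨b, Or.inr hbL, hbB⟩ (Set.disjoint_union_left.2 ⟨hd, hLd⟩)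

theorem adj_deleteEdges_or {x y a b : V} (h : Γ.Adj a b) :
    (Γ.deleteEdges {s(x, y)}).Adj a b ∨ (a = x ∧ b = y) ∨ (a = y ∧ b = x) := by
  by_cases he : s(a, b) = s(x, y)
  · exact Or.inr (by simpa using he)
  · exact Or.inl (by rw [deleteEdges_adj]; exact ⟨h, by simpa using he⟩)

theorem Separates.of_deleteEdges {S : Set V} {x y : V}
    (hS : Separates (Γ.deleteEdges {s(x, y)}) A B S)
    (hy : y ∈ reachSet (Γ.deleteEdges {s(x, y)}) B S)
    (hZ : Separates (Γ.deleteEdges {s(x, y)}) A (insert x S) Z) : Separates Γ A B Z := by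
  rw [Separates, Set.disjoint_left]
  have key : ∀ v ∈ reachSet Γ A Z, v ∈ reachSet (Γ.deleteEdges {s(x, y)}) A Z ∧
      v ∈ reachSet (Γ.deleteEdges {s(x, y)}) A S := by
    intro v hv
    refine reachSet_induction (P := fun v => v ∈ reachSet (Γ.deleteEdges {s(x, y)}) A Z ∧
      v ∈ reachSet (Γ.deleteEdges {s(x, y)}) A S) ?_ ?_ hv
    · intro a ha haZ
      have h₁ : a ∈ reachSet (Γ.deleteEdges {s(x, y)}) A Z := mem_reachSet_of_mem ha haZ
      exact ⟨h₁, mem_reachSet_of_mem ha fun h => Set.disjoint_left.1 hZ h₁ (Or.inr h)⟩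
    · rintro a b ⟨h₁, h₂⟩ hab hbZ
      rcases adj_deleteEdges_or (x := x) (y := y) hab with h | ⟨rfl, -⟩ | ⟨rfl, -⟩
      · have h₃ := mem_reachSet_of_adj h₁ h hbZ
        exact ⟨h₃, mem_reachSet_of_adj h₂ h fun h => Set.disjoint_left.1 hZ h₃ (Or.inr h)⟩
      · exact absurd (Set.mem_insert _ _) (Set.disjoint_left.1 hZ h₁)
      · exact absurd hy (Set.disjoint_left.1 hS.disjoint_reachSet h₂)
  intro v hv
  exact Set.disjoint_left.1 hS (key v hv).2

theorem ConnSet.exists_last_mem {K S T : Set V} (hK : ConnSet Γ K) (hA : (K ∩ A).Nonempty)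
    (hT : (K ∩ T).Nonempty) (hST : S ⊆ T) : ∃ L ⊆ K, ∃ s ∈ T, ConnSet Γ L ∧ (L ∩ A).Nonempty ∧
      s ∈ L ∧ L ⊆ insert s (reachSet Γ A S) := by
  obtain ⟨p, n, hp⟩ := hK.exists_tightPath hA hT
  refine ⟨p '' Set.Icc 0 n, ?_, p n, hp.lst_mem, hp.connSet,
    ⟨p 0, ⟨0, by simp, rfl⟩, hp.fst_mem⟩, ⟨n, by simp, rfl⟩, ?_⟩
  · rintro _ ⟨i, ⟨-, hi⟩, rfl⟩
    exact hp.mem i hi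
  · have key : ∀ i < n, p i ∈ reachSet Γ A S := by
      intro i hi
      have hS : ∀ i < n, p i ∉ S := fun i hi h =>
        absurd (hp.lst_only i hi.le (hST h)) hi.ne
      induction i with
      | zero => exact mem_reachSet_of_mem hp.fst_mem (hS 0 hi)
      | succ i ih => exact mem_reachSet_of_adj (ih (by omega)) (hp.adj i (by omega)) (hS _ hi)
    rintro _ ⟨i, ⟨-, hi⟩, rfl⟩
    rcases hi.lt_or_eq with hlt | rfl
    · exact Or.inr (key i hlt)
    · exact Or.inl rfl

theorem Linked.exists_ends {S : Finset V} {x : V} {k : ℕ} (hS : S.card < k)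
    (h : Linked Γ A (insert x (S : Set V)) k) : ∃ (P : Fin k → Set V) (s : Fin k → V),
      (∀ i, ConnSet Γ (P i)) ∧ (∀ i j, i ≠ j → Disjoint (P i) (P j)) ∧
      (∀ i, (P i ∩ A).Nonempty) ∧ (∀ i, s i ∈ P i) ∧
      (∀ i, P i ⊆ insert (s i) (reachSet Γ A S)) ∧ Function.Injective s ∧
      Set.range s = insert x (S : Set V) := by
  classical
  obtain ⟨P, hP, hd, hA, hT⟩ := h
  choose L hLP s hsT hL hLA hsL hLs using fun i =>
    (hP i).exists_last_mem (hA i) (hT i) (Set.subset_insert x (S : Set V))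
  have hinj : Function.Injective s := by
    intro i j hij
    by_contra hne
    exact Set.disjoint_left.1 (hd i j hne) (hLP i (hsL i)) (hij ▸ hLP j (hsL j))
  refine ⟨L, s, hL, fun i j hij => (hd i j hij).mono (hLP i) (hLP j), hLA, hsL, hLs, hinj, ?_⟩
  have h₁ : Finset.univ.image s = insert x S := by
    refine Finset.eq_of_subset_of_card_le ?_ ?_
    · intro v hv
      obtain ⟨i, -, rfl⟩ := Finset.mem_image.1 hv
      simpa using hsT i
    · rw [Finset.card_image_of_injective _ hinj, Finset.card_univ, Fintype.card_fin]
      exact (Finset.card_insert_le _ _).trans hS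
  have := congrArg (fun s : Finset V => (s : Set V)) h₁
  simpa using this

theorem Linked.concat {S : Finset V} {x y : V} {k : ℕ} {Γ' : SimpleGraph V} (hΓ : Γ' ≤ Γ)
    (hxy : Γ.Adj x y) (hS : S.card < k)
    (hsep : Separates Γ' A B S) (hx : x ∈ reachSet Γ' A S) (hy : y ∈ reachSet Γ' B S)
    (h₁ : Linked Γ' A (insert x (S : Set V)) k) (h₂ : Linked Γ' B (insert y (S : Set V)) k) :
    Linked Γ A B k := by
  classical
  obtain ⟨P, s, hP, hPd, hPA, hsP, hPs, hs, hsr⟩ := h₁.exists_ends hS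
  obtain ⟨Q, t, hQ, hQd, hQB, htQ, hQt, ht, htr⟩ := h₂.exists_ends hS
  have hdis := Set.disjoint_left.1 hsep.disjoint_reachSet
  have hxS : x ∉ (S : Set V) := notMem_of_mem_reachSet hx
  have hyS : y ∉ (S : Set V) := notMem_of_mem_reachSet hy
  have hsT : ∀ i, s i = x ∨ s i ∈ (S : Set V) := fun i => by
    have : s i ∈ Set.range s := ⟨i, rfl⟩
    rwa [hsr] at this
  have hex : ∀ i, ∃ j, t j = if s i = x then y else s i := by
    intro i
    have : (if s i = x then y else s i) ∈ Set.range t := by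
      rw [htr]
      split_ifs with h
      · exact Or.inl rfl
      · exact Or.inr ((hsT i).resolve_left h)
    exact this
  choose j hj using hex
  have hjinj : ∀ i i', j i = j i' → i = i' := by
    intro i i' h
    have h' := hj i
    rw [h, hj i'] at h'
    apply hs
    split_ifs at h' with h₁ h₂ h₂
    · rw [h₁, h₂]
    · exact absurd ((hsT i).resolve_left h₂) (h' ▸ hyS)
    · exact absurd ((hsT i').resolve_left h₁) (h' ▸ hyS)
    · exact h'.symm
  have hPQ : ∀ i i', i ≠ i' → Disjoint (P i) (Q (j i')) := by
    intro i i' hii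
    rw [Set.disjoint_left]
    intro v hv hv'
    have hji := hj i'
    rcases hPs i hv with h₁ | h₁ <;> rcases hQt _ hv' with h₂ | h₂
    · rw [← h₂, h₁] at hji
      split_ifs at hji with h₃
      · rcases hsT i with h₄ | h₄
        · exact hxy.ne (h₄ ▸ hji)
        · exact hyS (hji ▸ h₄)
      · exact hii (hs hji)
    · rcases hsT i with h₄ | h₄
      · exact hdis hx (by rw [← h₄, ← h₁]; exact h₂)
      · exact notMem_of_mem_reachSet h₂ (by rw [h₁]; exact h₄)
    · rw [← h₂] at hji
      split_ifs at hji with h₃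
      · exact hdis h₁ (hji ▸ hy)
      · exact notMem_of_mem_reachSet h₁ (hji ▸ (hsT i').resolve_left h₃)
    · exact hdis h₁ h₂
  refine ⟨fun i => P i ∪ Q (j i), fun i => ?_, fun i i' hii => ?_, fun i => ?_, fun i => ?_⟩
  · refine ((hP i).mono hΓ).union ((hQ (j i)).mono hΓ) ⟨s i, hsP i, t (j i), htQ _, ?_⟩
    rw [hj i]
    split_ifs with h
    · rw [h]
      exact Or.inr hxy
    · exact Or.inl rfl
  · rw [Set.disjoint_union_left, Set.disjoint_union_right, Set.disjoint_union_right]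
    exact ⟨⟨hPd i i' hii, hPQ i i' hii⟩, (hPQ i' i hii.symm).symm,
      hQd _ _ fun h => hii (hjinj i i' h)⟩
  · exact (hPA i).mono (Set.inter_subset_inter_left _ Set.subset_union_left)
  · exact (hQB _).mono (Set.inter_subset_inter_left _ Set.subset_union_right)

theorem Linked.symm {k : ℕ} (h : Linked Γ A B k) : Linked Γ B A k := by
  obtain ⟨P, hP, hd, hA, hB⟩ := h
  exact ⟨P, hP, hd, hB, hA⟩

theorem exists_crossing_of_not_separates {S : Set V} {x y : V}
    (hS : Separates (Γ.deleteEdges {s(x, y)}) A B S) (h : ¬ Separates Γ A B S) :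
    (x ∈ reachSet (Γ.deleteEdges {s(x, y)}) A S ∧ y ∈ reachSet (Γ.deleteEdges {s(x, y)}) B S) ∨
    (y ∈ reachSet (Γ.deleteEdges {s(x, y)}) A S ∧
      x ∈ reachSet (Γ.deleteEdges {s(x, y)}) B S) := by
  by_contra hcon
  push Not at hcon
  apply h
  rw [Separates, Set.disjoint_left]
  intro v hv hvB
  have hdis := Set.disjoint_left.1 hS.disjoint_reachSet
  suffices H : v ∉ S ∧ v ∉ reachSet (Γ.deleteEdges {s(x, y)}) B S from
    H.2 (mem_reachSet_of_mem hvB H.1)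
  by_cases hx : x ∈ reachSet (Γ.deleteEdges {s(x, y)}) A S ↔
      y ∈ reachSet (Γ.deleteEdges {s(x, y)}) A S
  · have : v ∈ reachSet (Γ.deleteEdges {s(x, y)}) A S := by
      refine reachSet_induction (P := fun v => v ∈ reachSet (Γ.deleteEdges {s(x, y)}) A S)
        (fun a ha haS => mem_reachSet_of_mem ha haS) ?_ hv
      intro a b ha hab hb
      rcases adj_deleteEdges_or (x := x) (y := y) hab with h | ⟨rfl, rfl⟩ | ⟨rfl, rfl⟩
      · exact mem_reachSet_of_adj ha h hb
      · exact hx.1 ha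
      · exact hx.2 ha
    exact ⟨notMem_of_mem_reachSet this, hdis this⟩
  · refine reachSet_induction (P := fun v => v ∉ S ∧ v ∉ reachSet (Γ.deleteEdges {s(x, y)}) B S)
      ?_ ?_ hv
    · intro a ha haS
      exact ⟨haS, hdis (mem_reachSet_of_mem ha haS)⟩
    · rintro a b ⟨haS, ha⟩ hab hb
      refine ⟨hb, fun hbB => ?_⟩
      rcases adj_deleteEdges_or (x := x) (y := y) hab with h | ⟨rfl, rfl⟩ | ⟨rfl, rfl⟩
      · exact ha (mem_reachSet_of_adj hbB h.symm haS)
      · have h₁ := fun h => hcon.1 h hbB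
        have h₂ : b ∉ reachSet (Γ.deleteEdges {s(a, b)}) A S := fun h => hdis h hbB
        exact hx ⟨fun h => absurd h h₁, fun h => absurd h h₂⟩
      · have h₁ := fun h => hcon.2 h hbB
        have h₂ : b ∉ reachSet (Γ.deleteEdges {s(b, a)}) A S := fun h => hdis h hbB
        exact hx ⟨fun h => absurd h h₂, fun h => absurd h h₁⟩

end

/-- Menger's theorem. -/
theorem exists_separates_or_linked {V : Type} [Finite V] (Γ : SimpleGraph V) (A B : Set V)
    (k : ℕ) : (∃ Z : Finset V, Z.card < k ∧ Separates Γ A B Z) ∨ Linked Γ A B k := by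
  classical
  have := Fintype.ofFinite V
  induction hm : Γ.edgeSet.ncard using Nat.strong_induction_on generalizing Γ A B with
  | _ m ih =>
  by_cases he : ∃ x y, Γ.Adj x y
  · obtain ⟨x, y, hxy⟩ := he
    have hlt : (Γ.deleteEdges {s(x, y)}).edgeSet.ncard < m := by
      rw [← hm]
      refine Set.ncard_lt_ncard ?_ (Set.toFinite _)
      rw [edgeSet_deleteEdges]
      exact ⟨Set.sdiff_subset, fun h => (h (show s(x, y) ∈ Γ.edgeSet from hxy)).2 rfl⟩
    have hle : Γ.deleteEdges {s(x, y)} ≤ Γ := deleteEdges_le _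
    have ih' := fun A B => ih _ hlt (Γ.deleteEdges {s(x, y)}) A B rfl
    rcases ih' A B with ⟨S, hSk, hS⟩ | ⟨P, hP, hPr⟩
    · by_cases hsep : Separates Γ A B S
      · exact Or.inl ⟨S, hSk, hsep⟩
      have main : ∀ x y, Γ.Adj x y → Separates (Γ.deleteEdges {s(x, y)}) A B S →
          x ∈ reachSet (Γ.deleteEdges {s(x, y)}) A S →
          y ∈ reachSet (Γ.deleteEdges {s(x, y)}) B S →
          (∀ A B, (∃ Z : Finset V, Z.card < k ∧ Separates (Γ.deleteEdges {s(x, y)}) A B Z) ∨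
            Linked (Γ.deleteEdges {s(x, y)}) A B k) →
          (∃ Z : Finset V, Z.card < k ∧ Separates Γ A B Z) ∨ Linked Γ A B k := by
        intro x y hxy hS hx hy ih'
        rcases ih' A (insert x S) with ⟨Z, hZk, hZ⟩ | h₁
        · exact Or.inl ⟨Z, hZk, hS.of_deleteEdges hy hZ⟩
        rcases ih' B (insert y S) with ⟨Z, hZk, hZ⟩ | h₂
        · refine Or.inl ⟨Z, hZk, ?_⟩
          rw [Sym2.eq_swap] at hS hx hZ
          exact (hS.symm.of_deleteEdges hx hZ).symm
        exact Or.inr (Linked.concat (deleteEdges_le _) hxy hSk hS hx hy h₁ h₂)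
      rcases exists_crossing_of_not_separates hS hsep with ⟨hx, hy⟩ | ⟨hy, hx⟩
      · exact main x y hxy hS hx hy ih'
      · rw [Sym2.eq_swap] at hS hx hy ih'
        exact main y x hxy.symm hS hy hx ih'
    · exact Or.inr ⟨P, fun i => (hP i).mono hle, hPr⟩
  · push Not at he
    by_cases hc : (A ∩ B).toFinset.card < k
    · refine Or.inl ⟨_, hc, ?_⟩
      rw [Separates, Set.disjoint_left]
      intro v hv hvB
      have hvA : v ∈ A := reachSet_induction (P := fun v => v ∈ A) (fun a ha _ => ha)
        (fun a b _ hab => absurd hab (he a b)) hv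
      exact notMem_of_mem_reachSet hv (by simp [hvA, hvB])
    · obtain ⟨T, hT, hTk⟩ := Finset.exists_subset_card_eq (not_lt.1 hc)
      have e := (Finset.equivFinOfCardEq hTk).symm
      have hmem : ∀ i, (e i : V) ∈ A ∩ B := fun i => by
        have := hT (e i).2
        simpa using this
      refine Or.inr ⟨fun i => {(e i : V)}, fun i => connSet_singleton _ _, fun i j hij => ?_,
        fun i => ⟨_, rfl, (hmem i).1⟩, fun i => ⟨_, rfl, (hmem i).2⟩⟩
      simpa [Subtype.ext_iff] using fun h => hij (e.injective (Subtype.ext h))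

/-- Within `K`, the sets `C x` and `C y` are joined by an edge or by a connected set avoiding all
the sets `C z` with `z ∈ S`. -/
def Dir {V ι : Type} (Γ : SimpleGraph V) (K : Set V) (C : ι → Set V) (S : Set ι) (x y : ι) :
    Prop :=
  Touch Γ (K ∩ C x) (K ∩ C y) ∨ ∃ L ⊆ K, ConnSet Γ L ∧ (∀ z ∈ S, Disjoint L (C z)) ∧
    Touch Γ L (K ∩ C x) ∧ Touch Γ L (K ∩ C y)

section

variable {V ι : Type} {Γ : SimpleGraph V} {K : Set V} {C : ι → Set V} {S : Set ι}

theorem Dir.symm {x y : ι} (h : Dir Γ K C S x y) : Dir Γ K C S y x := by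
  rcases h with h | ⟨L, hLK, hL, hd, hx, hy⟩
  · exact Or.inl h.symm
  · exact Or.inr ⟨L, hLK, hL, hd, hy, hx⟩

theorem Dir.anti {S' : Set ι} {x y : ι} (h : Dir Γ K C S x y) (hS : S' ⊆ S) :
    Dir Γ K C S' x y := by
  rcases h with h | ⟨L, hLK, hL, hd, hx, hy⟩
  · exact Or.inl h
  · exact Or.inr ⟨L, hLK, hL, fun z hz => hd z (hS hz), hx, hy⟩

theorem Dir.exists_connector {x y : ι} (h : Dir Γ K C S x y) (hx : x ∈ S)
    (hC : ∀ z ∈ S, ∀ z' ∈ S, z ≠ z' → Disjoint (C z) (C z')) :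
    ∃ M ⊆ K, ConnSet Γ M ∧ (M ∩ C x).Nonempty ∧ (∀ z ∈ S, z ≠ x → Disjoint M (C z)) ∧
      Touch Γ M (K ∩ C y) := by
  rcases h with ⟨u, ⟨huK, hux⟩, v, hv, huv⟩ | ⟨L, hLK, hL, hd, ⟨w, hw, u, ⟨huK, hux⟩, hwu⟩, hy⟩
  · refine ⟨{u}, by simpa using huK, connSet_singleton _ _, ⟨u, rfl, hux⟩, fun z hz hzx => ?_,
      u, rfl, v, hv, huv⟩
    rw [Set.disjoint_singleton_left]
    exact Set.disjoint_left.1 (hC x hx z hz hzx.symm) hux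
  · refine ⟨L ∪ {u}, Set.union_subset hLK (by simpa using huK),
      hL.union (connSet_singleton _ _) ⟨w, hw, u, rfl, Or.inr hwu⟩, ⟨u, Or.inr rfl, hux⟩,
      fun z hz hzx => ?_, hy.mono Set.subset_union_left subset_rfl⟩
    rw [Set.disjoint_union_left, Set.disjoint_singleton_left]
    exact ⟨hd z hz, Set.disjoint_left.1 (hC x hx z hz hzx.symm) hux⟩

/-- A property propagating along direct connections holds for every `C y` met by a connected set
all of whose edges lie in some `C x` or some row. -/
theorem ConnSet.dir_propagate {β : Type} {H : SimpleGraph V} {Q : Set V} (hQ : ConnSet H Q)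
    {R : β → Set V} (hR : ∀ b b', b ≠ b' → Disjoint (R b) (R b'))
    (hC : ∀ z ∈ S, ∀ z' ∈ S, z ≠ z' → Disjoint (C z) (C z'))
    (hH : ∀ a ∈ Q, ∀ b ∈ Q, H.Adj a b → (∃ x ∈ S, a ∈ C x ∧ b ∈ C x) ∨
      ∃ i, a ∈ R i ∧ b ∈ R i ∧ Γ.Adj a b)
    {P : ι → Prop} (hP : ∀ x ∈ S, ∀ y ∈ S, x ≠ y → P x → (∃ b, Dir Γ (R b) C S x y) →
      (Q ∩ C y).Nonempty → P y)
    {x₀ : ι} (hx₀ : x₀ ∈ S) (hPx₀ : P x₀) (hQx₀ : (Q ∩ C x₀).Nonempty)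
    {y : ι} (hy : y ∈ S) (hQy : (Q ∩ C y).Nonempty) : P y := by
  classical
  have hCeq : ∀ {x z v}, x ∈ S → z ∈ S → v ∈ C x → v ∈ C z → x = z := by
    intro x z v hx hz hv hv'
    by_contra hne
    exact Set.disjoint_left.1 (hC x hx z hz hne) hv hv'
  have hReq : ∀ {b b' v}, v ∈ R b → v ∈ R b' → b = b' := by
    intro b b' v hv hv'
    by_contra hne
    exact Set.disjoint_left.1 (hR b b' hne) hv hv'
  have hP' : ∀ x ∈ S, ∀ y ∈ S, P x → (∃ b, Dir Γ (R b) C S x y) → (Q ∩ C y).Nonempty → P y := by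
    intro x hx y hy hPx hD hQ
    by_cases hxy : x = y
    · exact hxy ▸ hPx
    · exact hP x hx y hy hxy hPx hD hQ
  have key := hQ.2 (fun v => (∃ x ∈ S, v ∈ C x ∧ P x) ∨ ((∀ x ∈ S, v ∉ C x) ∧
    ∃ b, ∃ L ⊆ R b, ConnSet Γ L ∧ (∀ z ∈ S, Disjoint L (C z)) ∧ v ∈ L ∧
      ∃ x ∈ S, P x ∧ Touch Γ L (R b ∩ C x))) ?_ ?_
  · obtain ⟨v, hvQ, hv⟩ := hQy
    rcases key v hvQ with ⟨x, hx, hvx, hPx⟩ | ⟨h, -⟩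
    · exact hCeq hx hy hvx hv ▸ hPx
    · exact absurd hv (h y hy)
  · obtain ⟨v, hvQ, hv⟩ := hQx₀
    exact ⟨v, hvQ, Or.inl ⟨x₀, hx₀, hv, hPx₀⟩⟩
  · intro a ha b hb hab hPa
    rcases hPa with ⟨x, hx, hax, hPx⟩ | ⟨hna, i, L, hLR, hL, hLd, haL, x, hx, hPx, ht⟩
    · rcases hH a ha b hb hab with ⟨z, hz, haz, hbz⟩ | ⟨i, hai, hbi, hΓ⟩
      · exact Or.inl ⟨z, hz, hbz, hCeq hx hz hax haz ▸ hPx⟩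
      · by_cases hbC : ∃ z ∈ S, b ∈ C z
        · obtain ⟨z, hz, hbz⟩ := hbC
          refine Or.inl ⟨z, hz, hbz, hP' x hx z hz hPx ⟨i, Or.inl ?_⟩ ⟨b, hb, hbz⟩⟩
          exact ⟨a, ⟨hai, hax⟩, b, ⟨hbi, hbz⟩, hΓ⟩
        · push Not at hbC
          exact Or.inr ⟨hbC, i, {b}, by simpa using hbi, connSet_singleton _ _,
            fun z hz => Set.disjoint_singleton_left.2 (hbC z hz), rfl, x, hx, hPx,
            b, rfl, a, ⟨hai, hax⟩, hΓ.symm⟩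
    · rcases hH a ha b hb hab with ⟨z, hz, haz, hbz⟩ | ⟨j, haj, hbj, hΓ⟩
      · exact absurd haz (hna z hz)
      obtain rfl : i = j := hReq (hLR haL) haj
      by_cases hbC : ∃ z ∈ S, b ∈ C z
      · obtain ⟨z, hz, hbz⟩ := hbC
        exact Or.inl ⟨z, hz, hbz, hP' x hx z hz hPx ⟨i, Or.inr ⟨L, hLR, hL, hLd, ht,
          a, haL, b, ⟨hbj, hbz⟩, hΓ⟩⟩ ⟨b, hb, hbz⟩⟩
      · push Not at hbC
        refine Or.inr ⟨hbC, i, L ∪ {b}, Set.union_subset hLR (by simpa using hbj),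
          hL.union (connSet_singleton _ _) ⟨a, haL, b, rfl, Or.inr hΓ⟩, fun z hz => ?_,
          Or.inr rfl, x, hx, hPx, ht.mono Set.subset_union_left subset_rfl⟩
        exact Set.disjoint_union_left.2 ⟨hLd z hz, Set.disjoint_singleton_left.2 (hbC z hz)⟩

/-- The graph of direct connections within `K` between the sets `C x`. -/
def dirGraph (Γ : SimpleGraph V) (K : Set V) (C : ι → Set V) (S : Set ι) : SimpleGraph ι where
  Adj x y := x ≠ y ∧ x ∈ S ∧ y ∈ S ∧ Dir Γ K C S x y
  symm := ⟨fun _ _ h => ⟨h.1.symm, h.2.2.1, h.2.1, h.2.2.2.symm⟩⟩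
  loopless := ⟨fun _ h => h.1 rfl⟩

theorem ConnSet.dirGraph (hK : ConnSet Γ K) (hS : S.Nonempty)
    (hC : ∀ z ∈ S, ∀ z' ∈ S, z ≠ z' → Disjoint (C z) (C z'))
    (hKC : ∀ z ∈ S, (K ∩ C z).Nonempty) : ConnSet (dirGraph Γ K C S) S := by
  refine ⟨hS, ?_⟩
  rintro P ⟨x₀, hx₀, hPx₀⟩ hc y hy
  refine hK.dir_propagate (Γ := Γ) (R := fun _ : Unit => K) (by simp) hC ?_ ?_ hx₀ hPx₀
    (hKC x₀ hx₀) hy (hKC y hy)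
  · exact fun a ha b hb hab => Or.inr ⟨(), ha, hb, hab⟩
  · rintro x hx y hy hxy hPx ⟨-, hD⟩ -
    exact hc x hx y hy ⟨hxy, hx, hy, hD⟩ hPx

end

/-- Disjoint paths `Q b 0, …, Q b (len b)`. -/
structure IsPathFamily {V β : Type} (Γ : SimpleGraph V) (Q : β → ℕ → V) (len : β → ℕ) :
    Prop where
  adj : ∀ b, ∀ i < len b, Γ.Adj (Q b i) (Q b (i + 1))
  inj : ∀ b b' i i', i ≤ len b → i' ≤ len b' → Q b i = Q b' i' → b = b' ∧ i = i'

theorem IsPathFamily.connSet {V β : Type} {Γ : SimpleGraph V} {Q : β → ℕ → V} {len : β → ℕ}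
    (h : IsPathFamily Γ Q len) (b : β) {i j : ℕ} (hij : i ≤ j) (hj : j ≤ len b) :
    ConnSet Γ (Q b '' Set.Icc i j) :=
  connSet_image_Icc _ _ _ hij fun k _ hk => h.adj b k (by omega)

theorem exists_wall_of_aligned (r : ℕ) : ∃ d T : ℕ, 0 < d ∧ 0 < T ∧ ∀ (V : Type)
    (Γ : SimpleGraph V) (Q : Fin d → ℕ → V) (len : Fin d → ℕ) (Y : Fin T → Set V),
    IsPathFamily Γ Q len → (∀ a, ConnSet Γ (Y a)) → (∀ a a', a ≠ a' → Disjoint (Y a) (Y a')) →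
    (∀ a b, ∃ i ≤ len b, Q b i ∈ Y a) →
    (∀ a a' b i i', a < a' → i ≤ len b → i' ≤ len b → Q b i ∈ Y a → Q b i' ∈ Y a' → i < i') →
    HasMinor Γ (Wall r) := by
  classical
  obtain ⟨d, hd0, hd⟩ := exists_degree_or_path (2 * r * r) r
  refine ⟨d, Fintype.card (SimpleGraph (Fin d)) * ((2 * r + 1) * (r + 1)), hd0,
    Nat.mul_pos Fintype.card_pos (by positivity), ?_⟩
  intro V Γ Q len Y hQ hY hYd hYQ hord
  let C : Fin d → Set V := fun b => Q b '' Set.Icc 0 (len b)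
  have hC : ∀ b ∈ (Set.univ : Set (Fin d)), ∀ b' ∈ (Set.univ : Set (Fin d)), b ≠ b' →
      Disjoint (C b) (C b') := by
    intro b _ b' _ hbb
    rw [Set.disjoint_left]
    rintro _ ⟨i, ⟨-, hi⟩, rfl⟩ ⟨j, ⟨-, hj⟩, hij⟩
    exact hbb (hQ.inj _ _ _ _ hj hi hij).1.symm
  have hYeq : ∀ {a a' v}, v ∈ Y a → v ∈ Y a' → a = a' := by
    intro a a' v hv hv'
    by_contra hne
    exact Set.disjoint_left.1 (hYd a a' hne) hv hv'
  obtain ⟨D, e, he⟩ := exists_monochromatic (T := (2 * r + 1) * (r + 1)) le_rfl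
    (fun a => dirGraph Γ (Y a) C Set.univ)
  have hD : ConnSet D Set.univ := by
    have h0 : 0 < (2 * r + 1) * (r + 1) := by positivity
    rw [← he ⟨0, h0⟩]
    refine (hY _).dirGraph ⟨⟨0, hd0⟩, trivial⟩ hC ?_
    intro b _
    obtain ⟨i, hi, hiY⟩ := hYQ (e ⟨0, h0⟩) b
    exact ⟨Q b i, hiY, i, ⟨Nat.zero_le _, hi⟩, rfl⟩
  have hconn : ∀ b b', D.Adj b b' → ∀ k, ∃ M ⊆ Y (e k), ConnSet Γ M ∧ (M ∩ C b).Nonempty ∧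
      (∀ z, z ≠ b → Disjoint M (C z)) ∧ Touch Γ M (Y (e k) ∩ C b') := by
    intro b b' hbb k
    rw [← he k] at hbb
    obtain ⟨M, h₁, h₂, h₃, h₄, h₅⟩ := hbb.2.2.2.exists_connector trivial hC
    exact ⟨M, h₁, h₂, h₃, fun z => h₄ z trivial, h₅⟩
  rcases hd D hD with ⟨v, f, hf⟩ | ⟨ρ, hρ, hρD⟩
  · let k : Fin (2 * r * r) → Fin ((2 * r + 1) * (r + 1)) :=
      fun i => ⟨i, lt_of_lt_of_le i.2 (by nlinarith)⟩
    have hk : ∀ i j, i ≠ j → k i ≠ k j := by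
      intro i j hij h
      exact hij (Fin.ext (by simpa [k] using h))
    choose M hMY hM hMv hMd hMt using fun (i j : Fin (2 * r * r)) => hconn v (f j) (hf j) (k i)
    let seg : Fin (2 * r * r) → Set V := fun i => {x | ∃ i₁ j i₂, i₁ ≤ j ∧ j ≤ i₂ ∧ i₂ ≤ len v ∧
      Q v i₁ ∈ Y (e (k i)) ∧ Q v i₂ ∈ Y (e (k i)) ∧ Q v j = x}
    have hsegC : ∀ i, seg i ⊆ C v := by
      rintro i x ⟨i₁, j, i₂, h₁, h₂, h₃, -, -, rfl⟩
      exact ⟨j, ⟨Nat.zero_le _, h₂.trans h₃⟩, rfl⟩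
    have hsegc : ∀ i, ConnSet Γ (seg i) := by
      intro i
      obtain ⟨j₀, hj₀, hj₀Y⟩ := hYQ (e (k i)) v
      refine connSet_of_center (Q v j₀) ⟨j₀, j₀, j₀, le_rfl, le_rfl, hj₀, hj₀Y, hj₀Y, rfl⟩ ?_
      rintro x ⟨i₁, j, i₂, h₁, h₂, h₃, h₄, h₅, rfl⟩
      rcases le_total j j₀ with hle | hle
      · refine ⟨Q v '' Set.Icc j j₀, ?_, hQ.connSet v hle hj₀, ⟨j₀, ⟨hle, le_rfl⟩, rfl⟩,
          ⟨j, ⟨le_rfl, hle⟩, rfl⟩⟩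
        rintro _ ⟨t, ⟨ht₁, ht₂⟩, rfl⟩
        exact ⟨i₁, t, j₀, h₁.trans ht₁, ht₂, hj₀, h₄, hj₀Y, rfl⟩
      · refine ⟨Q v '' Set.Icc j₀ j, ?_, hQ.connSet v hle (h₂.trans h₃), ⟨j₀, ⟨le_rfl, hle⟩, rfl⟩,
          ⟨j, ⟨hle, le_rfl⟩, rfl⟩⟩
        rintro _ ⟨t, ⟨ht₁, ht₂⟩, rfl⟩
        exact ⟨j₀, t, i₂, ht₁, ht₂.trans h₂, h₃, hj₀Y, h₅, rfl⟩
    have hYseg : ∀ i x, x ∈ Y (e (k i)) → x ∈ C v → x ∈ seg i := by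
      rintro i _ hx ⟨j, ⟨-, hj⟩, rfl⟩
      exact ⟨j, j, j, le_rfl, le_rfl, hj, hx, hx, rfl⟩
    have hsegd : ∀ i i', i ≠ i' → ∀ x ∈ seg i, x ∉ seg i' := by
      have key : ∀ i i', e (k i) < e (k i') → ∀ x ∈ seg i, x ∉ seg i' := by
        rintro i i' hlt x ⟨i₁, j, i₂, h₁, h₂, h₃, h₄, h₅, rfl⟩
          ⟨i₁', j', i₂', h₁', h₂', h₃', h₄', h₅', heq⟩
        have hjj := (hQ.inj v v j' j (by omega) (by omega) heq).2
        have := hord _ _ v i₂ i₁' hlt h₃ (by omega) h₅ h₄'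
        omega
      intro i i' hii x hx hx'
      rcases lt_or_gt_of_ne (e.injective.ne (hk i i' hii)) with hlt | hlt
      · exact key i i' hlt x hx hx'
      · exact key i' i hlt x hx' hx
    refine hasMinor_wall_of_biclique le_rfl (fun i => seg i ∪ ⋃ j ∈ Set.univ, M i j)
      (fun j => C (f j)) ?_ ?_ ?_ ?_ ?_ ?_
    · intro i
      refine (hsegc i).union_star (fun j _ => hM i j) fun j _ => ?_
      obtain ⟨u, huM, huC⟩ := hMv i j
      exact ⟨u, hYseg i u (hMY i j huM) huC, u, huM, Or.inl rfl⟩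
    · exact fun j => hQ.connSet _ (Nat.zero_le _) le_rfl
    · intro i i' hii
      have hMseg : ∀ i i' j, i ≠ i' → ∀ x ∈ M i j, x ∉ seg i' := by
        intro i i' j hii x hx hx'
        exact hsegd i i' hii x (hYseg i x (hMY i j hx) (hsegC i' hx')) hx'
      rw [Set.disjoint_left]
      rintro x (hx | hx) (hx' | hx')
      · exact hsegd i i' hii x hx hx'
      · simp only [Set.mem_iUnion, Set.mem_univ, exists_const] at hx'
        obtain ⟨j, hx'⟩ := hx'
        exact hMseg i' i j hii.symm x hx' hx
      · simp only [Set.mem_iUnion, Set.mem_univ, exists_const] at hx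
        obtain ⟨j, hx⟩ := hx
        exact hMseg i i' j hii x hx hx'
      · simp only [Set.mem_iUnion, Set.mem_univ, exists_const] at hx hx'
        obtain ⟨j, hx⟩ := hx
        obtain ⟨j', hx'⟩ := hx'
        exact hk i i' hii (e.injective (hYeq (hMY i j hx) (hMY i' j' hx')))
    · exact fun j j' hjj => hC _ trivial _ trivial (f.injective.ne hjj)
    · intro i j
      have hvj : f j ≠ v := (hf j).ne'
      rw [Set.disjoint_left]
      rintro x (hx | hx) hx'
      · exact Set.disjoint_left.1 (hC _ trivial _ trivial hvj) hx' (hsegC i hx)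
      · simp only [Set.mem_iUnion, Set.mem_univ, exists_const] at hx
        obtain ⟨j', hx⟩ := hx
        exact Set.disjoint_left.1 (hMd i j' (f j) hvj) hx hx'
    · intro i j
      refine (hMt i j).mono ?_ Set.inter_subset_right
      intro x hx
      refine Or.inr ?_
      simp only [Set.mem_iUnion, Set.mem_univ, exists_const]
      exact ⟨j, hx⟩
  · rcases Nat.eq_zero_or_pos r with rfl | hr
    · refine hasMinor_wall_of_grid (fun a => a.1.elim0) ?_ ?_ ?_ ?_
      · exact fun a => a.1.elim0
      · exact fun a => a.1.elim0
      · exact fun i => i.elim0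
      · exact fun i => i.elim0
    have hb : ∀ c i, c ≤ 2 * r → i < r → c * r + i < (2 * r + 1) * (r + 1) := by
      intro c i hc hi
      nlinarith
    let a : ℕ → ℕ → Fin (Fintype.card (SimpleGraph (Fin d)) * ((2 * r + 1) * (r + 1))) :=
      fun c i => if h : c * r + i < (2 * r + 1) * (r + 1) then e ⟨c * r + i, h⟩ else
        e ⟨0, by positivity⟩
    have ha : ∀ c i, c ≤ 2 * r → i < r → ∃ k, a c i = e k := by
      intro c i hc hi
      exact ⟨⟨c * r + i, hb c i hc hi⟩, by simp [a, hb c i hc hi]⟩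
    have hale : ∀ c i c' i', c ≤ 2 * r → i < r → c' ≤ 2 * r → i' < r →
        (a c i < a c' i' ↔ c * r + i < c' * r + i') := by
      intro c i c' i' hc hi hc' hi'
      simp [a, hb c i hc hi, hb c' i' hc' hi']
    have hlt : ∀ c i c' i', i < r → c < c' → c * r + i < c' * r + i' := by
      intro c i c' i' hi hc
      nlinarith
    have hainj : ∀ c i c' i', c ≤ 2 * r → i < r → c' ≤ 2 * r → i' < r → a c i = a c' i' →
        c = c' ∧ i = i' := by
      intro c i c' i' hc hi hc' hi' heq
      have h₁ : ¬ c * r + i < c' * r + i' := fun h =>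
        absurd heq ((hale c i c' i' hc hi hc' hi').2 h).ne
      have h₂ : ¬ c' * r + i' < c * r + i := fun h =>
        absurd heq ((hale c' i' c i hc' hi' hc hi).2 h).ne'
      rcases lt_trichotomy c c' with h | h | h
      · exact absurd (hlt c i c' i' hi h) h₁
      · subst h
        exact ⟨rfl, by omega⟩
      · exact absurd (hlt c' i' c i hi' h) h₂
    choose F hFl hFY using hYQ
    have hmin : ∀ a b, ∃ i ≤ len b, Q b i ∈ Y a ∧ ∀ j ≤ len b, Q b j ∈ Y a → i ≤ j := by
      intro a b
      have hex : ∃ i, i ≤ len b ∧ Q b i ∈ Y a := ⟨F a b, hFl a b, hFY a b⟩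
      exact ⟨Nat.find hex, (Nat.find_spec hex).1, (Nat.find_spec hex).2,
        fun j hj hjY => Nat.find_min' hex ⟨hj, hjY⟩⟩
    clear hFl hFY F
    choose F hFl hFY hFm using hmin
    have hFlt : ∀ a a' b, a < a' → F a b < F a' b := fun a a' b h =>
      hord a a' b _ _ h (hFl _ _) (hFl _ _) (hFY _ _) (hFY _ _)
    have hM : ∀ c i, ∃ M : Set V, c ≤ 2 * r → i + 1 < r → M ⊆ Y (a c i) ∧ ConnSet Γ M ∧
        (M ∩ C (ρ i)).Nonempty ∧ (∀ z, z ≠ ρ i → Disjoint M (C z)) ∧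
        Touch Γ M (Y (a c i) ∩ C (ρ (i + 1))) := by
      intro c i
      by_cases h : c ≤ 2 * r ∧ i + 1 < r
      · obtain ⟨k, hk⟩ := ha c i h.1 (by omega)
        obtain ⟨M, h₁, h₂, h₃, h₄, h₅⟩ := hconn _ _ (hρD i h.2) k
        refine ⟨M, fun _ _ => ?_⟩
        rw [hk]
        exact ⟨h₁, h₂, h₃, h₄, h₅⟩
      · exact ⟨∅, fun h₁ h₂ => absurd ⟨h₁, h₂⟩ h⟩
    choose M hM using hM
    let piece : ℕ → ℕ → Set V := fun i c =>
      Q (ρ i) '' Set.Icc (F (a c 0) (ρ i)) (F (a (c + 1) 0) (ρ i) - 1)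
    have hFpos : ∀ i c, i < r → c < 2 * r → F (a c 0) (ρ i) < F (a (c + 1) 0) (ρ i) := by
      intro i c hi hc
      exact hFlt _ _ _ ((hale c 0 (c + 1) 0 (by omega) hr (by omega) hr).2
        (hlt _ _ _ _ hr (by omega)))
    have hpiece : ∀ i c j x, i < r → c < 2 * r → j < r → x ∈ Y (a c j) → x ∈ C (ρ i) →
        x ∈ piece i c := by
      rintro i c j _ hi hc hj hx ⟨t, ⟨-, ht⟩, rfl⟩
      refine ⟨t, ⟨?_, ?_⟩, rfl⟩
      · rcases Nat.eq_zero_or_pos j with rfl | hj0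
        · exact hFm _ _ t ht hx
        · refine (hord (a c 0) (a c j) _ _ t ?_ (hFl _ _) ht (hFY _ _) hx).le
          rw [hale c 0 c j (by omega) hr (by omega) hj]
          omega
      · refine Nat.le_sub_one_of_lt (hord (a c j) (a (c + 1) 0) _ t _ ?_ ht (hFl _ _) hx (hFY _ _))
        rw [hale c j (c + 1) 0 (by omega) hj (by omega) hr]
        exact hlt _ _ _ _ hj (by omega)
    have hpieceC : ∀ i c, piece i c ⊆ C (ρ i) := by
      rintro i c _ ⟨t, ⟨-, ht⟩, rfl⟩
      exact ⟨t, ⟨Nat.zero_le _, ht.trans ((Nat.sub_le _ _).trans (hFl _ _))⟩, rfl⟩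
    have hpiecec : ∀ i c, i < r → c < 2 * r → ConnSet Γ (piece i c) := by
      intro i c hi hc
      exact hQ.connSet _ (Nat.le_sub_one_of_lt (hFpos i c hi hc))
        ((Nat.sub_le _ _).trans (hFl _ _))
    have hpieced : ∀ i c i' c', i < r → i' < r → c < 2 * r → c' < 2 * r → ∀ x, x ∈ piece i c →
        x ∈ piece i' c' → i = i' ∧ c = c' := by
      rintro i c i' c' hi hi' hc hc' x ⟨t, ⟨ht₁, ht₂⟩, rfl⟩ ⟨t', ⟨ht₁', ht₂'⟩, heq⟩
      obtain ⟨h₁, h₂⟩ := hQ.inj _ _ _ _ (ht₂'.trans ((Nat.sub_le _ _).trans (hFl _ _)))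
        (ht₂.trans ((Nat.sub_le _ _).trans (hFl _ _))) heq
      obtain rfl := hρ _ _ hi' hi h₁
      subst h₂
      refine ⟨rfl, ?_⟩
      have hmono : ∀ c c', c < c' → c' < 2 * r →
          F (a (c + 1) 0) (ρ i') ≤ F (a c' 0) (ρ i') := by
        intro c c' hcc hc'
        rcases (Nat.succ_le_of_lt hcc).eq_or_lt with h | h
        · rw [← h]
        · exact (hFlt _ _ _ ((hale _ _ _ _ (by omega) hr (by omega) hr).2 (hlt _ _ _ _ hr h))).le
      have h₃ := hFpos i' c hi' hc
      have h₄ := hFpos i' c' hi' hc'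
      rcases lt_trichotomy c c' with h | h | h
      · have := hmono c c' h hc'
        omega
      · exact h
      · have := hmono c' c h hc
        omega
    let B : ℕ → ℕ → Set V := fun i c => if i + 1 < r then piece i c ∪ M c i else piece i c
    have hpB : ∀ i c, piece i c ⊆ B i c := by
      intro i c
      simp only [B]
      split_ifs
      · exact Set.subset_union_left
      · exact subset_rfl
    have hB : ∀ i c x, x ∈ B i c → x ∈ piece i c ∨ (i + 1 < r ∧ x ∈ M c i) := by
      intro i c x hx
      simp only [B] at hx
      split_ifs at hx with h
      · rcases hx with hx | hx
        · exact Or.inl hx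
        · exact Or.inr ⟨h, hx⟩
      · exact Or.inl hx
    have hMp : ∀ i c i' c' x, i + 1 < r → i' < r → c < 2 * r → c' < 2 * r → x ∈ M c i →
        x ∈ piece i' c' → i = i' ∧ c = c' := by
      intro i c i' c' x hi hi' hc hc' hx hx'
      have hii : ρ i' = ρ i := by
        by_contra hne
        exact Set.disjoint_left.1 ((hM c i hc.le hi).2.2.2.1 _ hne) hx (hpieceC _ _ hx')
      have hxC : x ∈ C (ρ i) := hii ▸ hpieceC _ _ hx'
      exact hpieced i c i' c' (by omega) hi' hc hc' x
        (hpiece i c i x (by omega) hc (by omega) ((hM c i hc.le hi).1 hx) hxC) hx'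
    refine hasMinor_wall_of_grid (fun x => B x.1 x.2) ?_ ?_ ?_ ?_
    · rintro ⟨i, c⟩
      simp only [B]
      split_ifs with h
      · obtain ⟨h₁, h₂, ⟨u, hu, hu'⟩, -⟩ := hM c i c.2.le h
        exact (hpiecec i c i.2 c.2).union h₂
          ⟨u, hpiece i c i u i.2 c.2 i.2 (h₁ hu) hu', u, hu, Or.inl rfl⟩
      · exact hpiecec i c i.2 c.2
    · rintro ⟨i, c⟩ ⟨i', c'⟩ hne
      rw [Set.disjoint_left]
      intro x hx hx'
      have hne' : ¬ (i.val = i'.val ∧ c.val = c'.val) := by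
        rintro ⟨h₁, h₂⟩
        exact hne (Prod.ext (Fin.ext h₁) (Fin.ext h₂))
      rcases hB _ _ x hx with hx | ⟨hi, hx⟩ <;> rcases hB _ _ x hx' with hx' | ⟨hi', hx'⟩
      · exact hne' (hpieced i c i' c' i.2 i'.2 c.2 c'.2 x hx hx')
      · have := hMp i' c' i c x hi' i.2 c'.2 c.2 hx' hx
        exact hne' ⟨this.1.symm, this.2.symm⟩
      · exact hne' (hMp i c i' c' x hi i'.2 c.2 c'.2 hx hx')
      · have := hainj _ _ _ _ c.2.le i.2 c'.2.le i'.2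
          (hYeq ((hM c i c.2.le hi).1 hx) ((hM c' i' c'.2.le hi').1 hx'))
        exact hne' ⟨this.2, this.1⟩
    · rintro i ⟨c, hc⟩ ⟨c', hc'⟩ h
      obtain rfl : c + 1 = c' := h
      refine Touch.mono ?_ (hpB i c) (hpB i (c + 1))
      have h₁ := hFpos i c i.2 hc
      have h₂ := hFpos i (c + 1) i.2 hc'
      have h₃ := hQ.adj (ρ i) (F (a (c + 1) 0) (ρ i) - 1) (by have := hFl (a (c + 1) 0) (ρ i); omega)
      rw [Nat.sub_add_cancel (by omega)] at h₃
      exact ⟨_, ⟨_, ⟨Nat.le_sub_one_of_lt h₁, le_rfl⟩, rfl⟩, _, ⟨_, ⟨le_rfl, Nat.le_sub_one_of_lt h₂⟩, rfl⟩, h₃⟩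
    · rintro ⟨i, hi⟩ ⟨i', hi'⟩ ⟨c, hc⟩ h
      obtain rfl : i + 1 = i' := h
      obtain ⟨x, hx, y, ⟨hyY, hyC⟩, hxy⟩ := (hM c i hc.le hi').2.2.2.2
      refine ⟨x, ?_, y, hpB _ _ (hpiece (i + 1) c i y hi' hc hi hyY hyC), hxy⟩
      simp only [B]
      rw [if_pos hi']
      exact Or.inr hx

/-- The edges of `Γ` with both ends in a common set `C z`. -/
def colGraph {V ι : Type} (Γ : SimpleGraph V) (C : ι → Set V) : SimpleGraph V where
  Adj a b := Γ.Adj a b ∧ ∃ z, a ∈ C z ∧ b ∈ C z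
  symm := ⟨fun _ _ ⟨h, z, ha, hb⟩ => ⟨h.symm, z, hb, ha⟩⟩
  loopless := ⟨fun _ h => h.1.ne rfl⟩

theorem colGraph_le {V ι : Type} (Γ : SimpleGraph V) (C : ι → Set V) : colGraph Γ C ≤ Γ :=
  fun _ _ h => h.1

theorem ConnSet.colGraph {V ι : Type} {Γ : SimpleGraph V} {C : ι → Set V} {z : ι}
    (h : ConnSet Γ (C z)) : ConnSet (colGraph Γ C) (C z) :=
  h.mono_on fun _ ha _ hb hab => ⟨hab, z, ha, hb⟩

theorem IsPathFamily.exists_cut {V : Type} [Finite V] {n : ℕ} {H H' : SimpleGraph V}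
    {Q : Fin n → ℕ → V} {len : Fin n → ℕ} {X Y : Set V} (hQ : IsPathFamily H Q len)
    (hX : ∀ b, Q b 0 ∈ X) (hY : ∀ b, Q b (len b) ∈ Y) (b₁ : Fin n) {m : ℕ} (hm : m < len b₁)
    (hadj : ∀ b, ∀ i < len b, ¬ (b = b₁ ∧ i = m) → H'.Adj (Q b i) (Q b (i + 1)))
    (hL : ¬ Linked H' X Y n) : ∃ Z : Finset V, Z.card < n ∧ ∃ τ : Fin n → ℕ, τ b₁ = m + 1 ∧
      ∀ b i, i ≤ len b → (Q b i ∈ reachSet H' X Z ↔ i < τ b) := by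
  classical
  obtain ⟨Z, hZn, hZ⟩ := (exists_separates_or_linked H' X Y n).resolve_right hL
  refine ⟨Z, hZn, ?_⟩
  have hrow : ∀ b, b ≠ b₁ → ∃ i ≤ len b, Q b i ∈ Z := by
    intro b hb
    by_contra hcon
    push Not at hcon
    have hc : ConnSet H' (Q b '' Set.Icc 0 (len b)) := connSet_image_Icc _ _ _ (Nat.zero_le _)
      fun i _ hi => hadj b i hi fun h => hb h.1
    refine separates_iff.1 hZ _ hc ⟨Q b 0, ⟨0, by simp, rfl⟩, hX b⟩
      ⟨Q b (len b), ⟨len b, by simp, rfl⟩, hY b⟩ ?_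
    rw [Set.disjoint_left]
    rintro _ ⟨i, ⟨-, hi⟩, rfl⟩
    exact hcon i hi
  choose! z hzl hzZ using hrow
  have himg : ((Finset.univ.erase b₁).image fun b => Q b (z b)) = Z := by
    refine Finset.eq_of_subset_of_card_le ?_ ?_
    · intro v hv
      simp only [Finset.mem_image, Finset.mem_erase, Finset.mem_univ, and_true] at hv
      obtain ⟨b, hb, rfl⟩ := hv
      exact hzZ b hb
    · rw [Finset.card_image_of_injOn]
      · simp
        omega
      · intro b hb b' hb' h
        simp only [Finset.coe_erase, Finset.coe_univ, Set.mem_sdiff, Set.mem_univ, true_and,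
          Set.mem_singleton_iff] at hb hb'
        exact (hQ.inj b b' _ _ (hzl b hb) (hzl b' hb') h).1
  have hZQ : ∀ b i, i ≤ len b → Q b i ∈ (Z : Set V) → b ≠ b₁ ∧ i = z b := by
    intro b i hi hiZ
    rw [← himg] at hiZ
    simp only [Finset.coe_image, Finset.coe_erase, Finset.coe_univ, Set.mem_image, Set.mem_sdiff,
      Set.mem_univ, true_and, Set.mem_singleton_iff] at hiZ
    obtain ⟨b', hb', heq⟩ := hiZ
    obtain ⟨rfl, rfl⟩ := hQ.inj _ _ _ _ (hzl b' hb') hi heq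
    exact ⟨hb', rfl⟩
  have hpre : ∀ b i, i ≤ len b → (∀ j ≤ i, Q b j ∉ (Z : Set V)) → (b = b₁ → i ≤ m) →
      Q b i ∈ reachSet H' X Z := by
    intro b i hi hZ hbm
    refine ⟨Q b '' Set.Icc 0 i, connSet_image_Icc _ _ _ (Nat.zero_le _) fun j _ hj =>
      hadj b j (by omega) fun h => ?_, ?_, ⟨Q b 0, ⟨0, by simp, rfl⟩, hX b⟩, ⟨i, by simp, rfl⟩⟩
    · have := hbm h.1
      omega
    · rw [Set.disjoint_left]
      rintro _ ⟨j, ⟨-, hj⟩, rfl⟩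
      exact hZ j hj
  have hsuf : ∀ b i, i ≤ len b → (∀ j ≤ len b, i ≤ j → Q b j ∉ (Z : Set V)) → (b = b₁ → m < i) →
      Q b i ∉ reachSet H' X Z := by
    intro b i hi hZ' hbm hmem
    refine Set.disjoint_left.1 hZ (ConnSet.subset_reachSet (K := Q b '' Set.Icc i (len b))
      (connSet_image_Icc _ _ _ hi fun j hij hj => hadj b j hj fun h => ?_) ?_ ⟨i, by simp [hi], rfl⟩
      hmem ⟨len b, by simp [hi], rfl⟩) (hY b)
    · have := hbm h.1
      omega
    · rw [Set.disjoint_left]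
      rintro _ ⟨j, ⟨hij, hj⟩, rfl⟩
      exact hZ' j hj hij
  refine ⟨fun b => if b = b₁ then m + 1 else z b, if_pos rfl, ?_⟩
  intro b i hi
  by_cases hb : b = b₁
  · simp only [if_pos hb]
    constructor
    · intro h
      by_contra hlt
      exact hsuf b i hi (fun j hj _ hjZ => (hZQ b j hj hjZ).1 hb) (fun _ => by omega) h
    · intro h
      exact hpre b i hi (fun j hj hjZ => (hZQ b j (hj.trans hi) hjZ).1 hb) fun _ => by omega
  · simp only [if_neg hb]
    constructor
    · intro h
      by_contra hlt
      rcases (not_lt.1 hlt).eq_or_lt with heq | hlt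
      · exact notMem_of_mem_reachSet h (heq ▸ hzZ b hb)
      · exact hsuf b i hi (fun j hj hij hjZ => by have := (hZQ b j hj hjZ).2; omega)
          (fun h => absurd h hb) h
    · intro h
      exact hpre b i hi (fun j hj hjZ => by have := (hZQ b j (hj.trans hi) hjZ).2; omega)
        fun h => absurd h hb

theorem exists_reroute_aux {V ι : Type} [Finite V] {n d T : ℕ} {Γ₀ H : SimpleGraph V}
    {C : ι → Set V} (hCd : ∀ z z', z ≠ z' → Disjoint (C z) (C z')) (hC : ∀ z, ConnSet Γ₀ (C z))
    {Q : Fin n → ℕ → V} {len : Fin n → ℕ} {X Y : Set V} (hQ : IsPathFamily H Q len)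
    (hX : ∀ b, Q b 0 ∈ X) (hY : ∀ b, Q b (len b) ∈ Y)
    (hH' : ∀ b i, i < len b → ¬ Γ₀.Adj (Q b i) (Q b (i + 1)) → ∃ H', Γ₀ ≤ H' ∧
      ¬ Linked H' X Y n ∧ ∀ u v, H.Adj u v → s(u, v) ≠ s(Q b i, Q b (i + 1)) → H'.Adj u v)
    (hΓ₀ : ∀ u v z, Γ₀.Adj u v → u ∉ C z → v ∉ C z)
    (hd : 0 < d) (e : Fin d ↪ Fin n) (J : Finset ι) (hJ : 2 * n * (T + 1) + 1 ≤ J.card)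
    (hJQ : ∀ b, ∀ j ∈ J, ∃ i ≤ len (e b), Q (e b) i ∈ C j) :
    ∃ y : Fin T → ι, Function.Injective y ∧
      (∀ a b, ∃ i ≤ len (e b), Q (e b) i ∈ C (y a)) ∧
      ∀ a a' b i i', a < a' → i ≤ len (e b) → i' ≤ len (e b) → Q (e b) i ∈ C (y a) →
        Q (e b) i' ∈ C (y a') → i < i' := by
  classical
  have hCeq : ∀ {z z' v}, v ∈ C z → v ∈ C z' → z = z' := by
    intro z z' v hv hv'
    by_contra hne
    exact Set.disjoint_left.1 (hCd z z' hne) hv hv'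
  set b₁ := e ⟨0, hd⟩ with hb₁
  have hlo : ∀ j, ∃ i, j ∈ J → i ≤ len b₁ ∧ Q b₁ i ∈ C j ∧ ∀ i' < i, Q b₁ i' ∉ C j := by
    intro j
    by_cases hj : j ∈ J
    · have hex : ∃ i, i ≤ len b₁ ∧ Q b₁ i ∈ C j := hJQ ⟨0, hd⟩ j hj
      refine ⟨Nat.find hex, fun _ => ⟨(Nat.find_spec hex).1, (Nat.find_spec hex).2, ?_⟩⟩
      intro i' hi' h
      exact Nat.find_min hex hi' ⟨hi'.le.trans (Nat.find_spec hex).1, h⟩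
    · exact ⟨0, fun h => absurd h hj⟩
  choose lo hlo using hlo
  have hinj : Set.InjOn lo J := by
    intro j hj j' hj' h
    exact hCeq (hlo j hj).2.1 (h ▸ (hlo j' hj').2.1)
  have hcard : 2 * n * (T + 1) + 1 ≤ (J.image lo).card := by
    rwa [Finset.card_image_of_injOn hinj]
  let ε := (J.image lo).orderEmbOfCardLe hcard
  have hε : ∀ k, ∃ j ∈ J, lo j = ε k := fun k => by
    simpa using (J.image lo).orderEmbOfCardLe_mem hcard k
  choose c₀ hc₀J hc₀ using hε
  let c : ℕ → ι := fun k => if h : k < 2 * n * (T + 1) + 1 then c₀ ⟨k, h⟩ else c₀ ⟨0, by omega⟩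
  have hcJ : ∀ k, c k ∈ J := by
    intro k
    simp only [c]
    split_ifs
    exacts [hc₀J _, hc₀J _]
  have hclt : ∀ k k', k < k' → k' < 2 * n * (T + 1) + 1 → lo (c k) < lo (c k') := by
    intro k k' hk hk'
    simp only [c, hk', hk.trans hk', dite_true, hc₀]
    exact ε.strictMono (by simpa using hk)
  have hn : 0 < n := (Nat.zero_le _).trans_lt b₁.2
  have hcut : ∀ a, ∃ (Z : Finset V) (H' : SimpleGraph V) (τ : Fin n → ℕ), a ≤ T → Z.card < n ∧ Γ₀ ≤ H' ∧
      τ b₁ = lo (c (2 * n * a + 1)) ∧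
      ∀ b i, i ≤ len b → (Q b i ∈ reachSet H' X Z ↔ i < τ b) := by
    intro a
    by_cases ha : a ≤ T
    · have hak : 2 * n * a + 1 < 2 * n * (T + 1) + 1 := by nlinarith
      have hpos : 0 < lo (c (2 * n * a + 1)) :=
        (Nat.zero_le _).trans_lt (hclt 0 _ (by omega) hak)
      set m := lo (c (2 * n * a + 1)) - 1 with hm
      obtain ⟨h₁, h₂, h₃⟩ := hlo _ (hcJ (2 * n * a + 1))
      have hm1 : m + 1 = lo (c (2 * n * a + 1)) := by omega
      have hml : m < len b₁ := by omega
      obtain ⟨H', hle, hnl, hadj⟩ := hH' b₁ m hml fun h =>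
        hΓ₀ _ _ _ h (h₃ m (by omega)) (by rwa [hm1])
      obtain ⟨Z, hZ, τ, hτ₁, hτ⟩ := hQ.exists_cut hX hY b₁ hml (H' := H') (by
        intro b i hi hne
        refine hadj _ _ (hQ.adj b i hi) fun heq => hne ?_
        rw [Sym2.eq_iff] at heq
        rcases heq with ⟨heq, -⟩ | ⟨heq, heq'⟩
        · exact hQ.inj _ _ _ _ hi.le hml.le heq
        · have e₁ := (hQ.inj _ _ _ _ hi.le hml heq).2
          have e₂ := (hQ.inj _ _ _ _ hi hml.le heq').2
          omega) hnl
      exact ⟨Z, H', τ, fun _ => ⟨hZ, hle, by rw [hτ₁, hm1], hτ⟩⟩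
    · exact ⟨∅, ⊥, fun _ => 0, fun h => absurd h ha⟩
  choose Z H' τ hcut using hcut
  have hside : ∀ a j, a ≤ T → Disjoint (C j) (Z a) → j ∈ J → ∀ b i, i ≤ len b → Q b i ∈ C j →
      (i < τ a b ↔ lo j < lo (c (2 * n * a + 1))) := by
    intro a j ha hdj hj b i hi hiC
    obtain ⟨-, hle, hτ₁, hτ⟩ := hcut a ha
    obtain ⟨h₁, h₂, -⟩ := hlo j hj
    rw [← hτ₁, ← hτ b i hi, ← hτ b₁ _ h₁]
    exact ⟨fun h => ((hC j).mono hle).subset_reachSet hdj hiC h h₂,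
      fun h => ((hC j).mono hle).subset_reachSet hdj h₂ h hiC⟩
  have hY : ∀ a : Fin T, ∃ k < 2 * n, Disjoint (C (c (2 * n * a + 1 + k))) (Z a : Set V) ∧
      Disjoint (C (c (2 * n * a + 1 + k))) (Z (a + 1) : Set V) := by
    intro a
    by_contra hcon
    have hcon' : ∀ k < 2 * n, ∃ v ∈ Z a ∪ Z (a + 1), v ∈ C (c (2 * n * a + 1 + k)) := by
      intro k hk
      by_contra hne
      refine hcon ⟨k, hk, ?_, ?_⟩ <;> rw [Set.disjoint_left] <;> intro v hv hvZ
      · exact hne ⟨v, Finset.mem_union_left _ hvZ, hv⟩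
      · exact hne ⟨v, Finset.mem_union_right _ hvZ, hv⟩
    have : Nonempty V := ⟨Q b₁ 0⟩
    choose! w hwZ hwC using hcon'
    have h1 := Finset.card_le_card_of_injOn (s := Finset.range (2 * n)) (t := Z a ∪ Z (a + 1)) w
      (fun k hk => hwZ k (Finset.mem_range.1 hk)) (by
        intro k hk k' hk' h
        rw [Finset.coe_range, Set.mem_Iio] at hk hk'
        have h₂ := hCeq (hwC k hk) (h ▸ hwC k' hk')
        have hb : ∀ k < 2 * n, 2 * n * a + 1 + k < 2 * n * (T + 1) + 1 := by
          intro k hk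
          have := a.2
          nlinarith
        rcases lt_trichotomy k k' with hlt | heq | hlt
        · exact absurd (congrArg lo h₂) (hclt _ _ (by omega) (hb k' hk')).ne
        · exact heq
        · exact absurd (congrArg lo h₂) (hclt _ _ (by omega) (hb k hk)).ne')
    rw [Finset.card_range] at h1
    have h2 := Finset.card_union_le (Z a) (Z (a + 1))
    have h3 := (hcut a a.2.le).1
    have h4 := (hcut (a + 1) a.2).1
    omega
  choose k hk hkZ hkZ' using hY
  have hbd : ∀ a : Fin T, 2 * n * a + 1 + k a < 2 * n * (a + 1) + 1 := by
    intro a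
    have := hk a
    nlinarith
  have hbd' : ∀ a : Fin T, 2 * n * (a + 1) + 1 < 2 * n * (T + 1) + 1 := by
    intro a
    have := a.2
    nlinarith
  have hhit : ∀ (a : Fin T) b i, i ≤ len b → Q b i ∈ C (c (2 * n * a + 1 + k a)) →
      τ a b ≤ i ∧ i < τ (a + 1) b := by
    intro a b i hi hiC
    constructor
    · by_contra hlt
      rw [not_le, hside a _ a.2.le (hkZ a) (hcJ _) b i hi hiC] at hlt
      rcases Nat.eq_zero_or_pos (k a) with h0 | h0
      · simp [h0] at hlt
      · exact absurd hlt (hclt _ _ (by omega) ((hbd a).trans (hbd' a))).not_gt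
    · rw [hside (a + 1) _ a.2 (hkZ' a) (hcJ _) b i hi hiC]
      exact hclt _ _ (hbd a) (hbd' a)
  have hmono : ∀ b (a a' : ℕ), a ≤ a' → a' ≤ T → τ a (e b) ≤ τ a' (e b) := by
    intro b a a' h
    induction a', h using Nat.le_induction with
    | base => exact fun _ => le_rfl
    | succ a' h ih =>
      intro ha'
      obtain ⟨i, hi, hiC⟩ := hJQ b _ (hcJ (2 * n * a' + 1 + k ⟨a', ha'⟩))
      have := hhit ⟨a', ha'⟩ (e b) i hi hiC
      have := ih (by omega)
      simp only at *
      omega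
  refine ⟨fun a => c (2 * n * a + 1 + k a), ?_, fun a b => hJQ b _ (hcJ _), ?_⟩
  · intro a a' h
    obtain ⟨i, hi, hiC⟩ := hJQ ⟨0, hd⟩ _ (hcJ (2 * n * a + 1 + k a))
    have h₁ := hhit a _ i hi hiC
    have h₂ := hhit a' _ i hi (by simpa only [h] using hiC)
    rcases lt_trichotomy a a' with hlt | heq | hlt
    · have := hmono ⟨0, hd⟩ (a + 1) a' hlt a'.2.le
      omega
    · exact heq
    · have := hmono ⟨0, hd⟩ (a' + 1) a hlt a.2.le
      omega
  · intro a a' b i i' haa hi hi' hiC hiC'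
    have h₁ := hhit a _ i hi hiC
    have h₂ := hhit a' _ i' hi' hiC'
    have := hmono b (a + 1) a' haa a'.2.le
    omega

theorem Linked.exists_pathFamily {V : Type} {H : SimpleGraph V} {X Y : Set V} {n : ℕ}
    (h : Linked H X Y n) : ∃ (Q : Fin n → ℕ → V) (len : Fin n → ℕ), IsPathFamily H Q len ∧
      (∀ b, Q b 0 ∈ X) ∧ ∀ b, Q b (len b) ∈ Y := by
  obtain ⟨P, hP, hd, hX, hY⟩ := h
  choose Q len hQ using fun b => (hP b).exists_tightPath (hX b) (hY b)
  refine ⟨Q, len, ⟨fun b => (hQ b).adj, ?_⟩, fun b => (hQ b).fst_mem, fun b => (hQ b).lst_mem⟩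
  intro b b' i i' hi hi' heq
  have hb : b = b' := by
    by_contra hne
    exact Set.disjoint_left.1 (hd b b' hne) ((hQ b).mem i hi) (heq ▸ (hQ b').mem i' hi')
  subst hb
  exact ⟨rfl, (hQ b).inj hi hi' heq⟩

/-- Disjoint `X`–`Y` paths using few edges outside the columns yield a wall as soon as enough of
them cross enough columns. -/
theorem exists_reroute (r : ℕ) : ∃ d, 0 < d ∧ ∀ n, ∃ N, ∀ (V ι : Type) [Finite V]
    (Γ : SimpleGraph V) (C : ι → Set V), (∀ z z', z ≠ z' → Disjoint (C z) (C z')) →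
    (∀ z, ConnSet Γ (C z)) → ∀ (F₀ : SimpleGraph V), F₀ ≤ Γ → ∀ X Y : Set V,
    Linked (colGraph Γ C ⊔ F₀) X Y n → ∃ (Q : Fin n → ℕ → V) (len : Fin n → ℕ),
      IsPathFamily (colGraph Γ C ⊔ F₀) Q len ∧ (∀ b, Q b 0 ∈ X) ∧ (∀ b, Q b (len b) ∈ Y) ∧
      ∀ (e : Fin d ↪ Fin n) (J : Finset ι), N ≤ J.card →
        (∀ b, ∀ j ∈ J, ∃ i ≤ len (e b), Q (e b) i ∈ C j) → HasMinor Γ (Wall r) := by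
  classical
  obtain ⟨d, T, hd, hT, hw⟩ := exists_wall_of_aligned r
  refine ⟨d, hd, fun n => ⟨2 * n * (T + 1) + 1, ?_⟩⟩
  intro V ι _ Γ C hCd hC F₀ hF₀ X Y hL
  obtain ⟨F, ⟨hFF, hFL⟩, hFmin⟩ : ∃ F : SimpleGraph V,
      (F ≤ F₀ ∧ Linked (colGraph Γ C ⊔ F) X Y n) ∧
      ∀ F' < F, ¬ (F' ≤ F₀ ∧ Linked (colGraph Γ C ⊔ F') X Y n) := by
    obtain ⟨F, hF, hmin⟩ := (Set.toFinite
      {F : SimpleGraph V | F ≤ F₀ ∧ Linked (colGraph Γ C ⊔ F) X Y n}).exists_minimal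
      ⟨F₀, le_rfl, hL⟩
    exact ⟨F, hF, fun F' hlt h => hlt.not_ge (hmin h hlt.le)⟩
  obtain ⟨Q, len, hQ, hX, hY⟩ := hFL.exists_pathFamily
  have hle : colGraph Γ C ⊔ F ≤ colGraph Γ C ⊔ F₀ := sup_le_sup_left hFF _
  have hle' : colGraph Γ C ⊔ F₀ ≤ Γ := sup_le (colGraph_le Γ C) hF₀
  refine ⟨Q, len, ⟨fun b i hi => hle (hQ.adj b i hi), hQ.inj⟩, hX, hY, ?_⟩
  intro e J hJ hJQ
  obtain ⟨y, hy, hyQ, hyo⟩ := exists_reroute_aux hCd (fun z => (hC z).colGraph) hQ hX hY (by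
    intro b i hi hnot
    have hF : F.Adj (Q b i) (Q b (i + 1)) := ((sup_adj _ _ _ _).1 (hQ.adj b i hi)).resolve_left hnot
    refine ⟨colGraph Γ C ⊔ F.deleteEdges {s(Q b i, Q b (i + 1))}, le_sup_left, fun h => ?_, ?_⟩
    · refine hFmin _ (lt_of_le_of_ne (deleteEdges_le _) fun heq => ?_)
        ⟨(deleteEdges_le _).trans hFF, h⟩
      rw [← heq, deleteEdges_adj] at hF
      exact hF.2 rfl
    · intro u v huv hne
      rcases huv with huv | huv
      · exact Or.inl huv
      · exact Or.inr ((deleteEdges_adj).2 ⟨huv, hne⟩)) (by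
    rintro u v z ⟨-, z', hu, hv⟩ huz hvz
    by_cases h : z' = z
    · exact huz (h ▸ hu)
    · exact Set.disjoint_left.1 (hCd _ _ h) hv hvz) hd e J hJ hJQ
  exact hw V Γ (fun b => Q (e b)) (fun b => len (e b)) (fun a => C (y a))
    ⟨fun b i hi => hle' (hle (hQ.adj _ i hi)), fun b b' i i' hi hi' h =>
      ⟨e.injective (hQ.inj _ _ _ _ hi hi' h).1, (hQ.inj _ _ _ _ hi hi' h).2⟩⟩
    (fun a => hC _) (fun a a' h => hCd _ _ (hy.ne h)) hyQ hyo

theorem Linked.of_embedding {V : Type} {Γ : SimpleGraph V} {A B : Set V} {k k' : ℕ}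
    (h : Linked Γ A B k) (f : Fin k' ↪ Fin k) : Linked Γ A B k' := by
  obtain ⟨P, hP, hd, hA, hB⟩ := h
  exact ⟨fun i => P (f i), fun i => hP _, fun i j hij => hd _ _ (f.injective.ne hij),
    fun i => hA _, fun i => hB _⟩

theorem Linked.of_le {V : Type} {Γ : SimpleGraph V} {A B : Set V} {k k' : ℕ}
    (h : Linked Γ A B k) (hk : k' ≤ k) : Linked Γ A B k' :=
  h.of_embedding (Fin.castLEEmb hk)

theorem Linked.mono {V : Type} {Γ Γ' : SimpleGraph V} {A B : Set V} {k : ℕ}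
    (h : Linked Γ A B k) (hΓ : Γ ≤ Γ') : Linked Γ' A B k := by
  obtain ⟨P, hP, hd, hA, hB⟩ := h
  exact ⟨P, fun i => (hP i).mono hΓ, hd, hA, hB⟩

theorem exists_finEmbedding_of_card_le {α : Type} {k : ℕ} {s : Finset α}
    (h : k ≤ s.card) : ∃ f : Fin k ↪ α, ∀ i, f i ∈ s := by
  have : Nonempty (Fin k ↪ s) := Function.Embedding.nonempty_of_card_le (by simpa using h)
  obtain ⟨f⟩ := this
  exact ⟨f.trans (Function.Embedding.subtype _), fun i => (f i).2⟩

/-- Sufficiently linked pairs of sets can be joined by disjoint connected sets, unless there is a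
wall minor. -/
theorem exists_linkage (r t : ℕ) : ∃ k, ∀ (V : Type) [Finite V] (Γ : SimpleGraph V)
    (X Y : Fin t → Set V), (∀ e, Linked Γ (X e) (Y e) k) → HasMinor Γ (Wall r) ∨
    ∃ P : Fin t → Set V, (∀ e, ConnSet Γ (P e)) ∧ (∀ e e', e ≠ e' → Disjoint (P e) (P e')) ∧
      (∀ e, (P e ∩ X e).Nonempty) ∧ ∀ e, (P e ∩ Y e).Nonempty := by
  classical
  induction t with
  | zero => exact ⟨0, fun V _ Γ X Y _ => Or.inr ⟨fun _ => ∅, fun e => e.elim0, fun e => e.elim0,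
      fun e => e.elim0, fun e => e.elim0⟩⟩
  | succ t ih =>
    obtain ⟨k', ih⟩ := ih
    obtain ⟨d, hd, hroute⟩ := exists_reroute r
    obtain ⟨N, hN⟩ := hroute (k' + d)
    refine ⟨k' + d + (Fintype.card (Fin t × (Fin d ↪ Fin (k' + d))) * N + 1), ?_⟩
    intro V _ Γ X Y hL
    obtain ⟨C, hC, hCd, hCX, hCY⟩ := hL 0
    have hQ : ∀ e : Fin t, _ := fun e => hN V _ Γ C hCd hC Γ le_rfl (X e.succ) (Y e.succ)
      (((hL e.succ).of_le (Nat.le_add_right _ _)).mono le_sup_right)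
    choose Q len hQf hQX hQY hQw using hQ
    have hsup : colGraph Γ C ⊔ Γ ≤ Γ := sup_le (colGraph_le _ _) le_rfl
    let hits : Fin t → Fin (k' + d + (Fintype.card (Fin t × (Fin d ↪ Fin (k' + d))) * N + 1)) →
      Finset (Fin (k' + d)) := fun e p => Finset.univ.filter fun b => ∃ i ≤ len e b, Q e b i ∈ C p
    by_cases hgood : ∃ p, ∀ e, (hits e p).card ≤ d
    · obtain ⟨p, hp⟩ := hgood
      let Γ' : SimpleGraph V :=
        { Adj := fun u v => Γ.Adj u v ∧ u ∉ C p ∧ v ∉ C p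
          symm := ⟨fun _ _ h => ⟨h.1.symm, h.2.2, h.2.1⟩⟩
          loopless := ⟨fun _ h => h.1.ne rfl⟩ }
      have hΓ' : Γ' ≤ Γ := fun _ _ h => h.1
      rcases ih V Γ' (fun e => X e.succ \ C p) (fun e => Y e.succ \ C p) (by
        intro e
        have hcard : k' ≤ (hits e p)ᶜ.card := by
          have := hp e
          rw [Finset.card_compl, Fintype.card_fin]
          omega
        obtain ⟨f, hf⟩ := exists_finEmbedding_of_card_le hcard
        have hf' : ∀ i, ∀ j ≤ len e (f i), Q e (f i) j ∉ C p := by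
          intro i j hj hjC
          have := hf i
          simp only [hits, Finset.mem_compl, Finset.mem_filter, Finset.mem_univ, true_and] at this
          exact this ⟨j, hj, hjC⟩
        refine ⟨fun i => Q e (f i) '' Set.Icc 0 (len e (f i)), ?_, ?_, ?_, ?_⟩
        · intro i
          refine connSet_image_Icc _ _ _ (Nat.zero_le _) fun j _ hj => ?_
          exact ⟨hsup ((hQf e).adj _ j hj), hf' i j hj.le, hf' i _ hj⟩
        · intro i j hij
          rw [Set.disjoint_left]
          rintro _ ⟨a, ⟨-, ha⟩, rfl⟩ ⟨b, ⟨-, hb⟩, heq⟩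
          exact hij (f.injective ((hQf e).inj _ _ _ _ hb ha heq).1.symm)
        · exact fun i => ⟨_, ⟨0, by simp, rfl⟩, hQX e _, hf' i 0 (Nat.zero_le _)⟩
        · exact fun i => ⟨_, ⟨len e (f i), by simp, rfl⟩, hQY e _, hf' i _ le_rfl⟩) with
        hwall | ⟨P, hP, hPd, hPX, hPY⟩
      · exact Or.inl (hwall.mono hΓ')
      · have hPC : ∀ e, Disjoint (P e) (C p) := by
          intro e
          rw [Set.disjoint_left]
          obtain ⟨u, hu, huX⟩ := hPX e
          exact (hP e).2 (fun v => v ∉ C p) ⟨u, hu, huX.2⟩ fun a _ b _ hab _ => hab.2.2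
        refine Or.inr ⟨Fin.cons (C p) P, ?_, ?_, ?_, ?_⟩
        · exact Fin.cases (hC p) fun e => (hP e).mono hΓ'
        · refine Fin.cases (Fin.cases (fun h => absurd rfl h) fun e _ => (hPC e).symm)
            fun e => Fin.cases (fun _ => hPC e) fun e' h => ?_
          exact hPd e e' fun heq => h (by rw [heq])
        · refine Fin.cases (hCX p) fun e => ?_
          exact (hPX e).mono fun v hv => ⟨hv.1, hv.2.1⟩
        · refine Fin.cases (hCY p) fun e => ?_
          exact (hPY e).mono fun v hv => ⟨hv.1, hv.2.1⟩
    · push Not at hgood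
      have hch : ∀ p, ∃ x : Fin t × (Fin d ↪ Fin (k' + d)),
          ∀ b, ∃ i ≤ len x.1 (x.2 b), Q x.1 (x.2 b) i ∈ C p := by
        intro p
        obtain ⟨e, he⟩ := hgood p
        obtain ⟨f, hf⟩ := exists_finEmbedding_of_card_le he.le
        refine ⟨(e, f), fun b => ?_⟩
        have := hf b
        simpa only [hits, Finset.mem_filter, Finset.mem_univ, true_and] using this
      choose x hx using hch
      have : Nonempty (Fin t × (Fin d ↪ Fin (k' + d))) := ⟨x ⟨0, by omega⟩⟩
      obtain ⟨c, ε, hε⟩ := exists_monochromatic (T := N) (by omega) x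
      refine Or.inl (hQw c.1 c.2 (Finset.univ.map ε.toEmbedding) (by simp) ?_)
      intro b j hj
      simp only [Finset.mem_map, Finset.mem_univ, true_and] at hj
      obtain ⟨i, rfl⟩ := hj
      have := hx (ε i) b
      rw [hε] at this
      exact this

theorem exists_disjoint_of_card_lt {V : Type} {k : ℕ} {R : Fin k → Set V}
    (hR : ∀ i j, i ≠ j → Disjoint (R i) (R j)) {Z : Finset V} (hZ : Z.card < k) :
    ∃ i, Disjoint (R i) (Z : Set V) := by
  classical
  by_contra hcon
  have hcon' : ∀ i, ∃ v ∈ Z, v ∈ R i := by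
    intro i
    by_contra hne
    refine hcon ⟨i, Set.disjoint_left.2 fun v hv hvZ => hne ⟨v, hvZ, hv⟩⟩
  choose w hwZ hwR using hcon'
  have := Finset.card_le_card_of_injOn (s := Finset.univ) (t := Z) w (fun i _ => hwZ i) (by
    intro i _ j _ h
    by_contra hne
    exact Set.disjoint_left.1 (hR i j hne) (hwR i) (h ▸ hwR j))
  simp at this
  omega

/-- Anchors that reach many common helpers within many rows yield a wall. -/
theorem exists_wall_of_anchors (r : ℕ) : ∃ k, ∀ (V ι : Type) [Finite V] (Γ : SimpleGraph V)
    (C : ι → Set V) (R : Fin k → Set V) (x : Fin (2 * r * r) → ι) (z : Fin k → ι),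
    (∀ c c', c ≠ c' → Disjoint (C c) (C c')) → (∀ c, ConnSet Γ (C c)) →
    (∀ i j, i ≠ j → Disjoint (R i) (R j)) → Function.Injective x → Function.Injective z →
    (∀ a j, x a ≠ z j) →
    (∀ i j a, Dir Γ (R i) C (insert (z j) (Set.range x)) (z j) (x a)) → HasMinor Γ (Wall r) := by
  classical
  obtain ⟨k, hk⟩ := exists_linkage r
    (Fintype.card {p : Fin (2 * r * r) × Fin (2 * r * r) // p.1 < p.2})
  refine ⟨k, ?_⟩
  intro V ι _ Γ C R x z hCd hC hRd hx hz hxz hD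
  let A : Set V := ⋃ a, C (x a)
  let Γ' : SimpleGraph V :=
    { Adj := fun u v => Γ.Adj u v ∧ u ∉ A ∧ v ∉ A
      symm := ⟨fun _ _ h => ⟨h.1.symm, h.2.2, h.2.1⟩⟩
      loopless := ⟨fun _ h => h.1.ne rfl⟩ }
  have hΓ' : Γ' ≤ Γ := fun _ _ h => h.1
  let X : Fin (2 * r * r) → Set V := fun a => {v | v ∉ A ∧ ∃ u ∈ C (x a), Γ.Adj v u}
  have hzA : ∀ j, Disjoint (C (z j)) A := by
    intro j
    rw [Set.disjoint_iUnion_right]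
    exact fun a => hCd _ _ (hxz a j).symm
  have hlift : ∀ {K : Set V}, ConnSet Γ K → Disjoint K A → ConnSet Γ' K := fun hK hKA =>
    hK.mono_on fun a ha b hb hab =>
      ⟨hab, Set.disjoint_left.1 hKA ha, Set.disjoint_left.1 hKA hb⟩
  have hcon : ∀ i j a, ∃ M ⊆ R i, ConnSet Γ' M ∧ (M ∩ C (z j)).Nonempty ∧ (M ∩ X a).Nonempty := by
    intro i j a
    obtain ⟨M, hMR, hM, hMz, hMd, u, hu, v, hv, huv⟩ :=
      (hD i j a).exists_connector (Set.mem_insert _ _) fun c _ c' _ h => hCd c c' h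
    have hMA : Disjoint M A := by
      rw [Set.disjoint_iUnion_right]
      exact fun a => hMd _ (Set.mem_insert_of_mem _ ⟨a, rfl⟩) (hxz a j)
    exact ⟨M, hMR, hlift hM hMA, hMz, u, hu, Set.disjoint_left.1 hMA hu, v, hv.2, huv⟩
  have hlink : ∀ a b, Linked Γ' (X a) (X b) k := by
    intro a b
    refine (exists_separates_or_linked Γ' (X a) (X b) k).resolve_left ?_
    rintro ⟨Z, hZk, hZ⟩
    obtain ⟨i, hi⟩ := exists_disjoint_of_card_lt hRd hZk
    obtain ⟨j, hj⟩ := exists_disjoint_of_card_lt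
      (fun j j' h => hCd _ _ (hz.ne h) : ∀ j j', j ≠ j' → Disjoint (C (z j)) (C (z j'))) hZk
    obtain ⟨M, hMR, hM, ⟨u, huM, huz⟩, hMa⟩ := hcon i j a
    obtain ⟨M', hMR', hM', ⟨u', huM', huz'⟩, hMb⟩ := hcon i j b
    have h₁ := hM.union (hlift (hC (z j)) (hzA j)) ⟨u, huM, u, huz, Or.inl rfl⟩
    have h₂ := h₁.union hM' ⟨u', Or.inr huz', u', huM', Or.inl rfl⟩
    refine separates_iff.1 hZ _ h₂ (hMa.mono ?_) (hMb.mono ?_) ?_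
    · exact fun v hv => ⟨Or.inl (Or.inl hv.1), hv.2⟩
    · exact fun v hv => ⟨Or.inr hv.1, hv.2⟩
    · rw [Set.disjoint_union_left, Set.disjoint_union_left]
      exact ⟨⟨hi.mono_left hMR, hj⟩, hi.mono_left hMR'⟩
  let f := Fintype.equivFin {p : Fin (2 * r * r) × Fin (2 * r * r) // p.1 < p.2}
  rcases hk V Γ' (fun e => X (f.symm e).1.1) (fun e => X (f.symm e).1.2)
    (fun e => hlink _ _) with hw | ⟨P, hP, hPd, hPX, hPY⟩
  · exact hw.mono hΓ'
  have hPA : ∀ e, ∀ v ∈ P e, v ∉ A := by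
    intro e
    obtain ⟨u, hu, huX⟩ := hPX e
    exact (hP e).2 (fun v => v ∉ A) ⟨u, hu, huX.1⟩ fun a _ b _ hab _ => hab.2.2
  have hxA : ∀ a, C (x a) ⊆ A := fun a => Set.subset_iUnion (fun a => C (x a)) a
  let I : Fin (2 * r * r) → Set _ := fun a => {e | (f.symm e).1.1 = a}
  have hB : ∀ a v, v ∈ C (x a) ∪ ⋃ e ∈ I a, P e → v ∈ C (x a) ∨ ∃ e, (f.symm e).1.1 = a ∧ v ∈ P e := by
    rintro a v (h | h)
    · exact Or.inl h
    · simp only [Set.mem_iUnion, exists_prop] at h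
      exact Or.inr h
  refine hasMinor_wall_of_top le_rfl ⟨fun a => C (x a) ∪ ⋃ e ∈ I a, P e, ?_, ?_, ?_⟩
  · intro a
    refine (hC _).union_star (fun e _ => (hP e).mono hΓ') ?_
    rintro e rfl
    obtain ⟨v, hvP, -, u, hu, hvu⟩ := hPX e
    exact ⟨u, hu, v, hvP, Or.inr hvu.symm⟩
  · intro a b hab
    rw [Set.disjoint_left]
    intro v hv hv'
    rcases hB a v hv with hv | ⟨e, he, hv⟩ <;> rcases hB b v hv' with hv' | ⟨e', he', hv'⟩
    · exact Set.disjoint_left.1 (hCd _ _ (hx.ne hab)) hv hv'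
    · exact hPA e' v hv' (hxA a hv)
    · exact hPA e v hv (hxA b hv')
    · have : e ≠ e' := by
        rintro rfl
        exact hab (he.symm.trans he')
      exact Set.disjoint_left.1 (hPd e e' this) hv hv'
  · have key : ∀ a b, a < b → Touch Γ (C (x a) ∪ ⋃ e ∈ I a, P e) (C (x b) ∪ ⋃ e ∈ I b, P e) := by
      intro a b hab
      have hfa : f.symm (f ⟨(a, b), hab⟩) = ⟨(a, b), hab⟩ := f.symm_apply_apply _
      obtain ⟨v, hvP, -, u, hu, hvu⟩ := hPY (f ⟨(a, b), hab⟩)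
      rw [hfa] at hu
      refine ⟨v, Or.inr ?_, u, Or.inl hu, hvu⟩
      simp only [Set.mem_iUnion, exists_prop]
      exact ⟨_, congrArg (fun p => p.1.1) hfa, hvP⟩
    intro a b hab
    rcases lt_or_gt_of_ne hab.ne with h | h
    · exact key a b h
    · exact (key b a h).symm

/-- Rows whose direct connections respect a layering of the columns into thin layers yield a
wall. -/
theorem exists_wall_of_layers (r w : ℕ) : ∃ ℓ n, ∀ (V ι : Type) [Finite V] [Fintype ι]
    (Γ : SimpleGraph V) (C : ι → Set V) (R : Fin n → Set V) (δ : ι → ℕ),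
    (∀ c c', c ≠ c' → Disjoint (C c) (C c')) → (∀ c, ConnSet Γ (C c)) →
    (∀ i j, i ≠ j → Disjoint (R i) (R j)) → (∀ i, ConnSet Γ (R i)) →
    (∀ i c, (R i ∩ C c).Nonempty) →
    (∀ i x y, Dir Γ (R i) C Set.univ x y → δ y ≤ δ x + 1) →
    (∀ lev, {x | δ x = lev}.ncard ≤ w) → (∃ x, δ x = 0) → (∃ y, ℓ ≤ δ y) → HasMinor Γ (Wall r) := by
  classical
  obtain ⟨d, hd, hroute⟩ := exists_reroute r
  obtain ⟨N, hN⟩ := hroute (w * d)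
  refine ⟨Fintype.card (Fin d ↪ Fin (w * d)) * N + 1, w * d, ?_⟩
  rintro V ι _ _ Γ C R δ hCd hC hRd hR hRC hδ hw ⟨x₀, hx₀⟩ ⟨y₀, hy₀⟩
  obtain ⟨Q, len, hQ, hQX, hQY, hQw⟩ := hN V ι Γ C hCd hC (colGraph Γ R) (colGraph_le _ _)
    (C x₀) (C y₀) ⟨R, fun i => (hR i).colGraph.mono le_sup_right, hRd, fun i => hRC i _,
      fun i => hRC i _⟩
  have hmeet : ∀ (lev : Fin (Fintype.card (Fin d ↪ Fin (w * d)) * N + 1)) b,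
      ∃ c, δ c = lev + 1 ∧ ∃ i ≤ len b, Q b i ∈ C c := by
    intro lev b
    by_contra hcon
    push Not at hcon
    have h₁ := (hQ.connSet b (Nat.zero_le _) le_rfl).dir_propagate (Γ := Γ) (R := R) (C := C)
      (S := Set.univ) hRd (fun c _ c' _ h => hCd c c' h) (by
        rintro a - b - (⟨-, c, hac, hbc⟩ | ⟨hab, i, hai, hbi⟩)
        · exact Or.inl ⟨c, trivial, hac, hbc⟩
        · exact Or.inr ⟨i, hai, hbi, hab⟩) (P := fun c => δ c < lev + 1) (by
        rintro x - y - - hx ⟨i, hi⟩ ⟨_, ⟨j, ⟨-, hj⟩, rfl⟩, hjy⟩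
        have h₁ := hδ i x y hi
        have h₂ : δ y ≠ lev + 1 := fun h => hcon y h j hj hjy
        omega) (x₀ := x₀) trivial (by omega) ⟨_, ⟨0, by simp, rfl⟩, hQX b⟩ (y := y₀) trivial
        ⟨_, ⟨len b, by simp, rfl⟩, hQY b⟩
    have := lev.2
    omega
  have hcol : ∀ lev : Fin (Fintype.card (Fin d ↪ Fin (w * d)) * N + 1),
      ∃ c, δ c = lev + 1 ∧ ∃ e : Fin d ↪ Fin (w * d), ∀ b, ∃ i ≤ len (e b), Q (e b) i ∈ C c := by
    intro lev
    choose g hgδ hgQ using hmeet lev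
    let L : Finset ι := Finset.univ.filter fun c => δ c = lev + 1
    have hL : L.card ≤ w := by
      have := hw (lev + 1)
      rwa [Set.ncard_eq_toFinset_card', Set.toFinset_ofPred] at this
    have hLne : L.Nonempty := by
      rcases Nat.eq_zero_or_pos (w * d) with h0 | h0
      · have hw0 : w = 0 := by
          rcases Nat.mul_eq_zero.1 h0 with h | h
          · exact h
          · omega
        have := hw 0
        rw [hw0, Nat.le_zero, Set.ncard_eq_zero] at this
        exact absurd hx₀ (Set.eq_empty_iff_forall_notMem.1 this x₀)
      · exact ⟨g ⟨0, h0⟩, by simp [L, hgδ]⟩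
    obtain ⟨c, hcL, hc⟩ := Finset.exists_le_card_fiber_of_mul_le_card_of_maps_to
      (s := Finset.univ) (t := L) (f := g) (n := d) (fun b _ => by simp [L, hgδ]) hLne
      (by simpa using Nat.mul_le_mul_right d hL)
    obtain ⟨e, he⟩ := exists_finEmbedding_of_card_le hc
    refine ⟨c, by simpa [L] using hcL, e, fun b => ?_⟩
    have := he b
    simp only [Finset.mem_filter, Finset.mem_univ, true_and] at this
    exact this ▸ hgQ (e b)
  choose c hcδ e he using hcol
  have : Nonempty (Fin d ↪ Fin (w * d)) := ⟨e 0⟩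
  obtain ⟨e₀, ε, hε⟩ := exists_monochromatic (T := N) (Nat.le_succ _) e
  refine hQw e₀ (Finset.univ.image fun i => c (ε i)) ?_ ?_
  · rw [Finset.card_image_of_injective]
    · simp
    · intro i j h
      have := congrArg δ h
      simp only [hcδ] at this
      exact ε.injective (Fin.ext (by omega))
  · intro b j hj
    simp only [Finset.mem_image, Finset.mem_univ, true_and] at hj
    obtain ⟨i, rfl⟩ := hj
    rw [← hε i]
    exact he _ b

/-- `D T` holds between the least element of `T` and the element of `T` with exactly `m` elements of
`T` above it. -/
def EndRel {α : Type} (lt : α → α → Prop) (D : Set α → α → α → Prop) (m : ℕ) (T : Finset α) :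
    Prop :=
  ∃ x ∈ T, ∃ y ∈ T, (∀ z ∈ T, ¬ lt z x) ∧ {z | z ∈ T ∧ lt y z}.ncard = m ∧ D T x y

theorem endRel_image {α : Type} [DecidableEq α] {lt : α → α → Prop}
    {D : Set α → α → α → Prop} {m p : ℕ} {ω : ℕ → α}
    (hω : ∀ i j, i < p → j < p → (lt (ω i) (ω j) ↔ i < j)) {P : Finset ℕ} (hP : ∀ i ∈ P, i < p)
    {a b : ℕ} (ha : a ∈ P) (hb : b ∈ P) (haP : ∀ i ∈ P, a ≤ i)
    (hbP : (P.filter (b < ·)).card = m) :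
    EndRel lt D m (P.image ω) ↔ D (P.image ω : Finset α) (ω a) (ω b) := by
  have hinj : Set.InjOn ω P := by
    intro i hi j hj h
    rcases lt_trichotomy i j with hlt | heq | hlt
    · exact absurd ((hω i i (hP i hi) (hP i hi)).1
        (by simpa only [← h] using (hω i j (hP i hi) (hP j hj)).2 hlt)) (lt_irrefl _)
    · exact heq
    · exact absurd ((hω i i (hP i hi) (hP i hi)).1
        (by simpa only [← h] using (hω j i (hP j hj) (hP i hi)).2 hlt)) (lt_irrefl _)
  have hcount : ∀ b ∈ P, {z | z ∈ P.image ω ∧ lt (ω b) z}.ncard = (P.filter (b < ·)).card := by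
    intro b hb
    have : {z | z ∈ P.image ω ∧ lt (ω b) z} = ω '' (P.filter (b < ·) : Finset ℕ) := by
      ext z
      simp only [Finset.mem_image, Set.mem_ofPred_eq, Finset.coe_filter, Set.mem_image]
      constructor
      · rintro ⟨⟨i, hi, rfl⟩, h⟩
        exact ⟨i, ⟨hi, (hω b i (hP b hb) (hP i hi)).1 h⟩, rfl⟩
      · rintro ⟨i, ⟨hi, h⟩, rfl⟩
        exact ⟨⟨i, hi, rfl⟩, (hω b i (hP b hb) (hP i hi)).2 h⟩
    rw [this, Set.InjOn.ncard_image (hinj.mono fun i hi => Finset.mem_coe.2 (Finset.mem_filter.1 hi).1),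
      Set.ncard_coe_finset]
  constructor
  · rintro ⟨x, hx, y, hy, hxm, hym, hD⟩
    obtain ⟨a', ha', rfl⟩ := Finset.mem_image.1 hx
    obtain ⟨b', hb', rfl⟩ := Finset.mem_image.1 hy
    have haa : a' = a := by
      refine le_antisymm (not_lt.1 fun hlt => ?_) (haP a' ha')
      exact hxm (ω a) (Finset.mem_image_of_mem _ ha) ((hω a a' (hP a ha) (hP a' ha')).2 hlt)
    rw [hcount b' hb', ← hbP] at hym
    have hmono : ∀ i ∈ P, ∀ j ∈ P, i < j → (P.filter (j < ·)).card < (P.filter (i < ·)).card := by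
      intro i hi j hj hij
      refine Finset.card_lt_card (Finset.ssubset_iff_subset_ne.2 ⟨?_, fun h => ?_⟩)
      · intro l hl
        simp only [Finset.mem_filter] at hl ⊢
        exact ⟨hl.1, hij.trans hl.2⟩
      · have : j ∈ P.filter (i < ·) := Finset.mem_filter.2 ⟨hj, hij⟩
        rw [← h] at this
        exact lt_irrefl _ (Finset.mem_filter.1 this).2
    have hbb : b' = b := by
      rcases lt_trichotomy b' b with hlt | heq | hlt
      · have := hmono b' hb' b hb hlt
        omega
      · exact heq
      · have := hmono b hb b' hb' hlt
        omega
    exact haa ▸ hbb ▸ hD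
  · intro hD
    refine ⟨ω a, Finset.mem_image_of_mem _ ha, ω b, Finset.mem_image_of_mem _ hb, ?_, ?_, hD⟩
    · intro z hz h
      obtain ⟨i, hi, rfl⟩ := Finset.mem_image.1 hz
      exact absurd ((hω i a (hP i hi) (hP a ha)).1 h) (haP i hi).not_gt
    · rw [hcount b hb, hbP]

theorem not_rel_of_not_endRel {α : Type} [DecidableEq α] {lt : α → α → Prop}
    {D : Set α → α → α → Prop} {m p : ℕ} {ω : ℕ → α}
    (hω : ∀ i j, i < p → j < p → (lt (ω i) (ω j) ↔ i < j)) {S : Set α} (hS : ∀ i < p, ω i ∈ S)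
    (hDS : ∀ S S' x y, S ⊆ S' → D S' x y → D S x y)
    (hinj : Set.InjOn ω (Finset.range p))
    (h : ∀ T : Finset α, (T : Set α) ⊆ S → T.card = 2 * m + 2 → ¬ EndRel lt D m T) {a b : ℕ}
    (hab : a + m < b) (hb : b + m < p) : ¬ D S (ω a) (ω b) := by
  intro hD
  let P : Finset ℕ := Finset.Icc a (a + m) ∪ Finset.Icc b (b + m)
  have hP : ∀ i ∈ P, i < p := by
    intro i hi
    simp only [P, Finset.mem_union, Finset.mem_Icc] at hi
    omega
  have hPS : ((P.image ω : Finset α) : Set α) ⊆ S := by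
    intro z hz
    obtain ⟨i, hi, rfl⟩ := Finset.mem_image.1 hz
    exact hS i (hP i hi)
  refine h (P.image ω) hPS ?_ ((endRel_image hω hP (a := a) (b := b) ?_ ?_ ?_ ?_).2
    (hDS _ _ _ _ hPS hD))
  · rw [Finset.card_image_of_injOn (hinj.mono fun i hi => by simpa using hP i hi),
      Finset.card_union_of_disjoint]
    · simp only [Nat.card_Icc]
      omega
    · rw [Finset.disjoint_left]
      intro i hi hi'
      rw [Finset.mem_Icc] at hi hi'
      omega
  · simp [P]
  · simp [P]
  · intro i hi
    simp only [P, Finset.mem_union, Finset.mem_Icc] at hi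
    omega
  · have : P.filter (b < ·) = Finset.Icc (b + 1) (b + m) := by
      ext i
      simp only [P, Finset.mem_filter, Finset.mem_union, Finset.mem_Icc]
      omega
    rw [this, Nat.card_Icc]
    omega

theorem exists_wall_of_endRel (r : ℕ) : ∃ k p, ∀ (V ι : Type) [Finite V] (Γ : SimpleGraph V)
    (C : ι → Set V) (R : Fin k → Set V) (lt : ι → ι → Prop) (ω : ℕ → ι) (S : Finset ι)
    (D : Set ι → ι → ι → Prop),
    (∀ c c', c ≠ c' → Disjoint (C c) (C c')) → (∀ c, ConnSet Γ (C c)) →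
    (∀ i j, i ≠ j → Disjoint (R i) (R j)) →
    (∀ i j, i < p → j < p → (lt (ω i) (ω j) ↔ i < j)) → Set.InjOn ω (Finset.range p) →
    (∀ i < p, ω i ∈ S) → (∀ i S x y, D S x y → Dir Γ (R i) C S x y) →
    (∀ T ⊆ S, T.card = 2 * (2 * r * r) + 2 → EndRel lt D (2 * r * r) T) →
    HasMinor Γ (Wall r) := by
  classical
  obtain ⟨k, hk⟩ := exists_wall_of_anchors r
  set m := 2 * r * r with hm
  refine ⟨k, k + 3 * m, ?_⟩
  intro V ι _ Γ C R lt ω S D hCd hC hRd hω hinj hS hD hE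
  have hne : ∀ {i j : ℕ}, i < k + 3 * m → j < k + 3 * m → ω i = ω j → i = j := fun hi hj h =>
    hinj (by simpa using hi) (by simpa using hj) h
  refine hk V ι Γ C R (fun a => ω (k + m + a)) (fun j => ω j) hCd hC hRd ?_ ?_ ?_ ?_
  · intro a b h
    have := hne (by omega) (by omega) h
    exact Fin.ext (by omega)
  · intro a b h
    have := hne (by omega) (by omega) h
    exact Fin.ext this
  · intro a j h
    have := hne (by omega) (by omega) h
    omega
  · intro i j a
    let P : Finset ℕ := {j.val} ∪ Finset.Icc (k + a) (k + 2 * m + a)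
    have ha := a.2
    have hj := j.2
    have hP : ∀ i ∈ P, i < k + 3 * m := by
      intro i hi
      simp only [P, Finset.mem_union, Finset.mem_singleton, Finset.mem_Icc] at hi
      omega
    have hfil : P.filter (k + m + a < ·) = Finset.Icc (k + m + a + 1) (k + 2 * m + a) := by
      ext i
      simp only [P, Finset.mem_filter, Finset.mem_union, Finset.mem_singleton, Finset.mem_Icc]
      omega
    have h := (endRel_image (D := D) (m := m) hω hP (a := j) (b := k + m + a) (by simp [P])
      (by simp only [P, Finset.mem_union, Finset.mem_singleton, Finset.mem_Icc]; omega) (by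
        intro i hi
        simp only [P, Finset.mem_union, Finset.mem_singleton, Finset.mem_Icc] at hi
        omega) (by rw [hfil, Nat.card_Icc]; omega)).1 (hE _ ?_ ?_)
    · refine (hD i _ _ _ h).anti ?_
      rintro z (rfl | ⟨b, rfl⟩)
      · exact Finset.mem_coe.2 (Finset.mem_image_of_mem _ (by simp [P]))
      · have hb := b.2
        refine Finset.mem_coe.2 (Finset.mem_image_of_mem _ ?_)
        simp only [P, Finset.mem_union, Finset.mem_singleton, Finset.mem_Icc]
        omega
    · intro z hz
      obtain ⟨i, hi, rfl⟩ := Finset.mem_image.1 hz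
      exact hS i (hP i hi)
    · rw [Finset.card_image_of_injOn (hinj.mono fun i hi => by simpa using hP i hi),
        Finset.card_union_of_disjoint]
      · simp only [Nat.card_Icc, Finset.card_singleton]
        omega
      · rw [Finset.disjoint_left]
        intro i hi hi'
        rw [Finset.mem_Icc] at hi'
        rw [Finset.mem_singleton] at hi
        omega

theorem exists_enumeration {N q : ℕ} (hq : 0 < q) {B : Finset (Fin N)} (hB : B.card = q) :
    ∃ ω : ℕ → Fin N, (∀ i < q, ω i ∈ B) ∧ (∀ i j, i < q → j < q → (ω i < ω j ↔ i < j)) ∧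
      ∀ z ∈ B, ∃ i < q, ω i = z := by
  refine ⟨fun i => if h : i < q then B.orderEmbOfFin hB ⟨i, h⟩ else B.orderEmbOfFin hB ⟨0, hq⟩,
    fun i hi => ?_, fun i j hi hj => ?_, fun z hz => ?_⟩
  · simp only [hi, dif_pos, Finset.orderEmbOfFin_mem]
  · simp only [hi, hj, dif_pos, OrderEmbedding.lt_iff_lt, Fin.mk_lt_mk]
  · have : z ∈ Set.range (B.orderEmbOfFin hB) := by
      rw [Finset.range_orderEmbOfFin]
      exact Finset.mem_coe.2 hz
    obtain ⟨i, rfl⟩ := this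
    exact ⟨i, i.2, by simp⟩

theorem injOn_of_lt_iff {α : Type} [LinearOrder α] {q : ℕ} {ω : ℕ → α}
    (h : ∀ i j, i < q → j < q → (ω i < ω j ↔ i < j)) : Set.InjOn ω (Finset.range q) := by
  intro i hi j hj hij
  rw [Finset.mem_coe, Finset.mem_range] at hi hj
  rcases lt_trichotomy i j with hlt | heq | hlt
  · exact absurd ((h i j hi hj).2 hlt) (hij ▸ lt_irrefl _)
  · exact heq
  · exact absurd ((h j i hj hi).2 hlt) (hij ▸ lt_irrefl _)

/-- A wall minor from connected rows that see the columns in the same way, when no subset of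
columns has its extreme members in relation. -/
theorem exists_wall_of_not_endRel (r m : ℕ) : ∃ ℓ n, ∀ (V : Type) [Finite V] (Γ : SimpleGraph V)
    (N : ℕ) (C : Fin N → Set V) (R : Fin n → Set V) (D : Set (Fin N) → Fin N → Fin N → Prop)
    (B : Finset (Fin N)), B.card = 2 * ℓ * (m + 1) + 1 →
    (∀ c c', c ≠ c' → Disjoint (C c) (C c')) → (∀ c, ConnSet Γ (C c)) →
    (∀ i j, i ≠ j → Disjoint (R i) (R j)) → (∀ i, ConnSet Γ (R i)) →
    (∀ i c, (R i ∩ C c).Nonempty) → (∀ i S x y, Dir Γ (R i) C S x y → D S x y) →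
    (∀ S x y, D S x y → D S y x) → (∀ S S' x y, S ⊆ S' → D S' x y → D S x y) →
    (∀ T ⊆ B, T.card = 2 * m + 2 → ¬ EndRel (· < ·) D m T) →
    (∀ T ⊆ B, T.card = 2 * m + 2 → ¬ EndRel (· > ·) D m T) → HasMinor Γ (Wall r) := by
  classical
  obtain ⟨ℓ, n, hn⟩ := exists_wall_of_layers r (2 * (m + 1))
  refine ⟨ℓ, n, ?_⟩
  intro V _ Γ N C R D B hB hCd hC hRd hR hRC hD hDs hDa hlt hgt
  set Q := 2 * ℓ * (m + 1) + 1 with hQ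
  obtain ⟨ω, hωB, hω, hωs⟩ := exists_enumeration (by omega) hB
  have hinj := injOn_of_lt_iff hω
  have hne : ∀ {i j : ℕ}, i < Q → j < Q → ω i = ω j → i = j := fun hi hj h =>
    hinj (by simpa using hi) (by simpa using hj) h
  have key : ∀ a b, a < b → b < Q → D (B : Set (Fin N)) (ω a) (ω b) →
      b ≤ a + m ∨ (a < m ∧ Q ≤ b + m) := by
    intro a b hab hb h
    by_contra hcon
    rw [not_or, not_and_or] at hcon
    obtain ⟨h1, h2⟩ := hcon
    by_cases hbm : b + m < Q
    · exact not_rel_of_not_endRel (lt := (· < ·)) hω (S := (B : Set (Fin N)))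
        (fun i hi => Finset.mem_coe.2 (hωB i hi)) hDa hinj
        (fun T hT => hlt T (Finset.coe_subset.1 hT)) (a := a) (b := b) (by omega) hbm h
    · have ham : m ≤ a := by omega
      have h' := not_rel_of_not_endRel (lt := (· > ·)) (p := Q) (ω := fun i => ω (Q - 1 - i))
        (D := D) (m := m) (S := (B : Set (Fin N))) ?_
        (fun i hi => Finset.mem_coe.2 (hωB _ (by omega))) hDa ?_
        (fun T hT => hgt T (Finset.coe_subset.1 hT)) (a := Q - 1 - b) (b := Q - 1 - a) (by omega)
        (by omega)
      · rw [show Q - 1 - (Q - 1 - b) = b by omega, show Q - 1 - (Q - 1 - a) = a by omega] at h'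
        exact h' (hDs _ _ _ h)
      · intro i j hi hj
        show ω (Q - 1 - j) < ω (Q - 1 - i) ↔ _
        rw [hω _ _ (by omega) (by omega)]
        omega
      · intro i hi j hj hij
        rw [Finset.mem_coe, Finset.mem_range] at hi hj
        have := hne (by omega) (by omega) hij
        omega
  refine hn V (Fin Q) Γ (fun i => C (ω i)) R (fun i => min i.val (Q - 1 - i.val) / (m + 1)) ?_ ?_ hRd
    hR (fun i c => hRC i _) ?_ ?_ ?_ ?_
  · intro c c' hcc
    refine hCd _ _ fun h => hcc (Fin.ext (hne c.2 c'.2 h))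
  · intro c
    exact hC _
  · intro i x y h
    have h' : Dir Γ (R i) C (B : Set (Fin N)) (ω x) (ω y) := by
      rcases h with h | ⟨L, hLK, hL, hd, hx, hy⟩
      · exact Or.inl h
      · refine Or.inr ⟨L, hLK, hL, fun z hz => ?_, hx, hy⟩
        obtain ⟨j, hj, rfl⟩ := hωs z (Finset.mem_coe.1 hz)
        exact hd ⟨j, hj⟩ trivial
    have h'' := hD _ _ _ _ h'
    have hx := x.2
    have hy := y.2
    have hm : min y.val (Q - 1 - y.val) ≤ min x.val (Q - 1 - x.val) + (m + 1) := by
      rcases lt_trichotomy x.val y.val with hxy | hxy | hxy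
      · rcases key _ _ hxy hy h'' with h | h <;> omega
      · omega
      · rcases key _ _ hxy hx (hDs _ _ _ h'') with h | h <;> omega
    calc _ ≤ (min x.val (Q - 1 - x.val) + (m + 1)) / (m + 1) := Nat.div_le_div_right hm
      _ = _ := Nat.add_div_right _ (by omega)
  · intro lev
    let I := Finset.Ico (lev * (m + 1)) (lev * (m + 1) + (m + 1))
    have hsub : ∀ x : Fin Q, min x.val (Q - 1 - x.val) / (m + 1) = lev →
        x.val ∈ I ∪ I.image (Q - 1 - ·) := by
      intro x hx'
      rw [Nat.div_eq_iff (by omega)] at hx'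
      have hxQ := x.2
      rw [Finset.mem_union, Finset.mem_image, Finset.mem_Ico]
      rcases le_total x.val (Q - 1 - x.val) with h | h
      · rw [min_eq_left h] at hx'
        left
        omega
      · rw [min_eq_right h] at hx'
        right
        refine ⟨Q - 1 - x.val, Finset.mem_Ico.2 ⟨?_, ?_⟩, ?_⟩ <;> omega
    refine (Set.ncard_le_ncard_of_injOn (t := ((I ∪ I.image (Q - 1 - ·) : Finset ℕ) : Set ℕ))
      (fun i : Fin Q => i.val) (fun x hx => Finset.mem_coe.2 (hsub x hx))
      Fin.val_injective.injOn (Finset.finite_toSet _)).trans ?_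
    rw [Set.ncard_coe_finset]
    refine (Finset.card_union_le _ _).trans ?_
    have h1 := Finset.card_image_le (s := I) (f := (Q - 1 - ·))
    have h2 : I.card = m + 1 := by simp [I]
    omega
  · exact ⟨⟨0, by omega⟩, by simp⟩
  · have : ℓ * (m + 1) + ℓ * (m + 1) + 1 = Q := by rw [hQ]; ring
    refine ⟨⟨ℓ * (m + 1), by omega⟩, ?_⟩
    rw [Nat.le_div_iff_mul_le (by omega)]
    simp only
    omega

/-- Two crossing families of disjoint connected sets yield a wall minor. -/
theorem exists_wall_of_crossing (r : ℕ) : ∃ n, ∀ (V : Type) [Finite V] (Γ : SimpleGraph V)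
    (R C : Fin n → Set V), (∀ i, ConnSet Γ (R i)) → (∀ i j, i ≠ j → Disjoint (R i) (R j)) →
    (∀ i, ConnSet Γ (C i)) → (∀ i j, i ≠ j → Disjoint (C i) (C j)) →
    (∀ i j, (R i ∩ C j).Nonempty) → HasMinor Γ (Wall r) := by
  classical
  obtain ⟨k, p, hkp⟩ := exists_wall_of_endRel r
  set m := 2 * r * r with hm
  obtain ⟨ℓ, n', hn'⟩ := exists_wall_of_not_endRel r m
  obtain ⟨N₂, hN₂⟩ := exists_ramsey (2 * m + 2) (p + 1) (2 * ℓ * (m + 1) + 1)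
  obtain ⟨N, hN⟩ := exists_ramsey (2 * m + 2) (p + 1) N₂
  let κ := Set (Fin N) → Fin N → Fin N → Prop
  let M := Fintype.card κ * (k + n' + 1)
  refine ⟨N + M, ?_⟩
  intro V _ Γ R' C' hR hRd hC hCd hRC
  let R : Fin M → Set V := fun i => R' (Fin.natAdd N i)
  let C : Fin N → Set V := fun i => C' (Fin.castAdd M i)
  have hCd' : ∀ c c', c ≠ c' → Disjoint (C c) (C c') := fun c c' h =>
    hCd _ _ fun h' => h (Fin.castAdd_injective _ _ h')
  obtain ⟨D, e, he⟩ := exists_monochromatic (T := k + n' + 1) (m := M) le_rfl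
    (fun i => (fun S x y => Dir Γ (R i) C S x y : κ))
  have he' : ∀ i S x y, Dir Γ (R (e i)) C S x y ↔ D S x y := by
    intro i S x y
    rw [← he i]
  have hRd' : ∀ i j, i ≠ j → Disjoint (R (e i)) (R (e j)) := fun i j h =>
    hRd _ _ fun h' => h (e.injective (Fin.natAdd_injective _ _ h'))
  rcases hN (Fin N) Finset.univ (by simp) (EndRel (· < ·) D m) with
    ⟨B, -, hBc, hB⟩ | ⟨B₁, -, hB₁c, hB₁⟩
  · obtain ⟨ω, hωB, hω, -⟩ := exists_enumeration (by omega) hBc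
    exact hkp V (Fin N) Γ C (fun i => R (e ((Fin.castAdd n' i).castSucc))) (· < ·) ω B D hCd' (fun c => hC _)
      (fun i j h => hRd' _ _ fun h' => h (Fin.castAdd_injective _ _ (Fin.castSucc_injective _ h')))
      (fun i j hi hj => hω i j (by omega) (by omega))
      ((injOn_of_lt_iff hω).mono (by simp)) (fun i hi => hωB i (by omega))
      (fun i S x y h => (he' _ _ _ _).2 h) hB
  rcases hN₂ (Fin N) B₁ hB₁c.ge (EndRel (· > ·) D m) with ⟨B, -, hBc, hB⟩ | ⟨B, hBB, hBc, hB⟩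
  · obtain ⟨ω, hωB, hω, -⟩ := exists_enumeration (by omega) hBc
    have hω' : ∀ i j, i < p → j < p → (ω (p - i) > ω (p - j) ↔ i < j) := by
      intro i j hi hj
      show ω _ < ω _ ↔ _
      rw [hω _ _ (by omega) (by omega)]
      omega
    refine hkp V (Fin N) Γ C (fun i => R (e ((Fin.castAdd n' i).castSucc))) (· > ·) (fun i => ω (p - i)) B D
      hCd' (fun c => hC _)
      (fun i j h => hRd' _ _ fun h' => h (Fin.castAdd_injective _ _ (Fin.castSucc_injective _ h'))) hω' ?_
      (fun i hi => hωB _ (by omega)) (fun i S x y h => (he' _ _ _ _).2 h) hB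
    intro i hi j hj hij
    rw [Finset.mem_coe, Finset.mem_range] at hi hj
    have := injOn_of_lt_iff hω (x₁ := p - i) (x₂ := p - j) (by simp) (by simp) hij
    omega
  · have hi0 : 0 < k + n' + 1 := by omega
    exact hn' V Γ N C (fun i => R (e (Fin.natAdd k i).castSucc)) D B hBc hCd' (fun c => hC _)
      (fun i j h => hRd' _ _ fun h' => h (Fin.natAdd_injective _ _ (Fin.castSucc_injective _ h')))
      (fun i => hR _)
      (fun i c => hRC _ _) (fun i S x y h => (he' _ _ _ _).1 h)
      (fun S x y h => (he' ⟨0, hi0⟩ _ _ _).1 ((he' ⟨0, hi0⟩ _ _ _).2 h).symm)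
      (fun S S' x y hS h => (he' ⟨0, hi0⟩ _ _ _).1 (((he' ⟨0, hi0⟩ _ _ _).2 h).anti hS))
      (fun T hT => hB₁ T (hT.trans hBB)) hB

/-- An induced minor model of a complete bipartite graph with sides indexed by `ι` and `κ`. -/
structure IsModel {V ι κ : Type} (G : SimpleGraph V) (A : ι → Set V) (B : κ → Set V) : Prop where
  left_conn : ∀ i, ConnSet G (A i)
  right_conn : ∀ j, ConnSet G (B j)
  left_anti : ∀ i i', i ≠ i' → Anticomplete G (A i) (A i')
  right_anti : ∀ j j', j ≠ j' → Anticomplete G (B j) (B j')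
  disj : ∀ i j, Disjoint (A i) (B j)
  touch : ∀ i j, Touch G (A i) (B j)

section

variable {V ι κ : Type} {G : SimpleGraph V} {A : ι → Set V} {B : κ → Set V}

theorem IsModel.symm (h : IsModel G A B) : IsModel G B A :=
  ⟨h.right_conn, h.left_conn, h.right_anti, h.left_anti, fun i j => (h.disj j i).symm,
    fun i j => (h.touch j i).symm⟩

theorem IsModel.comp {ι' κ' : Type} (h : IsModel G A B) (e : ι' ↪ ι) (g : κ' ↪ κ) :
    IsModel G (A ∘ e) (B ∘ g) :=
  ⟨fun _ => h.left_conn _, fun _ => h.right_conn _,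
    fun _ _ hne => h.left_anti _ _ (e.injective.ne hne),
    fun _ _ hne => h.right_anti _ _ (g.injective.ne hne), fun _ _ => h.disj _ _,
    fun _ _ => h.touch _ _⟩

theorem Anticomplete.mono {X Y X' Y' : Set V} (h : Anticomplete G X Y) (hX : X' ⊆ X)
    (hY : Y' ⊆ Y) : Anticomplete G X' Y' :=
  ⟨h.1.mono hX hY, fun x hx y hy => h.2 x (hX hx) y (hY hy)⟩

end

theorem exists_wall_of_clean_connectors (r : ℕ) : ∃ n K, ∀ (V : Type) (G : SimpleGraph V)
    (A : Fin n → Set V) (B : Fin K → Set V), (∀ i, ConnSet G (A i)) →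
    (∀ i i', i ≠ i' → Anticomplete G (A i) (A i')) →
    (∀ j j', j ≠ j' → Anticomplete G (B j) (B j')) → (∀ i j, Disjoint (A i) (B j)) →
    (∀ j a b, a ≠ b → ∃ L ⊆ B j, ConnSet G L ∧ Touch G L (A a) ∧ Touch G L (A b) ∧
      ∀ c, c ≠ a → c ≠ b → ¬ Touch G L (A c)) → HasInducedMinor G (Wall r) := by
  classical
  refine ⟨2 * r * r, Fintype.card (Sym2 (Fin (2 * r * r))), ?_⟩
  intro V G A B hA hAA hBB hAB hL
  let j := Fintype.equivFin (Sym2 (Fin (2 * r * r)))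
  have hσ : ∀ e : Sym2 (Fin (2 * r * r)), ∃ L, e ∈ (⊤ : SimpleGraph (Fin (2 * r * r))).edgeSet →
      L ⊆ B (j e) ∧ ConnSet G L ∧ (∀ a ∈ e, Touch G L (A a)) ∧ ∀ a ∉ e, ¬ Touch G L (A a) := by
    intro e
    induction e using Sym2.ind with
    | _ a b =>
      by_cases hab : a = b
      · exact ⟨∅, fun h => absurd hab (by simpa using h)⟩
      · obtain ⟨L, h1, h2, h3, h4, h5⟩ := hL (j s(a, b)) a b hab
        refine ⟨L, fun _ => ⟨h1, h2, ?_, ?_⟩⟩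
        · intro x hx
          rcases Sym2.mem_iff.1 hx with rfl | rfl
          · exact h3
          · exact h4
        · intro x hx
          rw [Sym2.mem_iff, not_or] at hx
          exact h5 x hx.1 hx.2
  choose σ hσ using hσ
  have hsub : IsSubdivMinor G (⊤ : SimpleGraph (Fin (2 * r * r))) A σ :=
    ⟨hA, fun e he => (hσ e he).2.1, hAA, fun i e he => (hAB i _).mono_right (hσ e he).1,
      fun e he => (hσ e he).2.2.1, fun e he => (hσ e he).2.2.2,
      fun e he e' he' hne => Anticomplete.mono (hBB _ _ (j.injective.ne hne)) (hσ e he).1 (hσ e' he').1⟩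
  refine hsub.hasInducedMinor (hasMinor_wall_of_top le_rfl
    ⟨fun i => {i}, fun i => connSet_singleton _ i, fun i i' h => by simpa using h,
      fun a b hab => ⟨a, rfl, b, rfl, hab⟩⟩)

/-- Either many right-hand sets satisfy `E`, or connectors touching few left-hand sets yield a
wall. -/
theorem exists_wall_of_connectors (r k : ℕ) : ∃ M, ∀ t, ∃ m, ∀ (V : Type) (G : SimpleGraph V)
    (A : Fin M → Set V) (B : Fin m → Set V) (E : Fin m → Prop), (∀ i, ConnSet G (A i)) →
    (∀ i i', i ≠ i' → Anticomplete G (A i) (A i')) →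
    (∀ j j', j ≠ j' → Anticomplete G (B j) (B j')) → (∀ i j, Disjoint (A i) (B j)) →
    (∀ j, E j ∨ ∀ a b, a ≠ b → ∃ L ⊆ B j, ConnSet G L ∧ Touch G L (A a) ∧ Touch G L (A b) ∧
      {c | Touch G L (A c)}.ncard ≤ k) →
    HasInducedMinor G (Wall r) ∨ ∃ e : Fin t ↪ Fin m, ∀ i, E (e i) := by
  classical
  obtain ⟨n, K, hnK⟩ := exists_wall_of_clean_connectors r
  obtain ⟨M, hM⟩ := exists_free_embedding n k
  refine ⟨M, fun t => ⟨Fintype.card (Option (Fin n ↪ Fin M)) * (t + K), ?_⟩⟩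
  intro V G A B E hA hAA hBB hAB hE
  have hc : ∀ j, ∃ o : Option (Fin n ↪ Fin M), (o = none → E j) ∧ ∀ h, o = some h →
      ∀ a b, a ≠ b → ∃ L ⊆ B j, ConnSet G L ∧ Touch G L (A (h a)) ∧ Touch G L (A (h b)) ∧
      ∀ c, c ≠ a → c ≠ b → ¬ Touch G L (A (h c)) := by
    intro j
    rcases hE j with h | h
    · exact ⟨none, fun _ => h, by simp⟩
    · have h' : ∀ a b, ∃ L, a ≠ b → L ⊆ B j ∧ ConnSet G L ∧ Touch G L (A a) ∧ Touch G L (A b) ∧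
          {c | Touch G L (A c)}.ncard ≤ k := by
        intro a b
        by_cases hab : a = b
        · exact ⟨∅, fun h => absurd hab h⟩
        · obtain ⟨L, hL⟩ := h a b hab
          exact ⟨L, fun _ => hL⟩
      choose L hL using h'
      obtain ⟨f, hf⟩ := hM (fun a b => if a = b then ∅ else
        Finset.univ.filter fun c => Touch G (L a b) (A c)) (by
          intro a b
          split_ifs with hab
          · simp
          · have := (hL a b hab).2.2.2.2
            rwa [Set.ncard_eq_toFinset_card', Set.toFinset_ofPred] at this)
      refine ⟨some f, by simp, ?_⟩
      rintro _ ⟨⟩ a b hab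
      have hab' := f.injective.ne hab
      refine ⟨L (f a) (f b), (hL _ _ hab').1, (hL _ _ hab').2.1, (hL _ _ hab').2.2.1,
        (hL _ _ hab').2.2.2.1, fun c hca hcb => ?_⟩
      have := hf a b c hab hca hcb
      rw [if_neg hab'] at this
      simpa using this
  choose o ho ho' using hc
  obtain ⟨c, e, he⟩ := exists_monochromatic le_rfl o
  cases c with
  | none =>
    exact Or.inr ⟨(Fin.castAddEmb K).trans e.toEmbedding, fun i => ho _ (he _)⟩
  | some h =>
    left
    let g : Fin K ↪ Fin _ := (Fin.natAddEmb t).trans e.toEmbedding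
    exact hnK V G (A ∘ h) (B ∘ g) (fun _ => hA _) (fun i i' hne => hAA _ _ (h.injective.ne hne))
      (fun i i' hne => hBB _ _ (g.injective.ne hne)) (fun _ _ => hAB _ _)
      (fun j => ho' _ h (he _))

theorem IsTightPath.isPathSet {V : Type} {G : SimpleGraph V} {K X Y : Set V} {p : ℕ → V} {n : ℕ}
    (h : IsTightPath G K X Y p n) : IsPathSet G (p '' Set.Icc 0 n) := by
  refine ⟨n, ⟨RelIso.symm ⟨Equiv.ofBijective
    (fun i : Fin (n + 1) => (⟨p i, i, ⟨Nat.zero_le _, by omega⟩, rfl⟩ : p '' Set.Icc 0 n))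
    ⟨?_, ?_⟩, ?_⟩⟩⟩
  · intro i j hij
    exact Fin.ext (h.inj (by omega) (by omega) (Subtype.ext_iff.1 hij))
  · rintro ⟨_, i, ⟨-, hi⟩, rfl⟩
    exact ⟨⟨i, by omega⟩, rfl⟩
  · intro i j
    rw [pathGraph_adj]
    show G.Adj (p i) (p j) ↔ _
    constructor
    · intro hadj
      rcases lt_trichotomy i.val j.val with hlt | heq | hlt
      · left
        exact (h.induced _ _ hlt (by omega) hadj).symm
      · rw [heq] at hadj
        exact absurd hadj (G.loopless.irrefl _)
      · right
        exact (h.induced _ _ hlt (by omega) hadj.symm).symm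
    · rintro (hij | hij)
      · rw [← hij]
        exact h.adj _ (by omega)
      · rw [← hij]
        exact (h.adj _ (by omega)).symm

theorem exists_path_model_right (r k : ℕ) : ∃ M m, ∀ (V : Type) (G : SimpleGraph V)
    (A : Fin M → Set V) (B : Fin m → Set V), IsModel G A B → HasInducedMinor G (Wall r) ∨
    ∃ (e : Fin k ↪ Fin M) (B' : Fin k → Set V), (∀ j, IsPathSet G (B' j)) ∧ IsModel G (A ∘ e) B' := by
  classical
  obtain ⟨M, hM⟩ := exists_wall_of_connectors r k
  obtain ⟨m, hm⟩ := hM (Fintype.card (Finset (Fin M)) * k)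
  refine ⟨M, m, ?_⟩
  intro V G A B h
  rcases hm V G A B (fun j => ∃ s : Finset (Fin M), k ≤ s.card ∧ ∃ L ⊆ B j, ConnSet G L ∧
    IsPathSet G L ∧ ∀ i ∈ s, Touch G (A i) L) h.left_conn h.left_anti h.right_anti h.disj (by
      intro j
      by_contra hcon
      rw [not_or] at hcon
      obtain ⟨hcon, hcon'⟩ := hcon
      refine hcon' fun a b _ => ?_
      obtain ⟨u, hu, v, hv, huv⟩ := h.touch a j
      obtain ⟨u', hu', v', hv', huv'⟩ := h.touch b j
      obtain ⟨p, n, hp⟩ := (h.right_conn j).exists_tightPath (X := {v | ∃ u ∈ A a, G.Adj u v})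
        (Y := {v | ∃ u ∈ A b, G.Adj u v}) ⟨v, hv, u, hu, huv⟩ ⟨v', hv', u', hu', huv'⟩
      have hsub : p '' Set.Icc 0 n ⊆ B j := by
        rintro _ ⟨i, hi, rfl⟩
        exact hp.mem i hi.2
      refine ⟨p '' Set.Icc 0 n, hsub, hp.connSet, ?_, ?_, ?_⟩
      · obtain ⟨w, hw, hwp⟩ := hp.fst_mem
        exact ⟨p 0, ⟨0, by simp, rfl⟩, w, hw, hwp.symm⟩
      · obtain ⟨w, hw, hwp⟩ := hp.lst_mem
        exact ⟨p n, ⟨n, by simp, rfl⟩, w, hw, hwp.symm⟩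
      · by_contra hk
        refine hcon ⟨Finset.univ.filter fun c => Touch G (p '' Set.Icc 0 n) (A c), ?_, _, hsub,
          hp.connSet, hp.isPathSet, fun i hi => (Finset.mem_filter.1 hi).2.symm⟩
        rw [Set.ncard_eq_toFinset_card', Set.toFinset_ofPred] at hk
        omega) with hw | ⟨g, hg⟩
  · exact Or.inl hw
  · right
    choose s hs L hLB hL hLp hLt using hg
    obtain ⟨s₀, g', hg'⟩ := exists_monochromatic le_rfl s
    by_cases hk : k = 0
    · subst hk
      exact ⟨⟨Fin.elim0, fun i => i.elim0⟩, Fin.elim0, fun j => j.elim0,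
        ⟨fun j => j.elim0, fun j => j.elim0, fun j => j.elim0, fun j => j.elim0, fun j => j.elim0,
          fun j => j.elim0⟩⟩
    obtain ⟨e, he⟩ := exists_finEmbedding_of_card_le (hg' ⟨0, by omega⟩ ▸ hs _)
    refine ⟨e, fun j => L (g' j), fun j => hLp _, fun _ => h.left_conn _, fun _ => hL _,
      fun _ _ hne => h.left_anti _ _ (e.injective.ne hne),
      fun _ _ hne => Anticomplete.mono (h.right_anti _ _ (g.injective.ne (g'.injective.ne hne)))
        (hLB _) (hLB _),
      fun _ _ => (h.disj _ _).mono_right (hLB _), fun i j => hLt _ _ ?_⟩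
    rw [hg']
    exact he i

theorem exists_path_model (r k : ℕ) : ∃ f, ∀ (V : Type) (G : SimpleGraph V)
    (A B : Fin f → Set V), IsModel G A B → HasInducedMinor G (Wall r) ∨
    ∃ A' B' : Fin k → Set V, (∀ j, IsPathSet G (A' j)) ∧ (∀ j, IsPathSet G (B' j)) ∧
      IsModel G A' B' := by
  obtain ⟨M, m, hMm⟩ := exists_path_model_right r k
  obtain ⟨M', m', hMm'⟩ := exists_path_model_right r (M + m)
  refine ⟨M' + m', ?_⟩
  intro V G A B h
  rcases hMm' V G _ _ (h.comp (Fin.castAddEmb m') (Fin.natAddEmb M')) with hw | ⟨e, B', hB', h'⟩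
  · exact Or.inl hw
  rcases hMm V G _ _ (h'.comp (Fin.natAddEmb M) (Fin.castAddEmb m)).symm with
    hw | ⟨e', A', hA', h''⟩
  · exact Or.inl hw
  · exact Or.inr ⟨A', _, hA', fun j => hB' _, h''.symm⟩

theorem compsOn_iUnion {V ι : Type} {G : SimpleGraph V} {A : ι → Set V}
    (hA : ∀ i, ConnSet G (A i)) (hAA : ∀ i i', i ≠ i' → Anticomplete G (A i) (A i')) :
    CompsOn G (⋃ i, A i) = Set.range A := by
  have key : ∀ i v (hv : v ∈ ⋃ i, A i), v ∈ A i →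
      Subtype.val '' ((G.induce (⋃ i, A i)).connectedComponentMk ⟨v, hv⟩).supp = A i := by
    intro i v hv hvi
    ext w
    constructor
    · rintro ⟨⟨w, hw⟩, hwC, rfl⟩
      obtain ⟨walk⟩ := ConnectedComponent.exact hwC
      have hwalk : ∀ x y, (G.induce (⋃ i, A i)).Walk x y → y.1 ∈ A i → x.1 ∈ A i := by
        intro x y walk hy
        induction walk with
        | nil => exact hy
        | @cons x z y hxz _ ih =>
          obtain ⟨i', hi'⟩ := Set.mem_iUnion.1 x.2
          have hz := ih hy
          have : i' = i := by
            by_contra hne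
            exact (hAA _ _ hne).2 _ hi' _ hz hxz
          exact this ▸ hi'
      exact hwalk _ _ walk hvi
    · intro hw
      obtain ⟨hw', h⟩ := (hA i).2 (fun w => ∃ hw : w ∈ ⋃ i, A i,
        (G.induce (⋃ i, A i)).Reachable ⟨w, hw⟩ ⟨v, hv⟩) ⟨v, hvi, hv, Reachable.refl _⟩ (by
          rintro a ha b hb hab ⟨ha', h⟩
          have hb' : b ∈ ⋃ i, A i := Set.mem_iUnion.2 ⟨i, hb⟩
          have hab' : (G.induce (⋃ i, A i)).Adj ⟨b, hb'⟩ ⟨a, ha'⟩ := hab.symm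
          exact ⟨hb', hab'.reachable.trans h⟩) w hw
      exact ⟨⟨w, hw'⟩, ConnectedComponent.sound h, rfl⟩
  ext L
  constructor
  · rintro ⟨C, rfl⟩
    induction C using ConnectedComponent.ind with
    | _ v =>
      obtain ⟨v, hv⟩ := v
      obtain ⟨i, hi⟩ := Set.mem_iUnion.1 hv
      exact ⟨i, (key i v hv hi).symm⟩
  · rintro ⟨i, rfl⟩
    obtain ⟨v, hv⟩ := (hA i).1
    exact ⟨_, (key i v (Set.mem_iUnion.2 ⟨i, hv⟩) hv).symm⟩

theorem exists_constellation {V : Type} {G : SimpleGraph V} {s l : ℕ} {A : Fin l → Set V}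
    {b : Fin s → V} (hp : ∀ i, IsPathSet G (A i)) (hA : ∀ i, ConnSet G (A i))
    (hAA : ∀ i i', i ≠ i' → Anticomplete G (A i) (A i')) (hb : Function.Injective b)
    (hbb : ∀ j j', ¬ G.Adj (b j) (b j')) (hbA : ∀ i j, b j ∉ A i)
    (ht : ∀ i j, Touch G {b j} (A i)) : ∃ W S : Set V, IsConstellationOn G W S ∧ S.ncard = s ∧
      (CompsOn G (W \ S)).ncard = l := by
  have hW : ((Set.range b ∪ ⋃ i, A i) \ Set.range b) = ⋃ i, A i := by
    ext v
    constructor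
    · rintro ⟨h | h, h'⟩
      · exact absurd h h'
      · exact h
    · intro h
      refine ⟨Or.inr h, ?_⟩
      rintro ⟨j, rfl⟩
      obtain ⟨i, hi⟩ := Set.mem_iUnion.1 h
      exact hbA i j hi
  refine ⟨Set.range b ∪ ⋃ i, A i, Set.range b, ⟨Set.subset_union_left, ?_, ?_, ?_⟩, ?_, ?_⟩
  · rintro _ ⟨j, rfl⟩ _ ⟨j', rfl⟩
    exact hbb j j'
  · rw [hW, compsOn_iUnion hA hAA]
    rintro _ ⟨i, rfl⟩
    exact hp i
  · rw [hW, compsOn_iUnion hA hAA]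
    rintro _ ⟨j, rfl⟩ _ ⟨i, rfl⟩
    obtain ⟨_, rfl, y, hy, hxy⟩ := ht i j
    exact ⟨y, hy, hxy⟩
  · rw [← Set.image_univ, Set.ncard_image_of_injective _ hb]
    simp
  · rw [hW, compsOn_iUnion hA hAA, ← Set.image_univ, Set.ncard_image_of_injective]
    · simp
    · intro i i' h
      by_contra hne
      obtain ⟨v, hv⟩ := (hA i).1
      exact Set.disjoint_left.1 (hAA i i' hne).1 hv (h ▸ hv)

/-- No vertex, and no pair of adjacent vertices in the same `B j`, touches two of the sets `A`. -/
def Ample {V ι κ : Type} (G : SimpleGraph V) (A : ι → Set V) (B : κ → Set V) : Prop :=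
  ∀ j, ∀ u ∈ B j, ∀ v ∈ B j, (u = v ∨ G.Adj u v) → ∀ i i', Touch G {u} (A i) →
    Touch G {v} (A i') → i = i'

theorem Ample.comp {V ι κ ι' κ' : Type} {G : SimpleGraph V} {A : ι → Set V} {B : κ → Set V}
    (h : Ample G A B) (e : ι' ↪ ι) (g : κ' ↪ κ) : Ample G (A ∘ e) (B ∘ g) :=
  fun _ u hu v hv huv _ _ hui hvi => e.injective (h _ u hu v hv huv _ _ hui hvi)

theorem exists_ample_right (r s l k : ℕ) : ∃ M m, ∀ (V : Type) (G : SimpleGraph V)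
    (A : Fin M → Set V) (B : Fin m → Set V), IsModel G A B → (∀ i, IsPathSet G (A i)) →
    HasInducedMinor G (Wall r) ∨
    (∃ W S : Set V, IsConstellationOn G W S ∧ S.ncard = s ∧ (CompsOn G (W \ S)).ncard = l) ∨
    ∃ (e : Fin k ↪ Fin M) (g : Fin k ↪ Fin m), Ample G (A ∘ e) (B ∘ g) := by
  classical
  obtain ⟨M₁, hM₁⟩ := exists_wall_of_connectors r (l + l)
  obtain ⟨m₁, hm₁⟩ := hM₁ 1
  obtain ⟨M, hM⟩ := exists_ramsey 2 M₁ k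
  refine ⟨M, Fintype.card (Fin 3 × Finset (Fin M)) * (s + (m₁ + k) + 1), ?_⟩
  intro V G A B h hp
  have hcol : ∀ j, ∃ c : Fin 3 × Finset (Fin M),
      (c.1 = 0 → l ≤ c.2.card ∧ ∃ v ∈ B j, ∀ i ∈ c.2, Touch G {v} (A i)) ∧
      (c.1 = 1 → c.2.card = M₁ ∧ ∀ a ∈ c.2, ∀ b ∈ c.2, a ≠ b → ∃ L ⊆ B j, ConnSet G L ∧
        Touch G L (A a) ∧ Touch G L (A b) ∧ {c | Touch G L (A c)}.ncard ≤ l + l) ∧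
      (c.1 = 2 → c.2.card = k ∧ ∀ u ∈ B j, ∀ v ∈ B j, (u = v ∨ G.Adj u v) → ∀ i ∈ c.2, ∀ i' ∈ c.2,
        Touch G {u} (A i) → Touch G {v} (A i') → i = i') := by
    intro j
    by_cases hdeg : ∃ v ∈ B j, l ≤ (Finset.univ.filter fun i => Touch G {v} (A i)).card
    · obtain ⟨v, hv, hvl⟩ := hdeg
      exact ⟨(0, _), fun _ => ⟨hvl, v, hv, fun i hi => (Finset.mem_filter.1 hi).2⟩, by simp,
        by simp⟩
    push Not at hdeg
    rcases hM (Fin M) Finset.univ (by simp) (fun T => ∃ a ∈ T, ∃ b ∈ T, a ≠ b ∧ ∃ u ∈ B j,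
      ∃ v ∈ B j, (u = v ∨ G.Adj u v) ∧ Touch G {u} (A a) ∧ Touch G {v} (A b)) with
      ⟨X, -, hXc, hX⟩ | ⟨X, -, hXc, hX⟩
    · refine ⟨(1, X), by simp, fun _ => ⟨hXc, fun a ha b hb hab => ?_⟩, by simp⟩
      obtain ⟨a', ha', b', hb', hab', u, hu, v, hv, huv, hua, hvb⟩ := hX {a, b} (by
        intro x hx
        rcases Finset.mem_insert.1 hx with rfl | hx
        · exact ha
        · exact Finset.mem_singleton.1 hx ▸ hb) (Finset.card_pair hab)
      have hL : {u, v} ⊆ B j := by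
        rintro x (rfl | rfl)
        · exact hu
        · exact hv
      have hLc : ConnSet G {u, v} := by
        rcases huv with rfl | huv
        · simpa using connSet_singleton G u
        · exact connSet_pair huv
      have hta : Touch G {u, v} (A a') := hua.mono (by simp) subset_rfl
      have htb : Touch G {u, v} (A b') := hvb.mono (by simp) subset_rfl
      have hcard : {c | Touch G {u, v} (A c)}.ncard ≤ l + l := by
        have hsub : {c | Touch G {u, v} (A c)} ⊆
            ((Finset.univ.filter fun i => Touch G {u} (A i)) ∪
              (Finset.univ.filter fun i => Touch G {v} (A i)) : Finset (Fin M)) := by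
          rintro c ⟨x, hx, y, hy, hxy⟩
          rw [Finset.mem_coe, Finset.mem_union, Finset.mem_filter, Finset.mem_filter]
          rcases hx with rfl | rfl
          · exact Or.inl ⟨Finset.mem_univ _, _, rfl, y, hy, hxy⟩
          · exact Or.inr ⟨Finset.mem_univ _, _, rfl, y, hy, hxy⟩
        refine (Set.ncard_le_ncard hsub).trans ?_
        rw [Set.ncard_coe_finset]
        have h1 := hdeg u hu
        have h2 := hdeg v hv
        refine (Finset.card_union_le _ _).trans (by omega)
      rw [Finset.mem_insert, Finset.mem_singleton] at ha' hb'
      rcases ha' with rfl | rfl <;> rcases hb' with rfl | rfl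
      · exact absurd rfl hab'
      · exact ⟨_, hL, hLc, hta, htb, hcard⟩
      · exact ⟨_, hL, hLc, htb, hta, hcard⟩
      · exact absurd rfl hab'
    · refine ⟨(2, X), by simp, by simp, fun _ => ⟨hXc, ?_⟩⟩
      intro u hu v hv huv a ha b hb hua hvb
      by_contra hab
      refine hX {a, b} ?_ (Finset.card_pair hab) ⟨a, by simp, b, by simp, hab, u, hu, v, hv, huv,
        hua, hvb⟩
      intro x hx
      rcases Finset.mem_insert.1 hx with rfl | hx
      · exact ha
      · exact Finset.mem_singleton.1 hx ▸ hb
  choose c hc0 hc1 hc2 using hcol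
  obtain ⟨⟨q, X⟩, g, hg⟩ := exists_monochromatic le_rfl c
  have hgX : ∀ i, (c (g i)).2 = X := fun i => by rw [hg]
  have hgq : ∀ i, (c (g i)).1 = q := fun i => by rw [hg]
  let i₀ : Fin (s + (m₁ + k) + 1) := Fin.last _
  fin_cases q
  · right; left
    obtain ⟨e, he⟩ := exists_finEmbedding_of_card_le (hgX i₀ ▸ (hc0 (g i₀) (hgq i₀)).1)
    have hb : ∀ i : Fin s, ∃ v ∈ B (g (Fin.castAdd _ i).castSucc), ∀ i ∈ X, Touch G {v} (A i) := by
      intro i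
      rw [← hgX (Fin.castAdd _ i).castSucc]
      exact (hc0 _ (hgq _)).2
    choose b hbB hbt using hb
    have hne : ∀ {i i' : Fin s}, i ≠ i' → g (Fin.castAdd (m₁ + k) i).castSucc ≠
        g (Fin.castAdd (m₁ + k) i').castSucc := fun hne =>
      g.injective.ne fun h' => hne (Fin.castAdd_injective _ _ (Fin.castSucc_injective _ h'))
    refine exists_constellation (A := A ∘ e) (b := b) (fun _ => hp _) (fun _ => h.left_conn _)
      (fun _ _ hne => h.left_anti _ _ (e.injective.ne hne)) ?_ ?_ ?_ (fun i j => hbt _ _ (he i))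
    · intro i i' hii
      by_contra hn
      exact Set.disjoint_left.1 (h.right_anti _ _ (hne hn)).1 (hbB i) (hii ▸ hbB i')
    · intro i i' hadj
      by_cases hii : i = i'
      · subst hii
        exact G.loopless.irrefl _ hadj
      · exact (h.right_anti _ _ (hne hii)).2 _ (hbB i) _ (hbB i') hadj
    · exact fun i j hj => Set.disjoint_left.1 (h.disj _ _) hj (hbB j)
  · left
    obtain ⟨e, he⟩ := exists_finEmbedding_of_card_le (hgX i₀ ▸ (hc1 (g i₀) (hgq i₀)).1.ge)
    let g' : Fin m₁ ↪ Fin _ := ((Fin.castAddEmb k).trans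
      ((Fin.natAddEmb s).trans Fin.castSuccEmb)).trans g.toEmbedding
    rcases hm₁ V G (A ∘ e) (B ∘ g') (fun _ => False) (fun _ => h.left_conn _)
      (fun _ _ hne => h.left_anti _ _ (e.injective.ne hne))
      (fun _ _ hne => h.right_anti _ _ (g'.injective.ne hne)) (fun _ _ => h.disj _ _) (by
        intro j
        right
        intro a b hab
        obtain ⟨L, h1, h2, h3, h4, h5⟩ := (hc1 (g' j) (hgq _)).2 (e a) (hgX _ ▸ he a) (e b)
          (hgX _ ▸ he b) (e.injective.ne hab)
        refine ⟨L, h1, h2, h3, h4, le_trans ?_ h5⟩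
        exact Set.ncard_le_ncard_of_injOn e (fun c hc => hc) e.injective.injOn) with hw | ⟨_, hF⟩
    · exact hw
    · exact absurd (hF 0) id
  · right; right
    obtain ⟨e, he⟩ := exists_finEmbedding_of_card_le (hgX i₀ ▸ (hc2 (g i₀) (hgq i₀)).1.ge)
    let g' : Fin k ↪ Fin _ := ((Fin.natAddEmb m₁).trans
      ((Fin.natAddEmb s).trans Fin.castSuccEmb)).trans g.toEmbedding
    refine ⟨e, g', fun j u hu v hv huv i i' hui hvi => e.injective ?_⟩
    exact (hc2 (g' j) (hgq _)).2 u hu v hv huv _ (hgX _ ▸ he i) _ (hgX _ ▸ he i') hui hvi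

theorem exists_ample (r s l k : ℕ) : ∃ f, ∀ (V : Type) (G : SimpleGraph V)
    (A B : Fin f → Set V), IsModel G A B → (∀ i, IsPathSet G (A i)) → (∀ i, IsPathSet G (B i)) →
    HasInducedMinor G (Wall r) ∨
    (∃ W S : Set V, IsConstellationOn G W S ∧ S.ncard = s ∧ (CompsOn G (W \ S)).ncard = l) ∨
    ∃ e g : Fin k ↪ Fin f, Ample G (A ∘ e) (B ∘ g) ∧ Ample G (B ∘ g) (A ∘ e) := by
  obtain ⟨M, m, hMm⟩ := exists_ample_right r s l k
  obtain ⟨M', m', hMm'⟩ := exists_ample_right r s l (M + m)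
  refine ⟨M' + m', ?_⟩
  intro V G A B h hA hB
  rcases hMm' V G _ _ (h.comp (Fin.castAddEmb m') (Fin.natAddEmb M')) (fun _ => hA _) with
    hw | hc | ⟨e, g, ha⟩
  · exact Or.inl hw
  · exact Or.inr (Or.inl hc)
  let e₁ : Fin m ↪ Fin (M' + m') := (Fin.natAddEmb M).trans (e.trans (Fin.castAddEmb m'))
  let g₁ : Fin M ↪ Fin (M' + m') := (Fin.castAddEmb m).trans (g.trans (Fin.natAddEmb M'))
  have ha₁ : Ample G (A ∘ e₁) (B ∘ g₁) := ha.comp (Fin.natAddEmb M) (Fin.castAddEmb m)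
  rcases hMm V G _ _ (h.comp e₁ g₁).symm (fun _ => hB _) with hw | hc | ⟨e', g', ha'⟩
  · exact Or.inl hw
  · exact Or.inr (Or.inl hc)
  · exact Or.inr (Or.inr ⟨g'.trans e₁, e'.trans g₁, ha₁.comp g' e', ha'⟩)

/-- Pairwise disjoint induced paths `p a 0, …, p a (len a)`. -/
structure IsInducedPathFamily {V α : Type} (G : SimpleGraph V) (p : α → ℕ → V) (len : α → ℕ) :
    Prop where
  inj : ∀ a i b j, i ≤ len a → j ≤ len b → p a i = p b j → a = b ∧ i = j
  adj : ∀ a i, i < len a → G.Adj (p a i) (p a (i + 1))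
  induced : ∀ a i j, i < j → j ≤ len a → G.Adj (p a i) (p a j) → j = i + 1

/-- The vertices of the paths that have a neighbor on another path. -/
def crossSet {V α : Type} (G : SimpleGraph V) (p : α → ℕ → V) (len : α → ℕ) : Set V :=
  {v | ∃ a, ∃ i ≤ len a, v = p a i ∧ ∃ b, b ≠ a ∧ ∃ j ≤ len b, G.Adj (p a i) (p b j)}

section

variable {V α ι : Type} {G : SimpleGraph V} {p : α → ℕ → V} {len : α → ℕ} {c : ι → Set V}

/-- The subpath from `p a i` to `p a j` has its ends in `c x` and `c y` and avoids `T` otherwise. -/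
def IsSegment (p : α → ℕ → V) (len : α → ℕ) (T : Set V) (c : ι → Set V) (a : α) (i j : ℕ)
    (x y : ι) : Prop :=
  i < j ∧ j ≤ len a ∧ p a i ∈ c x ∧ p a j ∈ c y ∧ ∀ k, i < k → k < j → p a k ∉ T

def segmentGraph (p : α → ℕ → V) (len : α → ℕ) (T : Set V) (c : ι → Set V) : SimpleGraph ι where
  Adj x y := x ≠ y ∧ ∃ a i j, IsSegment p len T c a i j x y ∨ IsSegment p len T c a i j y x
  symm := ⟨fun _ _ h => ⟨h.1.symm, by
    obtain ⟨-, a, i, j, h⟩ := h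
    exact ⟨a, i, j, h.symm⟩⟩⟩
  loopless := ⟨fun _ h => h.1 rfl⟩

theorem connSet_segmentGraph {T : Set V} (hT : ∀ v ∈ T, ∃ x, v ∈ c x)
    (hc : ∀ v x y, v ∈ c x → v ∈ c y → x = y) (a : α)
    (hne : {x | ∃ i ≤ len a, p a i ∈ c x}.Nonempty) :
    ConnSet (segmentGraph p len T c) {x | ∃ i ≤ len a, p a i ∈ c x} := by
  refine ⟨hne, ?_⟩
  rintro P ⟨x, ⟨i, hi, hix⟩, hx⟩ hstep y ⟨j, hj, hjy⟩
  have key : ∀ d i j x y, j = i + d → j ≤ len a → p a i ∈ c x → p a j ∈ c y → (P x ↔ P y) := by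
    intro d
    induction d using Nat.strong_induction_on with
    | _ d ih =>
      intro i j x y hij hj hix hjy
      by_cases hxy : x = y
      · rw [hxy]
      have hd : i < j := by
        rcases Nat.eq_zero_or_pos d with h0 | h0
        · exact absurd (hc _ _ _ hix (by rwa [hij, h0] at hjy)) hxy
        · omega
      by_cases hk : ∃ k, i < k ∧ k < j ∧ p a k ∈ T
      · obtain ⟨k, hik, hkj, hkT⟩ := hk
        obtain ⟨z, hz⟩ := hT _ hkT
        exact (ih (k - i) (by omega) i k x z (by omega) (by omega) hix hz).trans
          (ih (j - k) (by omega) k j z y (by omega) hj hz hjy)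
      · push Not at hk
        have hadj : (segmentGraph p len T c).Adj x y := ⟨hxy, a, i, j, Or.inl ⟨hd, hj, hix, hjy, hk⟩⟩
        have hx : x ∈ {x | ∃ i ≤ len a, p a i ∈ c x} := ⟨i, by omega, hix⟩
        have hy : y ∈ {x | ∃ i ≤ len a, p a i ∈ c x} := ⟨j, hj, hjy⟩
        exact ⟨hstep x hx y hy hadj, hstep y hy x hx hadj.symm⟩
  rcases le_total i j with hij | hij
  · exact (key (j - i) i j x y (by omega) hj hix hjy).1 hx
  · exact (key (i - j) j i y x (by omega) hi hjy hix).2 hx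

theorem IsInducedPathFamily.eq_or_succ_of_adj (hp : IsInducedPathFamily G p len) {a : α} {i j : ℕ}
    (hi : i ≤ len a) (hj : j ≤ len a) (h : G.Adj (p a i) (p a j)) : j = i + 1 ∨ i = j + 1 := by
  rcases lt_trichotomy i j with hlt | heq | hlt
  · exact Or.inl (hp.induced a i j hlt hj h)
  · exact absurd h (heq ▸ G.loopless.irrefl _)
  · exact Or.inr (hp.induced a j i hlt hi h.symm)

theorem mem_crossSet {a b : α} {i j : ℕ} (hi : i ≤ len a) (hj : j ≤ len b) (hab : b ≠ a)
    (h : G.Adj (p a i) (p b j)) : p a i ∈ crossSet G p len :=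
  ⟨a, i, hi, rfl, b, hab, j, hj, h⟩

theorem IsInducedPathFamily.exists_isSubdivMinor (hp : IsInducedPathFamily G p len)
    (hc : ∀ x, ConnSet G (c x)) (hcc : ∀ x y, x ≠ y → Anticomplete G (c x) (c y))
    (hcT : ∀ x, c x ⊆ crossSet G p len) :
    ∃ σ, IsSubdivMinor G (segmentGraph p len (crossSet G p len) c) c σ := by
  classical
  set T := crossSet G p len with hT
  have hcu : ∀ {v x y}, v ∈ c x → v ∈ c y → x = y := by
    intro v x y hx hy
    by_contra hne
    exact Set.disjoint_left.1 (hcc x y hne).1 hx hy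
  have hch : ∀ e : Sym2 ι, ∃ t : (α × ℕ × ℕ) × ι × ι, e ∈ (segmentGraph p len T c).edgeSet →
      e = s(t.2.1, t.2.2) ∧ t.2.1 ≠ t.2.2 ∧
        IsSegment p len T c t.1.1 t.1.2.1 t.1.2.2 t.2.1 t.2.2 := by
    intro e
    induction e using Sym2.ind with
    | _ x y =>
      by_cases h : (segmentGraph p len T c).Adj x y
      · obtain ⟨hxy, a, i, j, h | h⟩ := h
        · exact ⟨((a, i, j), x, y), fun _ => ⟨rfl, hxy, h⟩⟩
        · exact ⟨((a, i, j), y, x), fun _ => ⟨Sym2.eq_swap, hxy.symm, h⟩⟩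
      · by_cases hα : Nonempty α
        · exact ⟨((hα.some, 0, 0), x, y), fun h' => absurd h' h⟩
        · obtain ⟨v, hv⟩ := (hc x).1
          obtain ⟨a, -⟩ := hcT x hv
          exact absurd ⟨a⟩ hα
  choose t ht using hch
  let σ : Sym2 ι → Set V := fun e => p (t e).1.1 '' Set.Icc ((t e).1.2.1 + 1) ((t e).1.2.2 - 1)
  have hlen : ∀ e ∈ (segmentGraph p len T c).edgeSet, (t e).1.2.1 + 2 ≤ (t e).1.2.2 := by
    intro e he
    obtain ⟨-, hne, hij, hj, hx, hy, -⟩ := ht e he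
    by_contra hlt
    have hj' : (t e).1.2.2 = (t e).1.2.1 + 1 := by omega
    rw [hj'] at hy
    exact (hcc _ _ hne).2 _ hx _ hy (hp.adj _ _ (by omega))
  have hmem : ∀ e ∈ (segmentGraph p len T c).edgeSet, ∀ v ∈ σ e, ∃ k, (t e).1.2.1 < k ∧
      k < (t e).1.2.2 ∧ k ≤ len (t e).1.1 ∧ v = p (t e).1.1 k ∧ v ∉ T := by
    rintro e he _ ⟨k, ⟨hk, hk'⟩, rfl⟩
    have h2 := hlen e he
    obtain ⟨-, hne, hij, hj, hx, hy, hT⟩ := ht e he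
    exact ⟨k, by omega, by omega, by omega, rfl, hT k (by omega) (by omega)⟩
  refine ⟨σ, hc, ?_, hcc, ?_, ?_, ?_, ?_⟩
  · intro e he
    have h2 := hlen e he
    obtain ⟨-, hne, hij, hj, hx, hy, -⟩ := ht e he
    exact connSet_image_Icc _ _ _ (by omega) fun k _ hk => hp.adj _ _ (by omega)
  · intro x e he
    refine Set.disjoint_left.2 fun v hvx hv => ?_
    obtain ⟨-, -, -, -, -, h⟩ := hmem e he v hv
    exact h (hcT x hvx)
  · intro e he x hx
    have h2 := hlen e he
    obtain ⟨hexy, hne, hij, hj, hxe, hye, -⟩ := ht e he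
    rw [hexy, Sym2.mem_iff] at hx
    rcases hx with rfl | rfl
    · exact ⟨_, ⟨(t e).1.2.1 + 1, ⟨le_rfl, by omega⟩, rfl⟩, _, hxe, (hp.adj _ _ (by omega)).symm⟩
    · refine ⟨_, ⟨(t e).1.2.2 - 1, ⟨by omega, le_rfl⟩, rfl⟩, _, hye, ?_⟩
      have := hp.adj (t e).1.1 ((t e).1.2.2 - 1) (by omega)
      rwa [Nat.sub_add_cancel (by omega)] at this
  · rintro e he x hx ⟨v, hv, w, hw, hvw⟩
    obtain ⟨k, hk1, hk2, hk3, rfl, hkT⟩ := hmem e he v hv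
    obtain ⟨hexy, hne, hij, hj, hxe, hye, hin⟩ := ht e he
    obtain ⟨b, m, hm, rfl, hwT⟩ := hcT x hw
    rw [hexy, Sym2.mem_iff, not_or] at hx
    by_cases hb : b = (t e).1.1
    · subst hb
      have hmi : m ≠ (t e).1.2.1 := fun h => hx.1 (hcu (h ▸ hw) hxe)
      have hmj : m ≠ (t e).1.2.2 := fun h => hx.2 (hcu (h ▸ hw) hye)
      have := hp.eq_or_succ_of_adj hk3 hm hvw
      exact hin m (by omega) (by omega) (hcT x hw)
    · exact hkT (mem_crossSet hk3 hm hb hvw)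
  · intro e he e' he' hee
    have hfar : ∀ v ∈ σ e, ∀ w ∈ σ e', ¬ (v = w ∨ G.Adj v w) := by
      intro v hv w hw hvw
      obtain ⟨k, hk1, hk2, hk3, rfl, hkT⟩ := hmem e he v hv
      obtain ⟨m, hm1, hm2, hm3, rfl, hmT⟩ := hmem e' he' w hw
      obtain ⟨hexy, hne, hij, hj, hxe, hye, hin⟩ := ht e he
      obtain ⟨hexy', hne', hij', hj', hxe', hye', hin'⟩ := ht e' he'
      have hab : (t e).1.1 = (t e').1.1 := by
        rcases hvw with h | h
        · exact (hp.inj _ _ _ _ hk3 hm3 h).1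
        · by_contra hne
          exact hkT (mem_crossSet hk3 hm3 (Ne.symm hne) h)
      rw [← hab] at hvw hxe' hye' hin' hm3
      have hkm : k = m ∨ m = k + 1 ∨ k = m + 1 := by
        rcases hvw with h | h
        · exact Or.inl (hp.inj _ _ _ _ hk3 hm3 h).2
        · exact Or.inr (hp.eq_or_succ_of_adj hk3 hm3 h)
      have hi : (t e).1.2.1 = (t e').1.2.1 := by
        rcases lt_trichotomy (t e).1.2.1 (t e').1.2.1 with hlt | heq | hlt
        · exact absurd (hcT _ hxe') (hin _ hlt (by omega))
        · exact heq
        · exact absurd (hcT _ hxe) (hin' _ hlt (by omega))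
      have hj : (t e).1.2.2 = (t e').1.2.2 := by
        rcases lt_trichotomy (t e).1.2.2 (t e').1.2.2 with hlt | heq | hlt
        · exact absurd (hcT _ hye) (hin' _ (by omega) hlt)
        · exact heq
        · exact absurd (hcT _ hye') (hin _ (by omega) hlt)
      rw [← hi] at hxe'
      rw [← hj] at hye'
      exact hee (by rw [hexy, hexy', hcu hxe hxe', hcu hye hye'])
    exact ⟨Set.disjoint_left.2 fun v hv hv' => hfar v hv v hv' (Or.inl rfl),
      fun v hv w hw h => hfar v hv w hw (Or.inr h)⟩

end

theorem IsPathSet.exists_enumeration {V : Type} {G : SimpleGraph V} {P : Set V}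
    (h : IsPathSet G P) : ∃ (p : ℕ → V) (n : ℕ), P = p '' Set.Icc 0 n ∧
      (∀ i j, i ≤ n → j ≤ n → p i = p j → i = j) ∧ (∀ i < n, G.Adj (p i) (p (i + 1))) ∧
      ∀ i j, i < j → j ≤ n → G.Adj (p i) (p j) → j = i + 1 := by
  obtain ⟨n, ⟨φ⟩⟩ := h
  let p : ℕ → V := fun i => (φ.symm (Fin.ofNat (n + 1) i)).1
  have hval : ∀ i ≤ n, (Fin.ofNat (n + 1) i).val = i := fun i hi => by
    simp [Fin.ofNat]
    omega
  have hadj : ∀ i j, i ≤ n → j ≤ n → (G.Adj (p i) (p j) ↔ i + 1 = j ∨ j + 1 = i) := by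
    intro i j hi hj
    have := φ.symm.map_rel_iff (a := Fin.ofNat (n + 1) i) (b := Fin.ofNat (n + 1) j)
    rw [pathGraph_adj, hval i hi, hval j hj] at this
    exact this
  refine ⟨p, n, ?_, ?_, ?_, ?_⟩
  · ext v
    constructor
    · intro hv
      refine ⟨(φ ⟨v, hv⟩).val, ⟨Nat.zero_le _, by omega⟩, ?_⟩
      have : Fin.ofNat (n + 1) (φ ⟨v, hv⟩).val = φ ⟨v, hv⟩ := Fin.ext (hval _ (by omega))
      simp only [p, this, RelIso.symm_apply_apply]
    · rintro ⟨i, -, rfl⟩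
      exact (φ.symm _).2
  · intro i j hi hj hij
    have := φ.symm.injective (Subtype.ext hij)
    rw [← hval i hi, ← hval j hj, this]
  · intro i hi
    exact (hadj i (i + 1) (by omega) (by omega)).2 (Or.inl rfl)
  · intro i j hij hj h
    have := (hadj i j (by omega) hj).1 h
    omega

/-- A connected set of vertices with neighbors on the opposite side meets only one set of an ample
side. -/
theorem Ample.eq_of_mem {V ι κ : Type} {G : SimpleGraph V} {A : ι → Set V} {B : κ → Set V}
    (ha : Ample G A B) (h : IsModel G A B) {K : Set V} (hK : ConnSet G K)
    (hKU : ∀ v ∈ K, (∃ i, v ∈ A i) ∨ ∃ j i, v ∈ B j ∧ Touch G {v} (A i)) {i i' : ι} {v w : V}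
    (hv : v ∈ K) (hvi : v ∈ A i) (hw : w ∈ K) (hwi : w ∈ A i') : i = i' := by
  have hAeq : ∀ {u i i'}, u ∈ A i → u ∈ A i' → i = i' := by
    intro u i i' hu hu'
    by_contra hne
    exact Set.disjoint_left.1 (h.left_anti i i' hne).1 hu hu'
  have key := hK.2 (fun u => u ∈ A i ∨ ∃ j, u ∈ B j ∧ Touch G {u} (A i)) ⟨v, hv, Or.inl hvi⟩ (by
    intro a haK b hbK hab hPa
    rcases hKU b hbK with ⟨i₁, hb⟩ | ⟨j₁, i₁, hb, hbt⟩
    · left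
      have : i = i₁ := by
        rcases hPa with hPa | ⟨j, haj, hat⟩
        · by_contra hne
          exact (h.left_anti i i₁ hne).2 _ hPa _ hb hab
        · exact ha j a haj a haj (Or.inl rfl) i i₁ hat ⟨a, rfl, b, hb, hab⟩
      exact this ▸ hb
    · right
      refine ⟨j₁, hb, ?_⟩
      rcases hPa with hPa | ⟨j, haj, hat⟩
      · exact ⟨b, rfl, a, hPa, hab.symm⟩
      · have hj : j = j₁ := by
          by_contra hne
          exact (h.right_anti j j₁ hne).2 _ haj _ hb hab
        subst hj
        have : i = i₁ := ha j a haj b hb (Or.inr hab) i i₁ hat hbt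
        exact this ▸ hbt) w hw
  rcases key with hk | ⟨j, hj, -⟩
  · exact hAeq hk hwi
  · exact absurd hj (Set.disjoint_left.1 (h.disj _ _) hwi)

theorem exists_wall_of_ample (r : ℕ) : ∃ n, ∀ (V : Type) [Finite V] (G : SimpleGraph V)
    (A B : Fin n → Set V), IsModel G A B → (∀ i, IsPathSet G (A i)) → (∀ i, IsPathSet G (B i)) →
    Ample G A B → Ample G B A → HasInducedMinor G (Wall r) := by
  classical
  obtain ⟨n, hn⟩ := exists_wall_of_crossing r
  refine ⟨n, ?_⟩
  intro V _ G A B h hA hB hAB hBA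
  let P : Fin n ⊕ Fin n → Set V := Sum.elim A B
  have hP : ∀ a, IsPathSet G (P a) := by
    rintro (i | j)
    · exact hA i
    · exact hB j
  have hPd : ∀ a b, a ≠ b → Disjoint (P a) (P b) := by
    rintro (i | i) (j | j) hab
    · exact (h.left_anti i j fun h' => hab (h' ▸ rfl)).1
    · exact h.disj i j
    · exact (h.disj j i).symm
    · exact (h.right_anti i j fun h' => hab (h' ▸ rfl)).1
  choose p len hPp hinj hadj hind using fun a => IsPathSet.exists_enumeration (hP a)
  have hmemP : ∀ a i, i ≤ len a → p a i ∈ P a := fun a i hi => by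
    rw [hPp a]
    exact ⟨i, ⟨Nat.zero_le _, hi⟩, rfl⟩
  have hPmem : ∀ a, ∀ v ∈ P a, ∃ i ≤ len a, p a i = v := fun a v hv => by
    rw [hPp a] at hv
    obtain ⟨i, hi, rfl⟩ := hv
    exact ⟨i, hi.2, rfl⟩
  have hp : IsInducedPathFamily G p len := by
    refine ⟨fun a i b j hi hj hij => ?_, hadj, hind⟩
    by_cases hab : a = b
    · subst hab
      exact ⟨rfl, hinj a i j hi hj hij⟩
    · exact absurd (hij ▸ hmemP b j hj) (Set.disjoint_left.1 (hPd a b hab) (hmemP a i hi))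
  set T := crossSet G p len with hT
  have hTmem : ∀ a b, a ≠ b → ∀ u ∈ P a, ∀ v ∈ P b, G.Adj u v → u ∈ T := by
    intro a b hab u hu v hv huv
    obtain ⟨i, hi, rfl⟩ := hPmem a u hu
    obtain ⟨j, hj, rfl⟩ := hPmem b v hv
    exact mem_crossSet hi hj (Ne.symm hab) huv
  have hTP : ∀ v ∈ T, ∃ a b, a ≠ b ∧ v ∈ P a ∧ ∃ w ∈ P b, G.Adj v w := by
    rintro _ ⟨a, i, hi, rfl, b, hab, j, hj, hadj⟩
    exact ⟨a, b, Ne.symm hab, hmemP a i hi, _, hmemP b j hj, hadj⟩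
  have hTU : ∀ v ∈ T, (∃ i, v ∈ A i ∧ ∃ j, Touch G {v} (B j)) ∨
      ∃ j, v ∈ B j ∧ ∃ i, Touch G {v} (A i) := by
    intro v hv
    obtain ⟨i | i, j | j, hab, hva, w, hw, hvw⟩ := hTP v hv
    · exact absurd hvw ((h.left_anti i j fun h' => hab (h' ▸ rfl)).2 _ hva _ hw)
    · exact Or.inl ⟨i, hva, j, v, rfl, w, hw, hvw⟩
    · exact Or.inr ⟨i, hva, j, v, rfl, w, hw, hvw⟩
    · exact absurd hvw ((h.right_anti i j fun h' => hab (h' ▸ rfl)).2 _ hva _ hw)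
  let c : (G.induce T).ConnectedComponent → Set V := fun C => Subtype.val '' C.supp
  have hcT : ∀ C, c C ⊆ T := by
    rintro C _ ⟨v, -, rfl⟩
    exact v.2
  have hTc : ∀ v ∈ T, ∃ C, v ∈ c C := fun v hv =>
    ⟨(G.induce T).connectedComponentMk ⟨v, hv⟩, ⟨v, hv⟩, rfl, rfl⟩
  have hcmk : ∀ C v (hv : v ∈ c C), (G.induce T).connectedComponentMk ⟨v, hcT C hv⟩ = C := by
    rintro C _ ⟨v, hv, rfl⟩
    exact hv
  have hc_adj : ∀ C C' u v, u ∈ c C → v ∈ c C' → G.Adj u v → C = C' := by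
    intro C C' u v hu hv huv
    rw [← hcmk C u hu, ← hcmk C' v hv]
    have : (G.induce T).Adj ⟨u, hcT C hu⟩ ⟨v, hcT C' hv⟩ := huv
    exact ConnectedComponent.sound this.reachable
  have hc_eq : ∀ v C C', v ∈ c C → v ∈ c C' → C = C' := by
    intro v C C' hv hv'
    rw [← hcmk C v hv, ← hcmk C' v hv']
  have hcc : ∀ C C', C ≠ C' → Anticomplete G (c C) (c C') := fun C C' hne =>
    ⟨Set.disjoint_left.2 fun v hv hv' => hne (hc_eq v C C' hv hv'),
      fun u hu v hv huv => hne (hc_adj C C' u v hu hv huv)⟩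
  have hc : ∀ C, ConnSet G (c C) := by
    intro C
    induction C using ConnectedComponent.ind with
    | _ v =>
      refine ⟨⟨v, v, rfl, rfl⟩, ?_⟩
      rintro Q ⟨_, ⟨x, hx, rfl⟩, hQx⟩ hstep _ ⟨y, hy, rfl⟩
      obtain ⟨walk⟩ := ConnectedComponent.exact (hx.trans hy.symm)
      clear hy
      induction walk with
      | nil => exact hQx
      | @cons x z y hxz _ ih =>
        have hz : (G.induce T).connectedComponentMk z = (G.induce T).connectedComponentMk v := by
          rw [← hx]
          exact (ConnectedComponent.sound hxz.reachable).symm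
        exact ih hz (hstep _ ⟨x, hx, rfl⟩ _ ⟨z, hz, rfl⟩ hxz hQx)
  obtain ⟨σ, hσ⟩ := hp.exists_isSubdivMinor hc hcc hcT
  refine hσ.hasInducedMinor ?_
  let row : Fin n ⊕ Fin n → Set (G.induce T).ConnectedComponent := fun a =>
    {x | ∃ i ≤ len a, p a i ∈ c x}
  have hrow : ∀ a x, x ∈ row a ↔ ∃ v ∈ P a, v ∈ c x := by
    intro a x
    constructor
    · rintro ⟨i, hi, hx⟩
      exact ⟨_, hmemP a i hi, hx⟩
    · rintro ⟨v, hv, hx⟩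
      obtain ⟨i, hi, rfl⟩ := hPmem a v hv
      exact ⟨i, hi, hx⟩
  have hcross : ∀ i j, (row (Sum.inl i) ∩ row (Sum.inr j)).Nonempty := by
    intro i j
    obtain ⟨u, hu, v, hv, huv⟩ := h.touch i j
    obtain ⟨C, hC⟩ := hTc u (hTmem (Sum.inl i) (Sum.inr j) (by simp) u hu v hv huv)
    obtain ⟨C', hC'⟩ := hTc v (hTmem (Sum.inr j) (Sum.inl i) (by simp) v hv u hu huv.symm)
    have := hc_adj C C' u v hC hC' huv
    subst this
    exact ⟨C, (hrow _ _).2 ⟨u, hu, hC⟩, (hrow _ _).2 ⟨v, hv, hC'⟩⟩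
  refine hn _ _ (fun i => row (Sum.inl i)) (fun j => row (Sum.inr j))
    (fun i => connSet_segmentGraph hTc hc_eq _ ((hcross i i).mono Set.inter_subset_left)) ?_
    (fun i => connSet_segmentGraph hTc hc_eq _ ((hcross i i).mono Set.inter_subset_right)) ?_ hcross
  · intro i i' hne
    refine Set.disjoint_left.2 fun x hx hx' => hne ?_
    obtain ⟨v, hv, hvx⟩ := (hrow _ _).1 hx
    obtain ⟨w, hw, hwx⟩ := (hrow _ _).1 hx'
    refine hAB.eq_of_mem h (hc x) (fun u hu => ?_) hvx hv hwx hw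
    rcases hTU u (hcT x hu) with ⟨i, hi, -⟩ | ⟨j, hj, i, hi⟩
    · exact Or.inl ⟨i, hi⟩
    · exact Or.inr ⟨j, i, hj, hi⟩
  · intro i i' hne
    refine Set.disjoint_left.2 fun x hx hx' => hne ?_
    obtain ⟨v, hv, hvx⟩ := (hrow _ _).1 hx
    obtain ⟨w, hw, hwx⟩ := (hrow _ _).1 hx'
    refine hBA.eq_of_mem h.symm (hc x) (fun u hu => ?_) hvx hv hwx hw
    rcases hTU u (hcT x hu) with ⟨i, hi, j, hj⟩ | ⟨j, hj, -⟩
    · exact Or.inr ⟨i, j, hi, hj⟩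
    · exact Or.inl ⟨j, hj⟩

theorem isModel_of_hasInducedMinor {V : Type} {G : SimpleGraph V} {f : ℕ}
    (h : HasInducedMinor G (completeBipartiteGraph (Fin f) (Fin f))) :
    ∃ A B : Fin f → Set V, IsModel G A B := by
  obtain ⟨D, hD, hDd, hDa⟩ := h
  have hconn : ∀ w, ConnSet G (D w) := fun w => connSet_iff.2 (hD w)
  refine ⟨fun i => D (Sum.inl i), fun j => D (Sum.inr j), fun i => hconn _, fun j => hconn _,
    fun i i' hne => ?_, fun i i' hne => ?_, fun i j => hDd (by simp), fun i j => ?_⟩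
  · have := (hDa (Sum.inl i) (Sum.inl i') (by simpa using hne)).not
    simpa using this
  · have := (hDa (Sum.inr i) (Sum.inr i') (by simpa using hne)).not
    simpa using this
  · exact touch_of_not_anticomplete ((hDa (Sum.inl i) (Sum.inr j) (by simp)).1 (by simp))
      (hDd (by simp))

end BicliqueMinor

/-- Theorem 1.3: for all positive `l, r, s` there is `f` such that every
graph with an induced minor isomorphic to `K_{f,f}` has an induced minor isomorphic to
the `r`-by-`r` wall, or contains an `(s,l)`-constellation. -/
theorem stmt0 (l r s : ℕ) (hl : 0 < l) (hr : 0 < r) (hs : 0 < s) :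
    ∃ f : ℕ, 0 < f ∧
      ∀ (V : Type) [Fintype V] (G : SimpleGraph V),
        HasInducedMinor G (completeBipartiteGraph (Fin f) (Fin f)) →
          HasInducedMinor G (Wall r) ∨
          ∃ W S : Set V, IsConstellationOn G W S ∧ S.ncard = s ∧
            (CompsOn G (W \ S)).ncard = l := by
  obtain ⟨n, hn⟩ := BicliqueMinor.exists_wall_of_ample r
  obtain ⟨k, hk⟩ := BicliqueMinor.exists_ample r s l n
  obtain ⟨f, hf⟩ := BicliqueMinor.exists_path_model r k
  refine ⟨f + 1, f.succ_pos, fun V _ G h => ?_⟩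
  obtain ⟨A, B, hAB⟩ := BicliqueMinor.isModel_of_hasInducedMinor h
  rcases hf V G _ _ (hAB.comp Fin.castSuccEmb Fin.castSuccEmb) with hw | ⟨A', B', hA', hB', h'⟩
  · exact Or.inl hw
  rcases hk V G A' B' h' hA' hB' with hw | hc | ⟨e, g, ha, ha'⟩
  · exact Or.inl hw
  · exact Or.inr hc
  · exact Or.inl (hn V G _ _ (h'.comp e g) (fun _ => hA' _) (fun _ => hB' _) ha ha')
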